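/- Let d ≥ 5, N ≥ 1 and let D ⊆ Z^d satisfy Q_{4N} ⊆ D. Let 𝒰 = 𝒰_D be the uniform spanning tree of the wired graph of D, and let 𝒰₀ be the component of the origin, i.e. the union of those paths of 𝒰 that do not contain the wired vertex as an interior vertex. Then there exist constants C, c > 0, depending only on d, such that for all λ > 0, P( |Q_N ∩ 𝒰₀| ≤ λ N⁴ ) ≤ C exp( -c λ^{-1/3} ). -/

import Mathlib

open MeasureTheory
open scoped ENNReal Classical

namespace USFPaper

/-- Vertices of the nearest-neighbour integer lattice `ℤ^d`. -/
abbrev V (d : ℕ) := Fin d → ℤ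

variable {d : ℕ}

/-- Nearest-neighbour adjacency in `ℤ^d`. -/
def adj (x y : V d) : Prop := (∑ i, |x i - y i|) = 1

/-- The cube `Q(x,r) = { y : ‖x - y‖_∞ ≤ r }`. -/
def cube (x : V d) (r : ℕ) : Set (V d) := { y | ∀ i, |y i - x i| ≤ (r : ℤ) }

/-- Euclidean distance on `ℤ^d`. -/
noncomputable def eudist (x y : V d) : ℝ := Real.sqrt (∑ i, ((x i : ℝ) - (y i : ℝ)) ^ 2)

/-- Configurations: subgraphs of `ℤ^d`, encoded by the indicator of their edge set
(on unordered pairs of vertices). -/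
abbrev Config (d : ℕ) := Sym2 (V d) → Bool

/-- `e` is an edge of the lattice `ℤ^d`. -/
def isLatticeEdge (e : Sym2 (V d)) : Prop := ∃ a b : V d, e = s(a, b) ∧ adj a b

/-- Spanning trees of the wired graph `G_A^W` obtained from `ℤ^d` by collapsing the
complement of the finite set `A` to a single vertex: sets `T` of lattice edges, each
with at least one endpoint in `A`, with exactly `|A|` edges, and such that every
vertex of `A` is joined by a path of edges of `T` to the (collapsed) complement
of `A`. -/
def wiredSpanningTrees (A : Set (V d)) : Set (Set (Sym2 (V d))) :=
  { T | (∀ e ∈ T, isLatticeEdge e ∧ ∃ v ∈ e, v ∈ A) ∧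
        T.ncard = A.ncard ∧
        ∀ x ∈ A, ∃ l : List (V d),
          l.Chain' (fun u w => adj u w ∧ s(u, w) ∈ T) ∧
          l.head? = some x ∧ ∃ y, l.getLast? = some y ∧ y ∉ A }

/-- The cylinder event prescribing the configuration on the finite edge set `K`. -/
def cylEvent (K : Finset (Sym2 (V d))) (f : Sym2 (V d) → Bool) : Set (Config d) :=
  { ω | ∀ e ∈ K, ω e = f e }

/-- `μ` is the weak limit of the uniform spanning trees of the wired graphs of the
exhausting sequence `Dseq`: for every cylinder event, the proportion of wired spanning
trees of `Dseq r` compatible with it converges to its `μ`-probability. -/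
def IsWiredLimit (Dseq : ℕ → Set (V d)) (μ : Measure (Config d)) : Prop :=
  ∀ (K : Finset (Sym2 (V d))) (f : Sym2 (V d) → Bool),
    Filter.Tendsto
      (fun r : ℕ =>
        ((Set.ncard { T ∈ wiredSpanningTrees (Dseq r) |
            ∀ e ∈ K, (e ∈ T ↔ f e = true) } : ℝ) /
         (Set.ncard (wiredSpanningTrees (Dseq r)) : ℝ)))
      Filter.atTop
      (nhds ((μ (cylEvent K f)).toReal))

/-- `μ` is the uniform spanning forest of `ℤ^d`: the weak limit of the uniform
spanning trees of the (wired) boxes `Q_r`. -/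
def IsUSF (μ : Measure (Config d)) : Prop :=
  IsWiredLimit (fun r => cube (0 : V d) r) μ

/-- The ball `B_𝒰(0,n)` of radius `n` about the origin in the intrinsic (graph)
metric of the configuration `ω`. -/
def ballU (ω : Config d) (n : ℕ) : Set (V d) :=
  { y | ∃ l : List (V d),
      l.Chain' (fun u w => adj u w ∧ ω s(u, w) = true) ∧
      l.head? = some 0 ∧ l.getLast? = some y ∧ l.length ≤ n + 1 }

/-- The component `𝒰₀` of the origin in the configuration `ω`, for a domain `D`:
all vertices joined to `0` by a path of open edges not leaving `D` (i.e. not passing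
through the collapsed vertex `r_D`). -/
def comp0In (D : Set (V d)) (ω : Config d) : Set (V d) :=
  { y | ∃ l : List (V d),
      l.Chain' (fun u w => adj u w ∧ ω s(u, w) = true) ∧
      l.head? = some 0 ∧ l.getLast? = some y ∧ ∀ v ∈ l, v ∈ D }

section
open Finset (mem_sdiff sum_le_sum mem_filter sum_congr mem_of_mem_erase sum_nonneg mul_sum sum_const single_le_sum sdiff_subset sum_le_sum_of_subset_of_nonneg mem_univ mem_inter erase_subset sum_add_distrib mem_range mem_erase sum_comm card_univ sum_mul_sum sum_eq_zero sum_div mem_Icc sum_mul prod_le_prod prod_congr erase_ssubset biUnion_subset)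
section
abbrev E (d : ℕ) := Fin d × Bool
def sg (b : Bool) : ℤ := if b then 1 else -1
def nb (x : V d) (e : E d) : V d := x + Pi.single e.1 (sg e.2)
noncomputable def av : (V d → ℝ) →ₗ[ℝ] (V d → ℝ) where
  toFun u x := (∑ e : E d, u (nb x e)) / (2 * d)
  map_add' u v := by
    ext x; simp [sum_add_distrib, add_div]
  map_smul' c u := by
    ext x; simp [← mul_sum, mul_div_assoc]
noncomputable def lap : (V d → ℝ) →ₗ[ℝ] (V d → ℝ) := LinearMap.id - av
lemma av_def (u : V d → ℝ) (x : V d) : av u x = (∑ e : E d, u (nb x e)) / (2 * d) := rfl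
lemma lap_def (u : V d → ℝ) (x : V d) : lap u x = u x - av u x := rfl
lemma card_E : (Fintype.card (E d) : ℝ) = 2 * d := by simp [E, mul_comm]
variable [hd : Fact (5 ≤ d)]
lemma dpos : (0 : ℝ) < d := by have := hd.out; exact_mod_cast (by omega : 0 < d)
lemma d2pos : (0 : ℝ) < 2 * d := by have := dpos (d := d); positivity
instance instNZ : NeZero d := ⟨by have := hd.out; omega⟩
lemma av_const (c : ℝ) (x : V d) : av (fun _ => c) x = c := by
  have := d2pos (d := d)
  rw [av_def, sum_const, nsmul_eq_mul, card_univ, card_E, mul_div_cancel_left₀ _ this.ne']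
lemma lap_const (c : ℝ) (x : V d) : lap (fun _ => c) x = 0 := by
  rw [lap_def, av_const]; simp
lemma av_mono {u v : V d → ℝ} {x : V d} (h : ∀ e, u (nb x e) ≤ v (nb x e)) : av u x ≤ av v x := by
  have := d2pos (d := d)
  rw [av_def, av_def]; gcongr; exact h _
lemma av_congr {u v : V d → ℝ} {x : V d} (h : ∀ e, u (nb x e) = v (nb x e)) : av u x = av v x :=
  le_antisymm (av_mono fun e => (h e).le) (av_mono fun e => (h e).ge)
def bdy (A : Finset (V d)) (y : V d) : Prop := y ∉ A ∧ ∃ x ∈ A, ∃ e, y = nb x e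
lemma mp (A : Finset (V d)) (u : V d → ℝ) (h1 : ∀ x ∈ A, 0 ≤ lap u x)
    (h0 : ∀ y, bdy A y → 0 ≤ u y) : ∀ x ∈ A, 0 ≤ u x := by
  by_contra hcon
  push Not at hcon
  obtain ⟨x0, hx0, hneg⟩ := hcon
  obtain ⟨x1, hx1, hmin⟩ := A.exists_min_image u ⟨x0, hx0⟩
  let B := A.filter (fun x => u x = u x1)
  have hB : B.Nonempty := ⟨x1, by simp [B, hx1]⟩
  obtain ⟨x, hx, hmax⟩ := B.exists_max_image (fun x => x 0) hB
  simp only [B, mem_filter] at hx hmax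
  have hlow : ∀ e, u x ≤ u (nb x e) := by
    intro e
    rw [hx.2]
    by_cases h : nb x e ∈ A
    · exact hmin _ h
    · have := h0 _ ⟨h, x, hx.1, e, rfl⟩
      have := hmin _ hx0
      linarith
  have hl := h1 x hx.1
  rw [lap_def, av_def] at hl
  have hdp := d2pos (d := d)
  have hs : ∑ e : E d, (u (nb x e) - u x) ≤ 0 := by
    rw [Finset.sum_sub_distrib, sum_const, nsmul_eq_mul, card_univ, card_E]
    have : (∑ e : E d, u (nb x e)) / (2 * d) ≤ u x := by linarith
    rw [div_le_iff₀ hdp] at this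
    linarith
  have heq : u (nb x (0, true)) = u x := by
    have h2 := single_le_sum (f := fun e : E d => u (nb x e) - u x)
      (fun e _ => sub_nonneg.mpr (hlow e)) (mem_univ ((0 : Fin d), true))
    have h3 := hlow (0, true)
    have h4 := le_trans h2 hs
    linarith
  have hmem : nb x (0, true) ∈ A := by
    by_contra h
    have h3 := h0 _ ⟨h, x, hx.1, _, rfl⟩
    have := hmin _ hx0
    rw [heq, hx.2] at h3
    linarith
  have h4 := hmax (nb x (0, true)) ⟨hmem, by rw [heq, hx.2]⟩
  simp [nb, sg] at h4
lemma mp_le (A : Finset (V d)) (u w : V d → ℝ) (h1 : ∀ x ∈ A, lap u x ≤ lap w x)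
    (h0 : ∀ y, bdy A y → u y ≤ w y) : ∀ x ∈ A, u x ≤ w x := by
  intro x hx
  have := mp A (w - u) (fun x hx => by have := h1 x hx; rw [map_sub]; exact sub_nonneg.mpr this)
    (fun y hy => by exact sub_nonneg.mpr (h0 y hy)) x hx
  exact sub_nonneg.mp this
lemma mp_le' (A : Finset (V d)) (u w : V d → ℝ) (h1 : ∀ x ∈ A, lap u x ≤ lap w x)
    (h0 : ∀ y, y ∉ A → u y ≤ w y) (x : V d) : u x ≤ w x := by
  by_cases h : x ∈ A
  · exact mp_le A u w h1 (fun y hy => h0 y hy.1) x h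
  · exact h0 x h
lemma mp_eq (A : Finset (V d)) (u w : V d → ℝ) (h1 : ∀ x ∈ A, lap u x = lap w x)
    (h0 : ∀ y, y ∉ A → u y = w y) (x : V d) : u x = w x :=
  le_antisymm (mp_le' A u w (fun x hx => (h1 x hx).le) (fun y hy => (h0 y hy).le) x)
    (mp_le' A w u (fun x hx => (h1 x hx).ge) (fun y hy => (h0 y hy).ge) x)
noncomputable def ext0 (A : Finset (V d)) : (A → ℝ) →ₗ[ℝ] (V d → ℝ) where
  toFun u x := if h : x ∈ A then u ⟨x, h⟩ else 0
  map_add' u v := by ext x; by_cases h : x ∈ A <;> simp [h]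
  map_smul' c u := by ext x; by_cases h : x ∈ A <;> simp [h]
lemma sol_exists (A : Finset (V d)) (φ ψ : V d → ℝ) :
    ∃ u : V d → ℝ, (∀ x ∉ A, u x = φ x) ∧ ∀ x ∈ A, lap u x = ψ x := by
  let T : (A → ℝ) →ₗ[ℝ] (A → ℝ) := (LinearMap.funLeft ℝ ℝ (Subtype.val : A → V d)) ∘ₗ lap ∘ₗ ext0 A
  have hT : ∀ u (x : A), T u x = lap (ext0 A u) x := fun u x => rfl
  have hinj : Function.Injective T := by
    rw [← LinearMap.ker_eq_bot, LinearMap.ker_eq_bot']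
    intro u hu
    have := mp_eq A (ext0 A u) 0 (fun x hx => by
      have := congrFun hu ⟨x, hx⟩
      rw [hT] at this; simpa using this) (fun y hy => by simp [ext0, hy])
    ext x
    have h2 := this x
    simpa [ext0] using h2
  have hsurj := LinearMap.injective_iff_surjective.mp hinj
  let φ0 : V d → ℝ := fun x => if x ∈ A then 0 else φ x
  obtain ⟨u, hu⟩ := hsurj (fun x => ψ x - lap φ0 x)
  refine ⟨ext0 A u + φ0, fun x hx => by simp [ext0, φ0, hx], fun x hx => ?_⟩
  have := congrFun hu ⟨x, hx⟩
  rw [hT] at this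
  simp only [map_add, Pi.add_apply, this]; ring
noncomputable def sol (A : Finset (V d)) (φ ψ : V d → ℝ) : V d → ℝ := (sol_exists A φ ψ).choose
lemma sol_off {A : Finset (V d)} {φ ψ : V d → ℝ} {x : V d} (h : x ∉ A) : sol A φ ψ x = φ x :=
  (sol_exists A φ ψ).choose_spec.1 x h
lemma sol_lap {A : Finset (V d)} {φ ψ : V d → ℝ} {x : V d} (h : x ∈ A) : lap (sol A φ ψ) x = ψ x :=
  (sol_exists A φ ψ).choose_spec.2 x h
noncomputable def ind (R : Set (V d)) (x : V d) : ℝ := if x ∈ R then 1 else 0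
lemma ind_nonneg (R : Set (V d)) (x : V d) : 0 ≤ ind R x := by unfold ind; split_ifs <;> norm_num
lemma ind_le (R : Set (V d)) (x : V d) : ind R x ≤ 1 := by unfold ind; split_ifs <;> norm_num
lemma ind_mem {R : Set (V d)} {x : V d} (h : x ∈ R) : ind R x = 1 := by simp [ind, h]
lemma ind_not {R : Set (V d)} {x : V d} (h : x ∉ R) : ind R x = 0 := by simp [ind, h]
noncomputable def hm (A : Finset (V d)) (R : Set (V d)) : V d → ℝ := sol A (ind R) 0
noncomputable def gr (A : Finset (V d)) (v : V d) : V d → ℝ := sol A 0 (ind {v})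
lemma hm_off {A : Finset (V d)} {R : Set (V d)} {x : V d} (h : x ∉ A) : hm A R x = ind R x := sol_off h
lemma hm_lap {A : Finset (V d)} {R : Set (V d)} {x : V d} (h : x ∈ A) : lap (hm A R) x = 0 := sol_lap h
lemma gr_off {A : Finset (V d)} {v x : V d} (h : x ∉ A) : gr A v x = 0 := sol_off h
lemma gr_lap {A : Finset (V d)} {v x : V d} (h : x ∈ A) : lap (gr A v) x = ind {v} x := sol_lap h
lemma hm_nonneg (A : Finset (V d)) (R : Set (V d)) (x : V d) : 0 ≤ hm A R x :=
  mp_le' A 0 _ (fun x hx => by simp [hm_lap hx]) (fun y hy => by rw [hm_off hy]; exact ind_nonneg _ _) x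
lemma hm_le_one (A : Finset (V d)) (R : Set (V d)) (x : V d) : hm A R x ≤ 1 :=
  mp_le' A _ (fun _ => 1) (fun x hx => by rw [hm_lap hx, lap_const])
    (fun y hy => by rw [hm_off hy]; exact ind_le _ _) x
lemma gr_nonneg (A : Finset (V d)) (v x : V d) : 0 ≤ gr A v x :=
  mp_le' A 0 _ (fun x hx => by simpa [gr_lap hx] using ind_nonneg _ _) (fun y hy => by simp [gr_off hy]) x
lemma hm_le_of {A : Finset (V d)} {R : Set (V d)} {u : V d → ℝ} (h1 : ∀ x ∈ A, 0 ≤ lap u x)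
    (h0 : ∀ x, x ∉ A → ind R x ≤ u x) (x : V d) : hm A R x ≤ u x :=
  mp_le' A _ u (fun x hx => by rw [hm_lap hx]; exact h1 x hx) (fun y hy => by rw [hm_off hy]; exact h0 y hy) x
lemma nonneg_avg {u : V d → ℝ} (hu : ∀ x, 0 ≤ u x) (x : V d) : 0 ≤ av u x := by
  have := d2pos (d := d); rw [av_def]
  exact div_nonneg (sum_nonneg fun e _ => hu _) this.le
lemma gr_le_of {A : Finset (V d)} {v : V d} {u : V d → ℝ} (h1 : ∀ x ∈ A, ind {v} x ≤ lap u x)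
    (h0 : ∀ x, x ∉ A → 0 ≤ u x) (x : V d) : gr A v x ≤ u x :=
  mp_le' A _ u (fun x hx => by rw [gr_lap hx]; exact h1 x hx) (fun y hy => by rw [gr_off hy]; exact h0 y hy) x
lemma gr_self_ge {A : Finset (V d)} {v : V d} (h : v ∈ A) : 1 ≤ gr A v v := by
  have h1 := gr_lap (v := v) h
  rw [lap_def, ind_mem (Set.mem_singleton _)] at h1
  have := nonneg_avg (gr_nonneg A v) v
  linarith
lemma gr_mono {A B : Finset (V d)} (h : A ⊆ B) (v x : V d) : gr A v x ≤ gr B v x :=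
  gr_le_of (fun x hx => (gr_lap (h hx)).ge) (fun x _ => gr_nonneg _ _ _) x
lemma sol_erase {A : Finset (V d)} {x : V d} (hx : x ∈ A) {u w : V d → ℝ}
    (hu : ∀ y ∈ A.erase x, lap u y = lap w y) (hux : lap u x = 0) (hw : w x = 0)
    (h0 : ∀ y, y ∉ A → u y = w y) : u x = gr A x x * av w x := by
  have key : ∀ y, u y = (w + (u x) • hm (A.erase x) {x}) y := by
    refine mp_eq (A.erase x) _ _ (fun y hy => ?_) (fun y hy => ?_)
    · simp [hu y hy, hm_lap hy]
    · by_cases hyx : y = x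
      · subst hyx; simp [hw, hm_off hy, ind]
      · have : y ∉ A := fun h => hy (by simp [h, hyx])
        simp [h0 y this, hm_off hy, ind, hyx]
  have key2 : ∀ y, gr A x y = ((gr A x x) • hm (A.erase x) {x}) y := by
    refine mp_eq (A.erase x) _ _ (fun y hy => ?_) (fun y hy => ?_)
    · have h1 : y ∈ A := mem_of_mem_erase hy
      have h2 : y ≠ x := Finset.ne_of_mem_erase hy
      simp [gr_lap h1, hm_lap hy, ind, h2]
    · by_cases hyx : y = x
      · subst hyx; simp [hm_off hy, ind]
      · have : y ∉ A := fun h => hy (by simp [h, hyx])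
        simp [gr_off this, hm_off hy, ind, hyx]
  have e1 : av u x = av w x + u x * av (hm (A.erase x) {x}) x := by
    rw [show u = w + (u x) • hm (A.erase x) {x} from funext key]
    simp [hw, hm_off (Finset.notMem_erase x A), ind]
  have e2 : av (gr A x) x = gr A x x * av (hm (A.erase x) {x}) x := by
    conv_lhs => rw [show gr A x = (gr A x x) • hm (A.erase x) {x} from funext key2]
    simp
  have e3 := gr_lap (v := x) hx
  rw [lap_def, ind_mem (Set.mem_singleton _)] at e3
  rw [lap_def] at hux
  have e4 : u x * (gr A x x - gr A x x * av (hm (A.erase x) {x}) x) = u x := by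
    rw [← e2, e3, mul_one]
  have e5 : u x - u x * av (hm (A.erase x) {x}) x = av w x := by linarith
  rw [← e5]
  linarith
lemma hm_erase {A : Finset (V d)} {x : V d} (hx : x ∈ A) {R : Set (V d)} (hR : x ∉ R) :
    hm A R x = gr A x x * av (hm (A.erase x) R) x := by
  refine sol_erase hx (fun y hy => ?_) (hm_lap hx) (by rw [hm_off (by simp), ind_not hR]) (fun y hy => ?_)
  · rw [hm_lap hy, hm_lap (mem_of_mem_erase hy)]
  · rw [hm_off hy, hm_off (fun h => hy (mem_of_mem_erase h))]
lemma gr_erase {A : Finset (V d)} {x v : V d} (hx : x ∈ A) (hv : x ≠ v) :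
    gr A v x = gr A x x * av (gr (A.erase x) v) x := by
  refine sol_erase hx (fun y hy => ?_) (by rw [gr_lap hx, ind_not (by simpa using hv)]) (gr_off (by simp))
    (fun y hy => ?_)
  · rw [gr_lap hy, gr_lap (mem_of_mem_erase hy)]
  · rw [gr_off hy, gr_off (fun h => hy (mem_of_mem_erase h))]
lemma hm_mono {A B : Finset (V d)} (h : A ⊆ B) {R : Set (V d)} (hR : ∀ x ∈ R, x ∉ B)
    (x : V d) : hm A R x ≤ hm B R x := by
  refine hm_le_of (fun x hx => (hm_lap (h hx)).ge) (fun x hx => ?_) x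
  by_cases hxr : x ∈ R
  · rw [hm_off (hR x hxr)]
  · rw [ind_not hxr]; exact hm_nonneg _ _ _
lemma step_le {u : V d → ℝ} (hu : ∀ y, 0 ≤ u y) {x : V d} (hx : 0 ≤ lap u x) (e : E d) :
    u (nb x e) / (2 * d) ≤ u x := by
  have := d2pos (d := d)
  rw [lap_def, av_def] at hx
  have h1 := single_le_sum (f := fun e : E d => u (nb x e)) (fun e _ => hu _) (mem_univ e)
  have h2 : u (nb x e) / (2 * d) ≤ (∑ e : E d, u (nb x e)) / (2 * d) := by gcongr
  linarith
end

section
variable [hd : Fact (5 ≤ d)]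
lemma ind_er {P : Finset (V d) → V d → Prop} (h0 : ∀ A x, x ∉ A → P A x)
    (h1 : ∀ A x, x ∈ A → (∀ y, P (A.erase x) y) → P A x) (A : Finset (V d)) : ∀ x, P A x := by
  induction A using Finset.strongInduction with
  | H A ih =>
    intro x
    by_cases hx : x ∈ A
    · exact h1 A x hx (fun y => ih _ (erase_ssubset hx) y)
    · exact h0 A x hx
noncomputable def LW (R : Set (V d)) (A : Finset (V d)) (x : V d) (F : List (V d) → ℝ) : ℝ :=
  if _h : x ∈ A then gr A x x * av (fun y => LW R (A.erase x) y (fun l => F (x :: l))) x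
  else ind R x * F []
termination_by A.card
decreasing_by exact Finset.card_erase_lt_of_mem _h
lemma LW_in {R : Set (V d)} {A : Finset (V d)} {x : V d} (h : x ∈ A) (F : List (V d) → ℝ) :
    LW R A x F = gr A x x * av (fun y => LW R (A.erase x) y (fun l => F (x :: l))) x := by
  rw [LW]; simp [h]
lemma LW_off {R : Set (V d)} {A : Finset (V d)} {x : V d} (h : x ∉ A) (F : List (V d) → ℝ) :
    LW R A x F = ind R x * F [] := by
  rw [LW]; simp [h]
lemma LW_mono' (R : Set (V d)) (A : Finset (V d)) (x : V d) : ∀ {F G : List (V d) → ℝ},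
    (∀ l, (∀ v ∈ l, v ∈ A) → F l ≤ G l) → LW R A x F ≤ LW R A x G := by
  refine ind_er (P := fun A x => ∀ {F G : List (V d) → ℝ},
    (∀ l, (∀ v ∈ l, v ∈ A) → F l ≤ G l) → LW R A x F ≤ LW R A x G) ?_ ?_ A x
  · intro A x hx F G h
    rw [LW_off hx, LW_off hx]
    exact mul_le_mul_of_nonneg_left (h _ (by simp)) (ind_nonneg _ _)
  · intro A x hx ih F G h
    rw [LW_in hx, LW_in hx]
    refine mul_le_mul_of_nonneg_left (av_mono fun e => ih _ fun l hl => h _ ?_) (gr_nonneg _ _ _)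
    intro v hv
    rcases List.mem_cons.mp hv with rfl | hv
    · exact hx
    · exact mem_of_mem_erase (hl v hv)
lemma LW_mono (R : Set (V d)) (A : Finset (V d)) (x : V d) {F G : List (V d) → ℝ}
    (h : ∀ l, F l ≤ G l) : LW R A x F ≤ LW R A x G := LW_mono' R A x fun l _ => h l
lemma LW_lin (R : Set (V d)) (A : Finset (V d)) (x : V d) : ∀ (a b : ℝ) (F G : List (V d) → ℝ),
    LW R A x (fun l => a * F l + b * G l) = a * LW R A x F + b * LW R A x G := by
  refine ind_er (P := fun A x => ∀ (a b : ℝ) (F G : List (V d) → ℝ),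
    LW R A x (fun l => a * F l + b * G l) = a * LW R A x F + b * LW R A x G) ?_ ?_ A x
  · intro A x hx a b F G
    rw [LW_off hx, LW_off hx, LW_off hx]; ring
  · intro A x hx ih a b F G
    rw [LW_in hx, LW_in hx, LW_in hx]
    simp only [ih]
    have : (fun y => a * LW R (A.erase x) y (fun l => F (x :: l)) + b * LW R (A.erase x) y (fun l => G (x :: l)))
      = a • (fun y => LW R (A.erase x) y (fun l => F (x :: l))) + b • (fun y => LW R (A.erase x) y (fun l => G (x :: l))) := by
      ext y; simp
    rw [this, map_add, map_smul, map_smul]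
    simp only [Pi.add_apply, Pi.smul_apply, smul_eq_mul]; ring
lemma LW_add (R : Set (V d)) (A : Finset (V d)) (x : V d) (F G : List (V d) → ℝ) :
    LW R A x (fun l => F l + G l) = LW R A x F + LW R A x G := by
  simpa using LW_lin R A x 1 1 F G
lemma LW_smul (R : Set (V d)) (A : Finset (V d)) (x : V d) (a : ℝ) (F : List (V d) → ℝ) :
    LW R A x (fun l => a * F l) = a * LW R A x F := by
  simpa using LW_lin R A x a 0 F F
lemma LW_zero (R : Set (V d)) (A : Finset (V d)) (x : V d) : LW R A x (fun _ => 0) = 0 := by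
  simpa using LW_lin R A x 0 0 (fun _ => 0) (fun _ => 0)
lemma LW_sum {ι : Type*} (s : Finset ι) (R : Set (V d)) (A : Finset (V d)) (x : V d)
    (F : ι → List (V d) → ℝ) :
    LW R A x (fun l => ∑ i ∈ s, F i l) = ∑ i ∈ s, LW R A x (F i) := by
  induction s using Finset.induction_on with
  | empty => simpa using LW_zero R A x
  | insert a s ha ih => simp only [Finset.sum_insert ha]; rw [LW_add, ih]
lemma LW_nonneg (R : Set (V d)) (A : Finset (V d)) (x : V d) {F : List (V d) → ℝ} (h : ∀ l, 0 ≤ F l) :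
    0 ≤ LW R A x F := by
  rw [← LW_zero R A x]; exact LW_mono R A x h
lemma LW_one (R : Set (V d)) (A : Finset (V d)) (x : V d) : (∀ y ∈ R, y ∉ A) →
    LW R A x (fun _ => 1) = hm A R x := by
  refine ind_er (P := fun A x => (∀ y ∈ R, y ∉ A) → LW R A x (fun _ => 1) = hm A R x) ?_ ?_ A x
  · intro A x hx _
    rw [LW_off hx, hm_off hx, mul_one]
  · intro A x hx ih hR
    rw [LW_in hx, hm_erase hx (fun h => hR x h hx)]
    congr 1
    refine av_congr fun e => ih _ (fun z hz h => hR z hz (mem_of_mem_erase h))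
noncomputable def ib (p : Prop) : ℝ := if p then 1 else 0
lemma ib_nonneg (p : Prop) : 0 ≤ ib p := by unfold ib; split_ifs <;> norm_num
lemma ib_le (p : Prop) : ib p ≤ 1 := by unfold ib; split_ifs <;> norm_num
lemma ib_true {p : Prop} (h : p) : ib p = 1 := by simp [ib, h]
lemma ib_false {p : Prop} (h : ¬ p) : ib p = 0 := by simp [ib, h]
lemma ib_mono {p q : Prop} (h : p → q) : ib p ≤ ib q := by
  by_cases hp : p
  · rw [ib_true hp, ib_true (h hp)]
  · rw [ib_false hp]; exact ib_nonneg _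
lemma av_mul_right (u : V d → ℝ) (c : ℝ) (x : V d) : av (fun y => u y * c) x = av u x * c := by
  have : (fun y => u y * c) = c • u := by ext y; simp [mul_comm]
  rw [this, map_smul]; simp [mul_comm]
lemma LW_pt (R : Set (V d)) (v : V d) (A : Finset (V d)) (x : V d) : (∀ y ∈ R, y ∉ A) →
    LW R A x (fun l => ib (v ∈ l)) ≤ gr A v x * hm A R v := by
  refine ind_er (P := fun A x => (∀ y ∈ R, y ∉ A) →
    LW R A x (fun l => ib (v ∈ l)) ≤ gr A v x * hm A R v) ?_ ?_ A x
  · intro A x hx _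
    rw [LW_off hx]; simp [ib, gr_off hx]
  · intro A x hx ih hR
    by_cases hv : x = v
    · subst hv
      calc _ ≤ LW R A x (fun _ => 1) := LW_mono R A x fun l => ib_le _
        _ = 1 * hm A R x := by rw [LW_one R A x hR, one_mul]
        _ ≤ _ := mul_le_mul_of_nonneg_right (gr_self_ge hx) (hm_nonneg _ _ _)
    · rw [LW_in hx, gr_erase hx hv, mul_assoc]
      refine mul_le_mul_of_nonneg_left ?_ (gr_nonneg _ _ _)
      rw [← av_mul_right]
      refine av_mono fun e => ?_
      have e1 : (fun l => ib (v ∈ x :: l)) = fun l => ib (v ∈ l) := by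
        ext l; simp [ib, Ne.symm hv]
      rw [e1]
      refine (ih _ (fun z hz h => hR z hz (mem_of_mem_erase h))).trans ?_
      exact mul_le_mul_of_nonneg_left (hm_mono (erase_subset _ _) hR _) (gr_nonneg _ _ _)
lemma LW_pt2 (R : Set (V d)) (v w : V d) (A : Finset (V d)) (x : V d) : (∀ y ∈ R, y ∉ A) →
    LW R A x (fun l => ib (v ∈ l ∧ w ∈ l)) ≤
      gr A v x * (gr A w v * hm A R w) + gr A w x * (gr A v w * hm A R v) := by
  refine ind_er (P := fun A x => (∀ y ∈ R, y ∉ A) → LW R A x (fun l => ib (v ∈ l ∧ w ∈ l)) ≤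
      gr A v x * (gr A w v * hm A R w) + gr A w x * (gr A v w * hm A R v)) ?_ ?_ A x
  · intro A x hx _
    rw [LW_off hx]; simp [ib, gr_off hx]
  · intro A x hx ih hR
    have nn : ∀ a b c : V d, 0 ≤ gr A a b * hm A R c := fun a b c => mul_nonneg (gr_nonneg _ _ _) (hm_nonneg _ _ _)
    by_cases hv : x = v
    · subst hv
      calc _ ≤ LW R A x (fun l => ib (w ∈ l)) := LW_mono R A x fun l => ib_mono fun h => h.2
        _ ≤ 1 * (gr A w x * hm A R w) := by rw [one_mul]; exact LW_pt R w A x hR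
        _ ≤ gr A x x * (gr A w x * hm A R w) := mul_le_mul_of_nonneg_right (gr_self_ge hx) (nn _ _ _)
        _ ≤ _ := le_add_of_nonneg_right (mul_nonneg (gr_nonneg _ _ _) (nn _ _ _))
    by_cases hw : x = w
    · subst hw
      calc _ ≤ LW R A x (fun l => ib (v ∈ l)) := LW_mono R A x fun l => ib_mono fun h => h.1
        _ ≤ 1 * (gr A v x * hm A R v) := by rw [one_mul]; exact LW_pt R v A x hR
        _ ≤ gr A x x * (gr A v x * hm A R v) := mul_le_mul_of_nonneg_right (gr_self_ge hx) (nn _ _ _)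
        _ ≤ _ := le_add_of_nonneg_left (mul_nonneg (gr_nonneg _ _ _) (nn _ _ _))
    · rw [LW_in hx, gr_erase hx hv, gr_erase hx hw, mul_assoc, mul_assoc, ← mul_add]
      refine mul_le_mul_of_nonneg_left ?_ (gr_nonneg _ _ _)
      rw [← av_mul_right, ← av_mul_right, ← Pi.add_apply, ← map_add]
      refine av_mono fun e => ?_
      have e1 : (fun l => ib (v ∈ x :: l ∧ w ∈ x :: l)) = fun l => ib (v ∈ l ∧ w ∈ l) := by
        ext l; simp [ib, Ne.symm hv, Ne.symm hw]
      rw [e1]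
      have hs := erase_subset x A
      refine (ih _ (fun z hz h => hR z hz (mem_of_mem_erase h))).trans ?_
      simp only [Pi.add_apply]
      gcongr
      · exact gr_nonneg _ _ _
      · exact hm_nonneg _ _ _
      · exact gr_nonneg _ _ _
      · exact gr_mono hs _ _
      · exact hm_mono hs hR _
      · exact gr_nonneg _ _ _
      · exact hm_nonneg _ _ _
      · exact gr_nonneg _ _ _
      · exact gr_mono hs _ _
      · exact hm_mono hs hR _
def hits (L b : Finset (V d)) (l : List (V d)) : Prop := ∃ v ∈ l.takeWhile (fun v => decide (v ∈ L)), v ∈ b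
lemma LW_lower (R : Set (V d)) (L b : Finset (V d)) (A : Finset (V d)) (x : V d) :
    (∀ y ∈ R, y ∉ A) → b ⊆ A → b ⊆ L → ∀ ψ : List (V d) → ℝ,
    (∀ l, (∀ v ∈ l, v ∈ A ∧ v ∈ L ∧ v ∉ b) → ∀ w ∈ b, ψ l ≤ hm (A \ l.toFinset) R w) →
    LW b ((A ∩ L) \ b) x ψ ≤ LW R A x (fun l => ib (hits L b l)) := by
  refine ind_er (P := fun A x => (∀ y ∈ R, y ∉ A) → b ⊆ A → b ⊆ L → ∀ ψ : List (V d) → ℝ,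
    (∀ l, (∀ v ∈ l, v ∈ A ∧ v ∈ L ∧ v ∉ b) → ∀ w ∈ b, ψ l ≤ hm (A \ l.toFinset) R w) →
    LW b ((A ∩ L) \ b) x ψ ≤ LW R A x (fun l => ib (hits L b l))) ?_ ?_ A x
  · intro A x hx _ hbA _ ψ _
    rw [LW_off (by simp [hx]), LW_off hx, ind_not (fun h => hx (hbA h)), zero_mul]
    exact mul_nonneg (ind_nonneg _ _) (ib_nonneg _)
  · intro A x hx ih hR hbA hbL ψ hψ
    by_cases hb : x ∈ b
    · rw [LW_off (by simp [hb]), LW_in hx]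
      have := hψ [] (by simp) x hb
      have e1 : (fun l => ib (hits L b (x :: l))) = fun _ => 1 := by
        ext l; exact ib_true ⟨x, by simp [hbL hb], hb⟩
      rw [e1, ← LW_in hx (fun _ => 1), LW_one R A x hR, ind_mem (by exact_mod_cast hb), one_mul]
      simpa using this
    by_cases hL : x ∈ L
    · have hx1 : x ∈ (A ∩ L) \ b := by simp [hx, hL, hb]
      rw [LW_in hx1, LW_in hx]
      have e1 : (fun l => ib (hits L b (x :: l))) = fun l => ib (hits L b l) := by
        ext l; simp [hits, hL, hb]
      have e2 : ((A ∩ L) \ b).erase x = (A.erase x ∩ L) \ b := by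
        ext y; simp; tauto
      rw [e1, e2]
      have h0 : 0 ≤ av (fun y => LW R (A.erase x) y (fun l => ib (hits L b l))) x :=
        nonneg_avg (fun y => LW_nonneg _ _ _ fun l => ib_nonneg _) x
      refine le_trans (mul_le_mul_of_nonneg_left (av_mono fun e => ?_) (gr_nonneg _ _ _))
        (mul_le_mul_of_nonneg_right (gr_mono (fun y => by simp; tauto) x x) h0)
      refine ih _ (fun z hz h => hR z hz (mem_of_mem_erase h))
        (fun y hy => mem_erase.mpr ⟨fun h => hb (h ▸ hy), hbA hy⟩) hbL _ (fun l hl w hw => ?_)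
      have := hψ (x :: l) (fun v hv => ?_) w hw
      · rwa [show A \ (x :: l).toFinset = A.erase x \ l.toFinset by ext y; simp; tauto] at this
      · rcases List.mem_cons.mp hv with rfl | hv
        · exact ⟨hx, hL, hb⟩
        · exact ⟨mem_of_mem_erase (hl v hv).1, (hl v hv).2⟩
    · rw [LW_off (by simp [hL]), ind_not (by exact_mod_cast hb), zero_mul]
      exact LW_nonneg _ _ _ fun l => ib_nonneg _
end

section
variable [hd : Fact (5 ≤ d)]
lemma taylor_rpow (b : ℝ) : ∃ c3 C δ : ℝ, 0 < C ∧ 0 < δ ∧ δ < 1 ∧ ∀ z : ℝ, |z| ≤ δ →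
    |(1 + z) ^ b - (1 + b * z + b * (b - 1) / 2 * z ^ 2 + c3 * z ^ 3)| ≤ C * z ^ 4 := by
  have h := (Real.one_add_rpow_hasFPowerSeriesAt_zero (a := b)).isBigO_sub_partialSum_pow 4
  obtain ⟨C, hC⟩ := h.bound
  rw [Metric.eventually_nhds_iff] at hC
  obtain ⟨δ, hδ, hC⟩ := hC
  refine ⟨Ring.choose b 3, max C 1, min (δ / 2) (1 / 2), by positivity, by positivity, by
    have := min_le_right (δ/2) (1/2); linarith, fun z hz => ?_⟩
  have h1 := hC (y := z) (by
    rw [dist_zero_right, Real.norm_eq_abs]; have := min_le_left (δ/2) (1/2); linarith)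
  have e2 : Ring.choose b 2 = b * (b - 1) / 2 := by
    have := Ring.descPochhammer_eq_factorial_smul_choose b 2
    simp [descPochhammer_succ_right, Polynomial.smeval_sub, Polynomial.smeval_mul, Nat.factorial] at this
    linarith
  simp only [FormalMultilinearSeries.partialSum, Finset.sum_range_succ, Finset.sum_range_zero, binomialSeries_apply] at h1
  simp [Ring.choose_zero_right, Ring.choose_one_right, e2] at h1
  have e4 : |z| ^ 4 = z ^ 4 := by rw [← abs_pow]; exact abs_of_nonneg (by positivity)
  rw [e4] at h1
  refine le_trans (le_of_eq ?_) (h1.trans (mul_le_mul_of_nonneg_right (le_max_left _ _) (by positivity)))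
  congr 1; ring
noncomputable def nsq (x : V d) : ℝ := ∑ i, (x i : ℝ) ^ 2
lemma nsq_nonneg (x : V d) : 0 ≤ nsq x := sum_nonneg fun i _ => sq_nonneg _
lemma nsq_nb (x : V d) (e : E d) : nsq (nb x e) = nsq x + (1 + 2 * (sg e.2) * x e.1) := by
  have : ∀ i, ((nb x e i : ℤ) : ℝ) ^ 2 = (x i : ℝ) ^ 2 + if i = e.1 then (1 + 2 * (sg e.2 : ℝ) * x e.1) else 0 := by
    intro i
    unfold nb
    by_cases h : i = e.1
    · subst h; rcases e with ⟨i, b⟩; cases b <;> simp [sg] <;> ring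
    · simp [h]
  unfold nsq
  simp_rw [this, sum_add_distrib]; simp
lemma sumE (F : Fin d → ℝ → ℝ) : ∑ e : E d, F e.1 (sg e.2 : ℝ) = ∑ i, (F i 1 + F i (-1)) := by
  rw [Fintype.sum_prod_type]; simp [sg]
noncomputable def ea (d : ℕ) : ℝ := ((d : ℝ) - 2) / 2
lemma d5 : (5 : ℝ) ≤ d := by exact_mod_cast hd.out
noncomputable def fk (κ : ℝ) (x : V d) : ℝ := (κ + nsq x) ^ (-(ea d))
lemma sum_x4 (x : V d) : ∑ i, (x i : ℝ) ^ 4 ≤ nsq x ^ 2 := by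
  have : ∀ i ∈ Finset.univ, (x i : ℝ) ^ 4 ≤ (x i : ℝ)^2 * nsq x := by
    intro i _
    have : (x i : ℝ)^2 ≤ nsq x := single_le_sum (f := fun i => (x i : ℝ)^2) (fun i _ => sq_nonneg _) (mem_univ i)
    nlinarith [sq_nonneg (x i : ℝ)]
  refine (sum_le_sum this).trans (le_of_eq ?_)
  rw [← sum_mul, sq]; rfl
lemma fk_lap_expand : ∃ C u0 : ℝ, 0 < C ∧ 1 ≤ u0 ∧ ∀ (κ : ℝ) (x : V d), u0 ≤ κ + nsq x → |κ| ≤ κ + nsq x →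
    |2 * d * (-(lap (fk κ) x)) - (κ + nsq x) ^ (-(ea d) - 2) * (ea d * d / 4 * (2 * d - 8 * κ))| ≤
      (κ + nsq x) ^ (-(ea d) - 2) * C := by
  obtain ⟨c3, C, δ, hC, hδ, hδ1, hT⟩ := taylor_rpow (-(ea d))
  have hd5 := d5 (d := d)
  refine ⟨|c3| * (2 * d + 48) + C * (16 * d + 1024), max 1 (16 / δ ^ 2), by positivity, le_max_left _ _, fun κ x hu hκ => ?_⟩
  set u := κ + nsq x with hudef
  have hu1 : 1 ≤ u := (le_max_left _ _).trans hu
  have hu2 : 16 / δ ^ 2 ≤ u := (le_max_right _ _).trans hu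
  have hu0 : 0 < u := by linarith
  have hn : nsq x ≤ 2 * u := by have := abs_le.mp hκ; linarith
  have hn0 := nsq_nonneg x
  set z : E d → ℝ := fun e => (1 + 2 * (sg e.2) * x e.1) / u with hz
  have hzδ : ∀ e, |z e| ≤ δ := by
    intro e
    have h1 : (x e.1 : ℝ)^2 ≤ nsq x := single_le_sum (f := fun i => (x i : ℝ)^2) (fun i _ => sq_nonneg _) (mem_univ e.1)
    have hs : (sg e.2 : ℝ) ^ 2 = 1 := by rcases e with ⟨i, b⟩; cases b <;> simp [sg]
    have h2 : (1 + 2 * (sg e.2 : ℝ) * x e.1) ^ 2 ≤ 16 * u := by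
      nlinarith [sq_nonneg ((sg e.2 : ℝ) * x e.1 - 1), sq_nonneg ((sg e.2 : ℝ) * x e.1)]
    have h3 : (z e) ^ 2 ≤ δ ^ 2 := by
      rw [hz]; simp only [div_pow]
      rw [div_le_iff₀ (by positivity)]
      rw [div_le_iff₀ (by positivity)] at hu2
      nlinarith
    exact abs_le_of_sq_le_sq h3 hδ.le
  have hfe : ∀ e, fk κ (nb x e) = u ^ (-(ea d)) * (1 + z e) ^ (-(ea d)) := by
    intro e
    have := abs_le.mp (hzδ e)
    rw [← Real.mul_rpow hu0.le (by linarith)]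
    unfold fk; congr 1; rw [nsq_nb, hz]; field_simp; ring
  have hlap : 2 * d * (-(lap (fk κ) x)) = u ^ (-(ea d)) * ∑ e, ((1 + z e) ^ (-(ea d)) - 1) := by
    rw [lap_def, av_def, Finset.sum_sub_distrib, mul_sub, mul_sum, sum_const, nsmul_eq_mul, card_univ, card_E]
    simp_rw [← hfe]
    have : fk κ x = u ^ (-(ea d)) := rfl
    rw [this]; field_simp; ring
  have s1 : ∑ e, z e = 2 * d / u := by
    rw [hz, ← sum_div, sumE (fun i s => 1 + 2 * s * (x i : ℝ))]
    congr 1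
    rw [sum_congr rfl (fun i _ => show _ = (2 : ℝ) by ring)]
    simp; ring
  have s2 : ∑ e, z e ^ 2 = 8 / u + (2 * d - 8 * κ) / u ^ 2 := by
    simp only [hz, div_pow]
    rw [← sum_div, sumE (fun i s => (1 + 2 * s * (x i : ℝ)) ^ 2),
      sum_congr rfl (fun i _ => show _ = (2 : ℝ) + 8 * (x i : ℝ) ^ 2 by ring), sum_add_distrib,
      ← mul_sum]
    simp only [sum_const, card_univ, Fintype.card_fin, nsmul_eq_mul]
    have : nsq x = u - κ := by rw [hudef]; ring
    rw [show (∑ i, (x i : ℝ) ^ 2) = u - κ from this]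
    field_simp; ring
  have s3 : |∑ e, z e ^ 3| ≤ (2 * d + 48) / u ^ 2 := by
    simp only [hz, div_pow]
    rw [← sum_div, sumE (fun i s => (1 + 2 * s * (x i : ℝ)) ^ 3),
      sum_congr rfl (fun i _ => show _ = (2 : ℝ) + 24 * (x i : ℝ) ^ 2 by ring), sum_add_distrib,
      ← mul_sum]
    simp only [sum_const, card_univ, Fintype.card_fin, nsmul_eq_mul]
    change |((d:ℝ) * 2 + 24 * nsq x) / u ^ 3| ≤ _
    rw [abs_of_nonneg (by positivity), div_le_div_iff₀ (by positivity) (by positivity)]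
    have : (d:ℝ) * 2 + 24 * nsq x ≤ (2 * d + 48) * u := by nlinarith
    calc _ ≤ (2 * d + 48) * u * u ^ 2 := by gcongr
      _ = _ := by ring
  have s4 : ∑ e, z e ^ 4 ≤ (16 * d + 1024) / u ^ 2 := by
    simp only [hz, div_pow]
    rw [← sum_div, sumE (fun i s => (1 + 2 * s * (x i : ℝ)) ^ 4)]
    have h1 : ∑ i, ((1 + 2 * 1 * (x i : ℝ)) ^ 4 + (1 + 2 * (-1) * (x i : ℝ)) ^ 4) ≤ ∑ i, (16 + 256 * (x i : ℝ) ^ 4) := by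
      refine sum_le_sum fun i _ => ?_
      nlinarith [sq_nonneg ((x i : ℝ)^2 * 4 - 1), sq_nonneg ((x i : ℝ)^2)]
    have h0 : ∑ i, (16 + 256 * (x i : ℝ) ^ 4) = d * 16 + 256 * ∑ i, (x i : ℝ) ^ 4 := by
      rw [sum_add_distrib, ← mul_sum]; simp
    rw [h0] at h1
    have h2 := sum_x4 x
    rw [div_le_div_iff₀ (by positivity) (by positivity)]
    have h3 : nsq x ^ 2 ≤ 4 * u ^ 2 := by nlinarith
    have : ∑ i, ((1 + 2 * 1 * (x i : ℝ)) ^ 4 + (1 + 2 * (-1) * (x i : ℝ)) ^ 4) ≤ (16 * d + 1024) * u ^ 2 := by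
      have h5 : (d : ℝ) * 16 * 1 ≤ d * 16 * u ^ 2 := by gcongr; nlinarith
      linarith
    calc _ ≤ (16 * d + 1024) * u ^ 2 * u ^ 2 := by gcongr
      _ = _ := by ring
  have hsum : |∑ e, ((1 + z e) ^ (-(ea d)) - 1) - ea d * d / 4 * (2 * d - 8 * κ) / u ^ 2| ≤
      (|c3| * (2 * d + 48) + C * (16 * d + 1024)) / u ^ 2 := by
    have hk : ea d * d / 4 * (2 * d - 8 * κ) / u ^ 2 =
        (-(ea d)) * ∑ e, z e + (-(ea d)) * ((-(ea d)) - 1) / 2 * ∑ e, z e ^ 2 := by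
      rw [s1, s2]
      have : ea d = ((d:ℝ) - 2) / 2 := rfl
      rw [this]; field_simp; ring
    have h2 : ∑ e, ((1 + z e) ^ (-(ea d)) - 1) - ea d * d / 4 * (2 * d - 8 * κ) / u ^ 2 =
        ∑ e, ((1 + z e) ^ (-(ea d)) - (1 + (-(ea d)) * z e + (-(ea d)) * ((-(ea d)) - 1) / 2 * z e ^ 2 + c3 * z e ^ 3))
        + c3 * ∑ e, z e ^ 3 := by
      rw [hk]; simp only [Finset.sum_sub_distrib, sum_add_distrib, mul_sum]; ring
    rw [h2]
    refine (abs_add_le _ _).trans ?_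
    rw [abs_mul]
    have h3 := (Finset.abs_sum_le_sum_abs (fun e => (1 + z e) ^ (-(ea d)) - (1 + (-(ea d)) * z e + (-(ea d)) * ((-(ea d)) - 1) / 2 * z e ^ 2 + c3 * z e ^ 3)) Finset.univ).trans (sum_le_sum fun e _ => hT (z e) (hzδ e))
    rw [← mul_sum] at h3
    have h4 := mul_le_mul_of_nonneg_left s4 hC.le
    have h5 := mul_le_mul_of_nonneg_left s3 (abs_nonneg c3)
    calc _ ≤ C * ((16 * d + 1024) / u ^ 2) + |c3| * ((2 * d + 48) / u ^ 2) := add_le_add (h3.trans h4) h5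
      _ = _ := by ring
  rw [hlap]
  have hp : u ^ (-(ea d) - 2) = u ^ (-(ea d)) / u ^ 2 := by
    rw [Real.rpow_sub hu0]; norm_cast
  rw [hp]
  have hup : 0 ≤ u ^ (-(ea d)) := by positivity
  calc _ = |u ^ (-(ea d)) * (∑ e, ((1 + z e) ^ (-(ea d)) - 1) - ea d * d / 4 * (2 * d - 8 * κ) / u ^ 2)| := by
        congr 1; ring
    _ ≤ u ^ (-(ea d)) * ((|c3| * (2 * d + 48) + C * (16 * d + 1024)) / u ^ 2) := by
        rw [abs_mul, abs_of_nonneg hup]; exact mul_le_mul_of_nonneg_left hsum hup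
    _ = _ := by ring
lemma ea_pos : 0 < ea d := by have := d5 (d := d); unfold ea; linarith
lemma fk_super_exists : ∃ κ : ℝ, 1 ≤ κ ∧ ∀ x : V d, 0 < lap (fk κ) x := by
  obtain ⟨C, u0, hC, hu0, h⟩ := fk_lap_expand (d := d)
  have hd5 := d5 (d := d)
  have hea := ea_pos (d := d)
  refine ⟨u0 + d + C / (ea d * d), by have : 0 < C / (ea d * d) := by positivity
                                      linarith, fun x => ?_⟩
  set κ := u0 + d + C / (ea d * d) with hκ
  have hx := nsq_nonneg x
  have hc : 0 < C / (ea d * d) := by positivity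
  have hp : 0 < κ + nsq x := by linarith
  have h1 := h κ x (by linarith) (by rw [abs_of_nonneg (by linarith)]; linarith)
  have h2 := (abs_le.mp h1).2
  have hpp : 0 < (κ + nsq x) ^ (-(ea d) - 2) := by positivity
  have h3 : ea d * d / 4 * (2 * d - 8 * κ) + C < 0 := by
    have e1 : ea d * d * κ = ea d * d * (u0 + d) + C := by rw [hκ]; field_simp
    have : 0 < ea d * d := by positivity
    nlinarith
  have h4 : 2 * d * (-(lap (fk κ) x)) ≤ (κ + nsq x) ^ (-(ea d) - 2) * (ea d * d / 4 * (2 * d - 8 * κ) + C) := by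
    rw [mul_add]; linarith
  have h5 := mul_neg_of_pos_of_neg hpp h3
  by_contra hcon
  push Not at hcon
  nlinarith
lemma fk_sub_exists : ∃ κ ρ : ℝ, 0 < κ ∧ 2 * κ ≤ ρ ∧ ∀ x : V d, ρ ≤ nsq x → lap (fk (-κ)) x ≤ 0 := by
  obtain ⟨C, u0, hC, hu0, h⟩ := fk_lap_expand (d := d)
  have hd5 := d5 (d := d)
  have hea := ea_pos (d := d)
  have hc : 0 < C / (ea d * d) := by positivity
  refine ⟨C / (ea d * d), u0 + 2 * (C / (ea d * d)), hc, by linarith, fun x hx => ?_⟩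
  set κ := C / (ea d * d) with hκ
  have hp : 0 < -κ + nsq x := by linarith
  have h1 := h (-κ) x (by linarith) (by rw [abs_neg, abs_of_nonneg (by linarith)]; linarith)
  have h2 := (abs_le.mp h1).1
  have hpp : 0 < (-κ + nsq x) ^ (-(ea d) - 2) := by positivity
  have h3 : 0 ≤ ea d * d / 4 * (2 * d - 8 * (-κ)) - C := by
    have e1 : ea d * d * κ = C := by rw [hκ]; field_simp
    have : 0 < ea d * d := by positivity
    nlinarith
  have h4 : (-κ + nsq x) ^ (-(ea d) - 2) * (ea d * d / 4 * (2 * d - 8 * (-κ)) - C) ≤ 2 * d * (-(lap (fk (-κ)) x)) := by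
    rw [mul_sub]; linarith
  have h5 := mul_nonneg hpp.le h3
  by_contra hcon
  push Not at hcon
  nlinarith
end

section
variable [hd : Fact (5 ≤ d)]
lemma lap_trans (u : V d → ℝ) (v x : V d) : lap (fun x => u (x - v)) x = lap u (x - v) := by
  rw [lap_def, lap_def, av_def, av_def]
  congr 2
  refine sum_congr rfl fun e _ => ?_
  congr 1; unfold nb; abel
noncomputable def kap (d : ℕ) [hd : Fact (5 ≤ d)] : ℝ := (fk_super_exists (d := d)).choose
lemma kap_one : 1 ≤ kap d := (fk_super_exists (d := d)).choose_spec.1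
noncomputable def fp (x : V d) : ℝ := fk (kap d) x
lemma fp_lap_pos (x : V d) : 0 < lap fp x := (fk_super_exists (d := d)).choose_spec.2 x
lemma fp_pos (x : V d) : 0 < fp x := by
  have := kap_one (d := d); have := nsq_nonneg x; unfold fp fk; positivity
lemma fp_neg (x : V d) : fp (-x) = fp x := by simp [fp, fk, nsq]
lemma fp_symm (x y : V d) : fp (x - y) = fp (y - x) := by rw [← fp_neg, neg_sub]
lemma fp_le_one (x : V d) : fp x ≤ 1 := by
  have h1 := kap_one (d := d); have h2 := nsq_nonneg x; have h3 := ea_pos (d := d)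
  exact Real.rpow_le_one_of_one_le_of_nonpos (by linarith) (by linarith)
lemma sq_rpow {r : ℝ} (hr : 0 < r) : (r ^ 2) ^ (-(ea d)) = 1 / r ^ (d - 2) := by
  have h5 := hd.out
  rw [← Real.rpow_natCast r 2, ← Real.rpow_mul hr.le, ← Real.rpow_natCast r (d - 2), one_div, ← Real.rpow_neg hr.le]
  congr 1; rw [Nat.cast_sub (by omega)]; unfold ea; push_cast; ring
noncomputable def Q (z : V d) (r : ℕ) : Finset (V d) := Finset.Icc (fun i => z i - r) (fun i => z i + r)
lemma mem_Q {z x : V d} {r : ℕ} : x ∈ Q z r ↔ ∀ i, |x i - z i| ≤ r := by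
  simp only [Q, mem_Icc, Pi.le_def, ← forall_and]
  refine forall_congr' fun i => ?_
  rw [abs_le]; constructor <;> intro h <;> constructor <;> linarith [h.1, h.2]
lemma card_Q (z : V d) (r : ℕ) : (Q z r).card = (2 * r + 1) ^ d := by
  rw [Q, Pi.card_Icc]
  rw [prod_congr rfl (fun i _ => show _ = 2 * r + 1 by rw [Int.card_Icc]; omega)]
  simp
lemma Q_self (z : V d) (r : ℕ) : z ∈ Q z r := by rw [mem_Q]; intro i; simp
lemma Q_mono (z : V d) {r s : ℕ} (h : r ≤ s) : Q z r ⊆ Q z s := by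
  intro x; rw [mem_Q, mem_Q]; intro hx i; exact (hx i).trans (by exact_mod_cast h)
lemma Q_symm {x z : V d} {r : ℕ} : x ∈ Q z r ↔ z ∈ Q x r := by
  rw [mem_Q, mem_Q]; exact forall_congr' fun i => by rw [abs_sub_comm]
lemma Q_tri {x y z : V d} {r s : ℕ} (h1 : x ∈ Q y r) (h2 : y ∈ Q z s) : x ∈ Q z (r + s) := by
  rw [mem_Q] at *
  intro i
  have := abs_sub_le (x i) (y i) (z i)
  push_cast; linarith [h1 i, h2 i]
lemma Q_sub {x z : V d} {r : ℕ} : x ∈ Q z r ↔ x - z ∈ Q 0 r := by simp [mem_Q]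
lemma nsq_le {x : V d} {r : ℕ} (h : x ∈ Q 0 r) : nsq x ≤ d * (r : ℝ) ^ 2 := by
  rw [mem_Q] at h
  have : ∀ i ∈ Finset.univ, (x i : ℝ) ^ 2 ≤ (r : ℝ) ^ 2 := by
    intro i _
    have := h i
    simp only [Pi.zero_apply, sub_zero] at this
    rw [sq_le_sq, Nat.abs_cast]; exact_mod_cast this
  have := sum_le_sum this
  simpa [nsq] using this
lemma nsq_ge {x : V d} {r : ℕ} (h : x ∉ Q 0 r) : ((r : ℝ) + 1) ^ 2 ≤ nsq x := by
  rw [mem_Q] at h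
  push Not at h
  obtain ⟨i, hi⟩ := h
  have h1 : (x i : ℝ)^2 ≤ nsq x := single_le_sum (f := fun i => (x i : ℝ)^2) (fun i _ => sq_nonneg _) (mem_univ i)
  refine le_trans ?_ h1
  simp only [Pi.zero_apply, sub_zero] at hi
  rw [sq_le_sq, abs_of_nonneg (by positivity)]
  have : (r : ℤ) + 1 ≤ |x i| := hi
  exact_mod_cast this
lemma fp_le {x : V d} {r : ℕ} (h : x ∉ Q 0 r) : fp x ≤ 1 / ((r : ℝ) + 1) ^ (d - 2) := by
  have h1 := nsq_ge h
  have h2 := kap_one (d := d)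
  have h3 := ea_pos (d := d)
  rw [← sq_rpow (d := d) (by positivity)]
  exact Real.rpow_le_rpow_of_nonpos (by positivity) (by linarith) (by linarith)
noncomputable def cf (d : ℕ) [hd : Fact (5 ≤ d)] : ℝ := (kap d + d) ^ (-(ea d))
lemma cf_pos : 0 < cf d := by
  have := kap_one (d := d); have := dpos (d := d); unfold cf; positivity
lemma fp_ge {x : V d} {r : ℕ} (hr : 1 ≤ r) (h : x ∈ Q 0 r) : cf d / (r : ℝ) ^ (d - 2) ≤ fp x := by
  have h1 := nsq_le h
  have h2 := kap_one (d := d)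
  have h3 := ea_pos (d := d)
  have h4 := dpos (d := d)
  have h5 := nsq_nonneg x
  have hr' : (1 : ℝ) ≤ r := by exact_mod_cast hr
  rw [div_eq_mul_one_div, ← sq_rpow (d := d) (by positivity)]
  unfold cf fp fk
  rw [← Real.mul_rpow (by positivity) (by positivity)]
  refine Real.rpow_le_rpow_of_nonpos (by positivity) ?_ (by linarith)
  have h6 : kap d * 1 ≤ kap d * (r : ℝ) ^ 2 := by gcongr; nlinarith
  linarith
noncomputable def Cg (d : ℕ) [hd : Fact (5 ≤ d)] : ℝ := 1 / lap (fp (d := d)) 0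
lemma Cg_pos : 0 < Cg d := by have := fp_lap_pos (0 : V d); unfold Cg; positivity
lemma gr_le (A : Finset (V d)) (v x : V d) : gr A v x ≤ Cg d * fp (x - v) := by
  have hc := Cg_pos (d := d)
  refine gr_le_of (u := fun x => Cg d * fp (x - v)) (fun x _ => ?_) (fun x _ => ?_) x
  · have : (fun x => Cg d * fp (x - v)) = Cg d • (fun x => fp (x - v)) := rfl
    rw [this, map_smul, Pi.smul_apply, lap_trans, smul_eq_mul]
    by_cases h : x = v
    · subst h; rw [ind_mem (Set.mem_singleton _), sub_self, Cg]
      have := fp_lap_pos (0 : V d); field_simp; exact le_refl _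
    · rw [ind_not (by simpa using h)]; have := fp_lap_pos (x - v); positivity
  · have := fp_pos (x - v); positivity
lemma hm_le_fp (A : Finset (V d)) {z : V d} {ℓ : ℕ} (hℓ : 1 ≤ ℓ) {R : Set (V d)} (hR : ∀ y ∈ R, y ∈ Q z ℓ) (x : V d) :
    hm A R x ≤ (ℓ : ℝ) ^ (d - 2) / cf d * fp (x - z) := by
  have hc := cf_pos (d := d)
  refine hm_le_of (u := fun x => (ℓ : ℝ) ^ (d - 2) / cf d * fp (x - z)) (fun x _ => ?_) (fun x _ => ?_) x
  · have : (fun x => (ℓ : ℝ) ^ (d - 2) / cf d * fp (x - z)) = ((ℓ : ℝ) ^ (d - 2) / cf d) • (fun x => fp (x - z)) := rfl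
    rw [this, map_smul, Pi.smul_apply, lap_trans, smul_eq_mul]
    have := fp_lap_pos (x - z); positivity
  · by_cases h : x ∈ R
    · rw [ind_mem h]
      have h1 := fp_ge hℓ (Q_sub.mp (hR x h))
      have hl : 0 < (ℓ : ℝ) ^ (d - 2) := by positivity
      rw [div_le_iff₀ hl] at h1
      rw [div_mul_eq_mul_div, le_div_iff₀ hc]; linarith
    · rw [ind_not h]; have := fp_pos (x - z); positivity
lemma sum_fp_dyadic (i : ℕ) : ∑ x ∈ Q (0 : V d) (2 ^ i), fp x ≤ (8 ^ d : ℝ) * 4 ^ i := by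
  have h5 := hd.out
  induction i with
  | zero =>
    have h1 : ∑ x ∈ Q (0 : V d) (2 ^ 0), fp x ≤ ∑ x ∈ Q (0 : V d) (2 ^ 0), (1:ℝ) := sum_le_sum fun x _ => fp_le_one x
    refine h1.trans ?_
    rw [sum_const, card_Q]
    norm_num
    gcongr; norm_num
  | succ i ih =>
    rw [← Finset.sum_sdiff (Q_mono (0 : V d) (pow_le_pow_right₀ (by norm_num : 1 ≤ 2) (Nat.le_succ i)))]
    have h1 : ∑ x ∈ Q (0 : V d) (2 ^ (i+1)) \ Q 0 (2 ^ i), fp x ≤ ∑ x ∈ Q (0 : V d) (2 ^ (i+1)), (1 / ((2:ℝ) ^ i) ^ (d - 2)) := by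
      refine (sum_le_sum fun x hx => ?_).trans (sum_le_sum_of_subset_of_nonneg sdiff_subset fun x _ _ => by positivity)
      refine (fp_le (mem_sdiff.mp hx).2).trans ?_
      push_cast; gcongr; linarith
    rw [sum_const, card_Q, nsmul_eq_mul] at h1
    have h2 : (((2 * 2 ^ (i+1) + 1) ^ d : ℕ) : ℝ) * (1 / ((2:ℝ) ^ i) ^ (d - 2)) ≤ 8 ^ d * 4 ^ i := by
      have e1 : (((2 * 2 ^ (i+1) + 1) ^ d : ℕ) : ℝ) ≤ (8 * 2 ^ i) ^ d := by
        push_cast; gcongr; rw [pow_succ]; nlinarith [one_le_pow₀ (n := i) (by norm_num : (1:ℝ) ≤ 2)]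
      have e2 : ((8:ℝ) * 2 ^ i) ^ d = 8 ^ d * 4 ^ i * (2 ^ i) ^ (d - 2) := by
        rw [mul_pow, mul_assoc, show (4:ℝ) = 2 ^ 2 by norm_num, ← pow_mul 2 2, mul_comm 2 i, pow_mul, ← pow_add]
        congr 2; omega
      rw [mul_one_div, div_le_iff₀ (by positivity), ← e2]; exact e1
    rw [pow_succ (4:ℝ)]
    have : (0:ℝ) < 8 ^ d * 4 ^ i := by positivity
    linarith
lemma sum_fp2_dyadic (i j : ℕ) (hij : i ≤ j) : ∑ x ∈ Q (0 : V d) (2 ^ j) \ Q 0 (2 ^ i), fp x ^ 2 ≤ (8 ^ d : ℝ) * (2 / 2 ^ i - 2 / 2 ^ j) := by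
  have h5 := hd.out
  induction j, hij using Nat.le_induction with
  | base => simp
  | succ j hj ih =>
    have hs : Q (0 : V d) (2 ^ j) \ Q 0 (2 ^ i) ⊆ Q (0 : V d) (2 ^ (j+1)) \ Q 0 (2 ^ i) :=
      Finset.sdiff_subset_sdiff (Q_mono _ (pow_le_pow_right₀ (by norm_num : 1 ≤ 2) (Nat.le_succ j))) (le_refl _)
    rw [← Finset.sum_sdiff hs]
    have h1 : ∑ x ∈ (Q (0 : V d) (2 ^ (j+1)) \ Q 0 (2 ^ i)) \ (Q (0 : V d) (2 ^ j) \ Q 0 (2 ^ i)), fp x ^ 2 ≤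
        ∑ x ∈ Q (0 : V d) (2 ^ (j+1)), (1 / ((2:ℝ) ^ j) ^ (d - 2)) ^ 2 := by
      refine (sum_le_sum fun x hx => ?_).trans (sum_le_sum_of_subset_of_nonneg (sdiff_subset.trans sdiff_subset) fun x _ _ => by positivity)
      have hx' : x ∉ Q 0 (2 ^ j) := by
        simp only [mem_sdiff] at hx; tauto
      have := fp_pos x
      have h3 := fp_le hx'
      gcongr
      refine h3.trans ?_
      push_cast; gcongr; linarith
    rw [sum_const, card_Q, nsmul_eq_mul] at h1
    have h2 : (((2 * 2 ^ (j+1) + 1) ^ d : ℕ) : ℝ) * (1 / ((2:ℝ) ^ j) ^ (d - 2)) ^ 2 ≤ 8 ^ d * (1 / 2 ^ j) := by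
      have e1 : (((2 * 2 ^ (j+1) + 1) ^ d : ℕ) : ℝ) ≤ (8 * 2 ^ j) ^ d := by
        push_cast; gcongr; rw [pow_succ]; nlinarith [one_le_pow₀ (n := j) (by norm_num : (1:ℝ) ≤ 2)]
      have e2 : (2:ℝ) ^ j * (2 ^ j) ^ d ≤ ((2 ^ j) ^ (d - 2)) ^ 2 := by
        rw [← pow_succ', ← pow_mul ((2:ℝ) ^ j)]
        exact pow_le_pow_right₀ (one_le_pow₀ (by norm_num : (1:ℝ) ≤ 2)) (by omega)
      rw [div_pow, one_pow, mul_one_div, mul_one_div, div_le_div_iff₀ (by positivity) (by positivity)]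
      calc _ ≤ (8 * 2 ^ j) ^ d * (2:ℝ) ^ j := by gcongr
        _ = 8 ^ d * (2 ^ j * (2 ^ j) ^ d) := by rw [mul_pow]; ring
        _ ≤ _ := by gcongr
    have e3 : (2:ℝ) / 2 ^ (j+1) = 1 / 2 ^ j := by rw [pow_succ]; field_simp
    rw [e3]
    have e4 : (2:ℝ) / 2 ^ j = 1 / 2 ^ j + 1 / 2 ^ j := by ring
    rw [e4] at ih
    nlinarith
lemma sub_Q (F : Finset (V d)) : ∃ j, F ⊆ Q 0 (2 ^ j) := by
  obtain ⟨n, hn⟩ : ∃ n : ℕ, ∀ x ∈ F, ∀ i, |x i| ≤ n := by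
    refine ⟨∑ x ∈ F, ∑ i, (x i).natAbs, fun x hx i => ?_⟩
    have h1 := single_le_sum (f := fun i => (x i).natAbs) (fun i _ => Nat.zero_le _) (mem_univ i)
    have h2 := single_le_sum (f := fun x : V d => ∑ i, (x i).natAbs) (fun i _ => Nat.zero_le _) hx
    rw [Int.abs_eq_natAbs]; exact_mod_cast h1.trans h2
  refine ⟨n, fun x hx => mem_Q.mpr fun i => ?_⟩
  have h1 := hn x hx i
  have : (n : ℤ) ≤ ((2 ^ n : ℕ) : ℤ) := by exact_mod_cast Nat.lt_two_pow_self.le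
  simpa using h1.trans this
lemma sum_fp2_tail (i : ℕ) (F : Finset (V d)) (z : V d) (hF : ∀ x ∈ F, x ∉ Q z (2 ^ i)) :
    ∑ x ∈ F, fp (x - z) ^ 2 ≤ (8 ^ d : ℝ) * (2 / 2 ^ i) := by
  obtain ⟨j, hj⟩ := sub_Q (F.image (fun x => x - z))
  have h1 : ∑ x ∈ F, fp (x - z) ^ 2 = ∑ y ∈ F.image (fun x => x - z), fp y ^ 2 := by
    rw [Finset.sum_image]; intro a _ b _ hab; simpa using hab
  rw [h1]
  have h2 : F.image (fun x => x - z) ⊆ Q 0 (2 ^ (max i j)) \ Q 0 (2 ^ i) := by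
    intro y hy
    refine mem_sdiff.mpr ⟨Q_mono _ (pow_le_pow_right₀ (by norm_num) (le_max_right _ _)) (hj hy), ?_⟩
    obtain ⟨x, hx, rfl⟩ := Finset.mem_image.mp hy
    rw [← Q_sub]; exact hF x hx
  refine (sum_le_sum_of_subset_of_nonneg h2 fun x _ _ => sq_nonneg _).trans ?_
  refine (sum_fp2_dyadic i _ (le_max_left _ _)).trans ?_
  gcongr
  have : (0:ℝ) ≤ 2 / 2 ^ (max i j) := by positivity
  linarith
lemma sum_fp2 (F : Finset (V d)) (z : V d) : ∑ x ∈ F, fp (x - z) ^ 2 ≤ (3 * 8 ^ d : ℝ) := by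
  rw [← Finset.sum_filter_add_sum_filter_not F (fun x => x ∈ Q z (2 ^ 0))]
  have h1 := sum_fp2_tail 0 (F.filter (fun x => x ∉ Q z (2 ^ 0))) z (fun x hx => (mem_filter.mp hx).2)
  have h2 : ∑ x ∈ F.filter (fun x => x ∈ Q z (2 ^ 0)), fp (x - z) ^ 2 ≤ ∑ x ∈ Q z (2 ^ 0), (1 : ℝ) := by
    refine (sum_le_sum fun x _ => ?_).trans (sum_le_sum_of_subset_of_nonneg
      (fun x hx => (mem_filter.mp hx).2) fun x _ _ => by positivity)
    exact pow_le_one₀ (fp_pos _).le (fp_le_one _)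
  rw [sum_const, card_Q, nsmul_eq_mul] at h2
  have h3 : (((2 * 2 ^ 0 + 1) ^ d : ℕ) : ℝ) ≤ 8 ^ d := by push_cast; gcongr; norm_num
  norm_num at h1 h2 h3 ⊢
  linarith
lemma sum_fp (r : ℕ) (hr : 1 ≤ r) (z x : V d) : ∑ y ∈ Q z r, fp (y - x) ≤ (64 * 8 ^ d : ℝ) * (r : ℝ) ^ 2 := by
  have h5 := hd.out
  have hr' : (1 : ℝ) ≤ r := by exact_mod_cast hr
  by_cases hx : x ∈ Q z (2 * r)
  · set i := Nat.clog 2 (3 * r) with hi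
    have h1 : 3 * r ≤ 2 ^ i := Nat.le_pow_clog (by norm_num) _
    have h2 : 2 ^ i ≤ 6 * r := by
      have h3 : 2 ^ (i - 1) < 3 * r := Nat.pow_pred_clog_lt_self (by norm_num) (by omega)
      have h4 : 0 < i := Nat.clog_pos (by norm_num) (by omega)
      have : 2 ^ i = 2 * 2 ^ (i - 1) := by rw [← pow_succ']; congr 1; omega
      omega
    have h3 : ∑ y ∈ Q z r, fp (y - x) = ∑ y ∈ (Q z r).image (fun y => y - x), fp y := by
      rw [Finset.sum_image]; intro a _ b _ hab; simpa using hab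
    have h4 : (Q z r).image (fun y => y - x) ⊆ Q 0 (2 ^ i) := by
      intro y hy
      obtain ⟨w, hw, rfl⟩ := Finset.mem_image.mp hy
      rw [← Q_sub]
      exact Q_mono _ (by omega) (Q_tri hw (Q_symm.mp hx))
    rw [h3]
    refine (sum_le_sum_of_subset_of_nonneg h4 fun x _ _ => (fp_pos x).le).trans ((sum_fp_dyadic i).trans ?_)
    have h6 : (4:ℝ) ^ i ≤ 36 * (r:ℝ) ^ 2 := by
      have : (2:ℝ) ^ i ≤ 6 * r := by exact_mod_cast h2
      calc (4:ℝ) ^ i = (2 ^ i) ^ 2 := by rw [← pow_mul, mul_comm, pow_mul]; norm_num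
        _ ≤ (6 * r) ^ 2 := by gcongr
        _ = _ := by ring
    have : (0:ℝ) < 8 ^ d := by positivity
    nlinarith
  · have h1 : ∀ y ∈ Q z r, fp (y - x) ≤ 1 / (r : ℝ) ^ (d - 2) := by
      intro y hy
      have : y - x ∉ Q 0 r := by
        rw [← Q_sub]; intro h
        exact hx (Q_mono _ (by omega) (Q_tri (Q_symm.mp h) hy))
      refine (fp_le this).trans ?_
      gcongr; linarith
    refine (sum_le_sum h1).trans ?_
    rw [sum_const, card_Q, nsmul_eq_mul, mul_one_div, div_le_iff₀ (by positivity), mul_assoc, ← pow_add,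
      show 2 + (d - 2) = d by omega]
    push_cast
    calc (2 * (r:ℝ) + 1) ^ d ≤ (8 * r) ^ d := by gcongr; linarith
      _ = 8 ^ d * (r:ℝ) ^ d := mul_pow _ _ _
      _ ≤ _ := by have : (0:ℝ) < 8 ^ d * (r:ℝ) ^ d := by positivity
                  linarith
end

section
variable [hd : Fact (5 ≤ d)]
lemma nb_mem_Q {x z : V d} {r : ℕ} (e : E d) (h : x ∈ Q z r) : nb x e ∈ Q z (r + 1) := by
  rw [mem_Q] at *
  intro i
  have h1 := h i
  have h2 : |nb x e i - x i| ≤ 1 := by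
    rcases e with ⟨j, b⟩
    by_cases hij : i = j
    · subst hij; cases b <;> simp [nb, sg]
    · simp [nb, hij]
  have := abs_sub_le (nb x e i) (x i) (z i)
  push_cast; linarith
lemma nb_inv (x : V d) (e : E d) : nb (nb x e) (e.1, !e.2) = x := by
  rcases e with ⟨i, b⟩
  have : (Pi.single i (sg (!b)) : V d) = - Pi.single i (sg b) := by
    rw [← Pi.single_neg]; congr 1; cases b <;> simp [sg]
  simp only [nb, this]; abel
lemma H1_exists : ∃ (M l0 : ℕ) (c : ℝ), 1 ≤ M ∧ 1 ≤ l0 ∧ 0 < c ∧ c ≤ 1 ∧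
    ∀ (ℓ r : ℕ) (z : V d) (u : V d → ℝ) (θ : ℝ), l0 ≤ ℓ → ℓ ≤ r → (∀ x, 0 ≤ u x) → 0 ≤ θ →
      (∀ x ∈ Q z (M * r), x ∉ Q z ℓ → 0 ≤ lap u x) → (∀ x ∈ Q z ℓ, θ ≤ u x) →
      ∀ x ∈ Q z r, c * ((ℓ : ℝ) / r) ^ (d - 2) * θ ≤ u x := by
  obtain ⟨κ, ρ, hκ, hρ, hsub⟩ := fk_sub_exists (d := d)
  have hd5 := d5 (d := d)
  have h5 := hd.out
  have ha := ea_pos (d := d)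
  obtain ⟨M, hM⟩ := exists_nat_ge (2 * (2:ℝ) ^ (ea d) * (d:ℝ) ^ (ea d))
  obtain ⟨l0, hl0⟩ := exists_nat_ge (max ρ 1)
  set a2 := (2:ℝ) ^ (ea d) with ha2
  set da := (d:ℝ) ^ (ea d) with hda
  have ha2p : 1 ≤ a2 := Real.one_le_rpow (by norm_num) ha.le
  have hdap : 1 ≤ da := Real.one_le_rpow (by linarith) ha.le
  have hl1 : (1:ℝ) ≤ l0 := (le_max_right _ _).trans hl0
  have hM1 : (1:ℝ) ≤ M := le_trans (by nlinarith) hM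
  refine ⟨M, l0, 1 / (2 * a2 * da), by exact_mod_cast hM1, by exact_mod_cast hl1, by positivity, ?_, ?_⟩
  · rw [div_le_one (by positivity)]; nlinarith
  intro ℓ r z u θ hℓ hr hu hθ hlap hin
  have hℓl : (l0:ℝ) ≤ ℓ := by exact_mod_cast hℓ
  have hrl : (ℓ:ℝ) ≤ r := by exact_mod_cast hr
  have hρl : ρ ≤ l0 := (le_max_left _ _).trans hl0
  -- upper bound
  have hup : ∀ (y : V d) (k : ℝ), ℓ ≤ k → k ^ 2 ≤ nsq y → fk (-κ) y ≤ a2 / k ^ (d - 2) := by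
    intro y k hk hy
    have hk1 : 1 ≤ k := by linarith
    have hk2 : ρ ≤ k ^ 2 := by nlinarith
    have e1 : a2 / k ^ (d - 2) = (k ^ 2 / 2) ^ (-(ea d)) := by
      rw [Real.div_rpow (by positivity) (by norm_num), sq_rpow (by linarith), Real.rpow_neg (by norm_num), ha2]
      field_simp
    rw [e1]
    exact Real.rpow_le_rpow_of_nonpos (by positivity) (by linarith) (by linarith)
  set A := Q z (M * r) \ Q z ℓ with hA
  set w : V d → ℝ := fun x => (θ * (ℓ:ℝ) ^ (d - 2) / a2) * (fk (-κ) (x - z) - a2 / ((M * r : ℕ) : ℝ) ^ (d - 2)) with hw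
  have hMr : (r:ℝ) ≤ ((M * r : ℕ) : ℝ) := by push_cast; nlinarith
  have hK : 0 ≤ θ * (ℓ:ℝ) ^ (d - 2) / a2 := by positivity
  have hmain : ∀ x ∈ A, w x ≤ u x := by
    refine mp_le A w u (fun x hx => ?_) (fun y hy => ?_)
    · rw [hA, mem_sdiff] at hx
      have h1 := hlap x hx.1 hx.2
      have h2 : w = (θ * (ℓ:ℝ) ^ (d - 2) / a2) • ((fun x => fk (-κ) (x - z)) - (fun _ => a2 / ((M * r : ℕ) : ℝ) ^ (d - 2))) := rfl
      rw [h2, map_smul, map_sub, Pi.smul_apply, Pi.sub_apply, lap_trans, lap_const, smul_eq_mul]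
      refine le_trans (mul_nonpos_of_nonneg_of_nonpos hK ?_) h1
      rw [sub_zero]
      refine hsub _ ?_
      have h3 : x - z ∉ Q 0 ℓ := by rw [← Q_sub]; exact hx.2
      have := nsq_ge h3
      nlinarith
    · obtain ⟨hyA, x, hxA, e, rfl⟩ := hy
      rw [hA, mem_sdiff] at hyA hxA
      by_cases h1 : nb x e ∈ Q z (M * r)
      · have h2 : nb x e ∈ Q z ℓ := by by_contra h; exact hyA ⟨h1, h⟩
        refine le_trans ?_ (hin _ h2)
        have h3 : nb x e - z ∉ Q 0 (ℓ - 1) := by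
          rw [← Q_sub]; intro h
          have h4 := nb_mem_Q (e.1, !e.2) h
          rw [nb_inv] at h4
          exact hxA.2 (Q_mono _ (by have : 1 ≤ l0 := by exact_mod_cast hl1
                                    omega) h4)
        have h4 := nsq_ge h3
        have h5' : ((ℓ - 1 : ℕ) : ℝ) + 1 = ℓ := by
          rw [Nat.cast_sub (by have : 1 ≤ l0 := by exact_mod_cast hl1
                               omega)]; simp
        rw [h5'] at h4
        have h6 := hup _ _ le_rfl h4
        have hlp : (0:ℝ) < (ℓ:ℝ) ^ (d - 2) := by have : (0:ℝ) < ℓ := by linarith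
                                                 positivity
        have h7 : (0:ℝ) ≤ a2 / ((M * r : ℕ) : ℝ) ^ (d - 2) := by positivity
        calc w (nb x e) ≤ (θ * (ℓ:ℝ) ^ (d - 2) / a2) * (a2 / (ℓ:ℝ) ^ (d - 2)) := by
              rw [hw]; exact mul_le_mul_of_nonneg_left (by linarith) hK
          _ = θ := by field_simp
      · refine le_trans ?_ (hu _)
        refine mul_nonpos_of_nonneg_of_nonpos hK (sub_nonpos.mpr ?_)
        have h2 : nb x e - z ∉ Q 0 (M * r) := by rwa [← Q_sub]
        refine hup _ _ (by linarith) (le_trans ?_ (nsq_ge h2))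
        gcongr; linarith
  intro x hx
  have hr0 : (0:ℝ) < r := by linarith
  by_cases hxl : x ∈ Q z ℓ
  · refine le_trans ?_ (hin x hxl)
    have h1 : ((ℓ:ℝ) / r) ^ (d - 2) ≤ 1 := pow_le_one₀ (by positivity) (by rw [div_le_one hr0]; exact hrl)
    have h2 : 1 / (2 * a2 * da) ≤ 1 := by rw [div_le_one (by positivity)]; nlinarith
    have h3 : (0:ℝ) ≤ ((ℓ:ℝ) / r) ^ (d - 2) := by positivity
    have h4 : (0:ℝ) < 1 / (2 * a2 * da) := by positivity
    have : 1 / (2 * a2 * da) * ((ℓ:ℝ) / r) ^ (d - 2) ≤ 1 := by nlinarith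
    nlinarith
  · have hxA : x ∈ A := by
      rw [hA, mem_sdiff]; refine ⟨Q_mono z ?_ hx, hxl⟩
      exact_mod_cast hMr
    refine le_trans ?_ (hmain x hxA)
    have h3 : x - z ∉ Q 0 ℓ := by rwa [← Q_sub]
    have h4 := nsq_ge h3
    have h5' := nsq_le (Q_sub.mp hx)
    have h6 : 1 / (da * (r:ℝ) ^ (d - 2)) ≤ fk (-κ) (x - z) := by
      have e1 : 1 / (da * (r:ℝ) ^ (d - 2)) = (d * (r:ℝ) ^ 2) ^ (-(ea d)) := by
        rw [Real.mul_rpow (by positivity) (by positivity), sq_rpow hr0, Real.rpow_neg (by positivity), hda]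
        field_simp
      rw [e1]
      exact Real.rpow_le_rpow_of_nonpos (by nlinarith) (by linarith) (by linarith)
    have h7 : a2 / ((M * r : ℕ) : ℝ) ^ (d - 2) ≤ 1 / (2 * da * (r:ℝ) ^ (d - 2)) := by
      have e1 : 2 * a2 * da ≤ (M:ℝ) ^ (d - 2) := hM.trans (le_self_pow₀ hM1 (by omega))
      push_cast
      rw [mul_pow, div_le_div_iff₀ (by positivity) (by positivity)]
      have : 0 < (r:ℝ) ^ (d - 2) := by positivity
      nlinarith
    have h8 : 1 / (2 * da * (r:ℝ) ^ (d - 2)) ≤ fk (-κ) (x - z) - a2 / ((M * r : ℕ) : ℝ) ^ (d - 2) := by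
      have : 1 / (da * (r:ℝ) ^ (d - 2)) = 1 / (2 * da * (r:ℝ) ^ (d - 2)) + 1 / (2 * da * (r:ℝ) ^ (d - 2)) := by
        field_simp; norm_num
      linarith
    calc 1 / (2 * a2 * da) * ((ℓ:ℝ) / r) ^ (d - 2) * θ = (θ * (ℓ:ℝ) ^ (d - 2) / a2) * (1 / (2 * da * (r:ℝ) ^ (d - 2))) := by
          rw [div_pow]; field_simp
      _ ≤ _ := mul_le_mul_of_nonneg_left h8 hK
end

section
variable [hd : Fact (5 ≤ d)]
noncomputable def M0 (d : ℕ) [hd : Fact (5 ≤ d)] : ℕ := (H1_exists (d := d)).choose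
noncomputable def l0 (d : ℕ) [hd : Fact (5 ≤ d)] : ℕ := (H1_exists (d := d)).choose_spec.choose
noncomputable def c1 (d : ℕ) [hd : Fact (5 ≤ d)] : ℝ := (H1_exists (d := d)).choose_spec.choose_spec.choose
lemma H1_spec : 1 ≤ M0 d ∧ 1 ≤ l0 d ∧ 0 < c1 d ∧ c1 d ≤ 1 ∧
    ∀ (ℓ r : ℕ) (z : V d) (u : V d → ℝ) (θ : ℝ), l0 d ≤ ℓ → ℓ ≤ r → (∀ x, 0 ≤ u x) → 0 ≤ θ →
      (∀ x ∈ Q z (M0 d * r), x ∉ Q z ℓ → 0 ≤ lap u x) → (∀ x ∈ Q z ℓ, θ ≤ u x) →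
      ∀ x ∈ Q z r, c1 d * ((ℓ : ℝ) / r) ^ (d - 2) * θ ≤ u x :=
  (H1_exists (d := d)).choose_spec.choose_spec.choose_spec
lemma M0_one : 1 ≤ M0 d := H1_spec.1
lemma l0_one : 1 ≤ l0 d := H1_spec.2.1
lemma c1_pos : 0 < c1 d := H1_spec.2.2.1
lemma c1_le : c1 d ≤ 1 := H1_spec.2.2.2.1
lemma H1 {ℓ r : ℕ} {z : V d} {u : V d → ℝ} {θ : ℝ} (h1 : l0 d ≤ ℓ) (h2 : ℓ ≤ r) (h3 : ∀ x, 0 ≤ u x) (h4 : 0 ≤ θ)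
      (h5 : ∀ x ∈ Q z (M0 d * r), x ∉ Q z ℓ → 0 ≤ lap u x) (h6 : ∀ x ∈ Q z ℓ, θ ≤ u x) :
      ∀ x ∈ Q z r, c1 d * ((ℓ : ℝ) / r) ^ (d - 2) * θ ≤ u x := H1_spec.2.2.2.2 ℓ r z u θ h1 h2 h3 h4 h5 h6
noncomputable def c2 (d : ℕ) [hd : Fact (5 ≤ d)] : ℝ := c1 d * (1 / 2) ^ (d - 2)
lemma c2_pos : 0 < c2 d := by have := c1_pos (d := d); unfold c2; positivity
lemma chain1 {r : ℕ} (hr : l0 d ≤ r) {z : V d} {u : V d → ℝ} {θ : ℝ} (h3 : ∀ x, 0 ≤ u x) (h4 : 0 ≤ θ)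
    (h5 : ∀ x ∈ Q z (2 * M0 d * r), 0 ≤ lap u x) (h6 : ∀ x ∈ Q z r, θ ≤ u x) : ∀ x ∈ Q z (2 * r), c2 d * θ ≤ u x := by
  have hl := l0_one (d := d)
  intro x hx
  have h := H1 hr (by omega : r ≤ 2 * r) h3 h4 (fun x hx _ => h5 x (by rwa [show 2 * M0 d * r = M0 d * (2 * r) by ring])) h6 x hx
  have : (r : ℝ) / ((2 * r : ℕ) : ℝ) = 1 / 2 := by
    have : (0:ℝ) < r := by exact_mod_cast (by omega : 0 < r)
    push_cast; field_simp
  rwa [this] at h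
lemma chain {r : ℕ} (hr : l0 d ≤ r) {u : V d → ℝ} (h3 : ∀ x, 0 ≤ u x) (n : ℕ) :
    ∀ {z z' : V d} {θ : ℝ}, 0 ≤ θ → (∀ i, |z i - z' i| ≤ (n * r : ℕ)) →
    (∀ w : V d, (∀ i, min (z i) (z' i) ≤ w i ∧ w i ≤ max (z i) (z' i)) → ∀ x ∈ Q w (2 * M0 d * r), 0 ≤ lap u x) →
    (∀ x ∈ Q z r, θ ≤ u x) → ∀ x ∈ Q z' r, c2 d ^ n * θ ≤ u x := by
  induction n with
  | zero =>
    intro z z' θ h4 hz _ h6 x hx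
    have : z = z' := by ext i; have := hz i; simp at this; linarith [abs_nonpos_iff.mp (le_of_eq (by simpa using this : |z i - z' i| = 0))]
    subst this; simpa using h6 x hx
  | succ n ih =>
    intro z z' θ h4 hz hG h6 x hx
    let z1 : V d := fun i => max (z i - r) (min (z i + r) (z' i))
    have hz1 : z1 ∈ Q z r := by
      rw [mem_Q]; intro i; simp only [z1, abs_le]; omega
    have h7 := chain1 hr h3 h4 (hG z (fun i => ⟨min_le_left _ _, le_max_left _ _⟩)) h6
    have h8 : ∀ x ∈ Q z1 r, c2 d * θ ≤ u x := fun x hx => h7 x (Q_mono _ (by omega) (Q_tri hx hz1))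
    have h9 := ih (z := z1) (z' := z') (θ := c2 d * θ) (mul_nonneg c2_pos.le h4) (fun i => by
        have h10 := abs_le.mp (hz i)
        have e1 : (((n + 1) * r : ℕ) : ℤ) = (n * r : ℕ) + r := by push_cast; ring
        rw [e1] at h10
        have : (0:ℤ) ≤ (n * r : ℕ) := by positivity
        rw [abs_le]; simp only [z1]; omega) (fun w hw => hG w (fun i => by
        have := hw i; simp only [z1] at this; omega)) h8 x hx
    rw [pow_succ, mul_assoc]; exact h9
lemma steps {u : V d → ℝ} (hu : ∀ x, 0 ≤ u x) {p q y : V d} (hy : y ∈ Finset.Icc p q)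
    (hl : ∀ x ∈ Finset.Icc p q, 0 ≤ lap u x) (n : ℕ) :
    ∀ x ∈ Finset.Icc p q, (∑ i, (x i - y i).natAbs ≤ n) → u y / (2 * d) ^ n ≤ u x := by
  have h2 := d2pos (d := d)
  have hd5 := d5 (d := d)
  induction n with
  | zero =>
    intro x hx hn
    have : x = y := by
      ext i
      have := single_le_sum (f := fun i => (x i - y i).natAbs) (fun i _ => Nat.zero_le _) (mem_univ i)
      omega
    subst this; simp
  | succ n ih =>
    intro x hx hn
    by_cases hxy : x = y
    · subst hxy
      exact div_le_self (hu x) (one_le_pow₀ (by linarith))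
    · obtain ⟨i, hi⟩ : ∃ i, x i ≠ y i := by by_contra h; push Not at h; exact hxy (funext h)
      let e : E d := (i, decide (x i < y i))
      have hnb : ∀ j, nb x e j = if j = i then (if x i < y i then x i + 1 else x i - 1) else x j := by
        intro j
        by_cases hj : j = i
        · subst hj; simp only [nb, e, sg, Pi.add_apply, Pi.single_eq_same, if_true]; split_ifs <;> simp_all <;> ring
        · simp [nb, e, hj]
      rw [mem_Icc, Pi.le_def, Pi.le_def] at hx hy
      have hmem : nb x e ∈ Finset.Icc p q := by
        rw [mem_Icc, Pi.le_def, Pi.le_def]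
        constructor <;> intro j <;> rw [hnb j] <;> have h3 := hx.1 j <;> have h4 := hx.2 j <;> have h5 := hy.1 j <;>
          have h6 := hy.2 j <;> split_ifs <;> try subst_vars <;> omega
        all_goals omega
      have hsum : ∑ j, (nb x e j - y j).natAbs ≤ n := by
        have h3 : ∑ j, (nb x e j - y j).natAbs < ∑ j, (x j - y j).natAbs := by
          refine Finset.sum_lt_sum (fun j _ => ?_) ⟨i, mem_univ _, ?_⟩
          · rw [hnb]; split_ifs <;> try subst_vars <;> omega
            all_goals omega
          · rw [hnb]; split_ifs <;> omega
        omega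
      have h3 := ih _ hmem hsum
      have h4 := step_le hu (hl x (by rw [mem_Icc, Pi.le_def, Pi.le_def]; exact hx)) e
      refine le_trans ?_ h4
      rw [pow_succ, ← div_div]; gcongr
lemma steps_Q {u : V d → ℝ} (hu : ∀ x, 0 ≤ u x) {z x y : V d} {ℓ : ℕ} (hx : x ∈ Q z ℓ) (hy : y ∈ Q z ℓ)
    (hl : ∀ x ∈ Q z ℓ, 0 ≤ lap u x) : u y / (2 * d) ^ (2 * ℓ * d) ≤ u x := by
  refine steps hu hy hl _ x hx ?_
  have : ∀ i ∈ Finset.univ, (x i - y i).natAbs ≤ 2 * ℓ := by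
    intro i _
    have h1 := abs_le.mp (mem_Q.mp hx i); have h2 := abs_le.mp (mem_Q.mp hy i); omega
  refine (sum_le_sum this).trans ?_
  simp [mul_comm]
noncomputable def c3 (d : ℕ) [hd : Fact (5 ≤ d)] : ℝ := c1 d / (2 * d) ^ (2 * l0 d * d)
lemma c3_pos : 0 < c3 d := by have := c1_pos (d := d); have := dpos (d := d); unfold c3; positivity
lemma gr_ge {B : Finset (V d)} {v y : V d} {r : ℕ} (hr : l0 d ≤ r) (hB : Q v (M0 d * r) ⊆ B) (hy : y ∈ Q v r) :
    c3 d / (r : ℝ) ^ (d - 2) ≤ gr B v y := by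
  have hl := l0_one (d := d)
  have hM := M0_one (d := d)
  have hdp := dpos (d := d)
  have hs : ∀ x ∈ Q v (M0 d * r), 0 ≤ lap (gr B v) x := fun x hx => by rw [gr_lap (hB hx)]; exact ind_nonneg _ _
  have hsub : Q v (l0 d) ⊆ Q v (M0 d * r) := Q_mono _ (hr.trans (Nat.le_mul_of_pos_left _ hM))
  have h1 : ∀ x ∈ Q v (l0 d), 1 / (2 * (d:ℝ)) ^ (2 * l0 d * d) ≤ gr B v x := by
    intro x hx
    refine le_trans ?_ (steps_Q (gr_nonneg B v) hx (Q_self v _) (fun x hx => hs x (hsub hx)))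
    gcongr
    exact gr_self_ge (hB (Q_self v _))
  have h2 := H1 le_rfl hr (gr_nonneg B v) (by positivity) (fun x hx _ => hs x hx) h1 y hy
  refine le_trans ?_ h2
  have hr0 : (0:ℝ) < r := by exact_mod_cast (by omega : 0 < r)
  have hc := c1_pos (d := d)
  have hl' : (1:ℝ) ≤ (l0 d : ℝ) ^ (d - 2) := one_le_pow₀ (by exact_mod_cast hl)
  rw [div_pow, c3]
  calc _ = c1 d * (1 / (r:ℝ) ^ (d - 2)) * (1 / (2 * (d:ℝ)) ^ (2 * l0 d * d)) := by field_simp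
    _ ≤ _ := by gcongr
noncomputable def CH (d : ℕ) [hd : Fact (5 ≤ d)] : ℝ := Cg d * 3 ^ (d - 2) / c3 d
lemma CH_pos : 0 < CH d := by have := c3_pos (d := d); have := Cg_pos (d := d); unfold CH; positivity
lemma harnack {h : V d → ℝ} (h0 : ∀ x, 0 ≤ h x) {z : V d} {s : ℕ} (hs : l0 d ≤ s)
    (hh : ∀ x ∈ Q z ((3 * M0 d + 3) * s), lap h x = 0) {x y : V d} (hx : x ∈ Q z s) (hy : y ∈ Q z s) :
    h x ≤ CH d * h y := by
  have hl := l0_one (d := d)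
  have hM := M0_one (d := d)
  set B := Q z ((3 * M0 d + 3) * s) with hB
  set B1 := Q z (2 * s) with hB1
  have hBB : B1 ⊆ B := Q_mono _ (by nlinarith)
  set ut := sol (B \ B1) (fun x => h x * ind (B1 : Set (V d)) x) 0 with hut
  have ut_in : ∀ x ∈ B1, ut x = h x := fun x hx => by
    rw [hut, sol_off (by simp [hx]), ind_mem (by simpa using hx), mul_one]
  have ut_out : ∀ x ∉ B, ut x = 0 := fun x hx => by
    rw [hut, sol_off (by simp [hx]), ind_not (by simpa using fun h => hx (hBB h)), mul_zero]
  have ut_le : ∀ x, ut x ≤ h x := by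
    refine mp_le' (B \ B1) _ _ (fun x hx => ?_) (fun x hx => ?_)
    · rw [hut, sol_lap hx, hh x (mem_sdiff.mp hx).1]; rfl
    · rw [hut, sol_off hx]; exact mul_le_of_le_one_right (h0 x) (ind_le _ _)
  have mu0 : ∀ v ∈ B1, 0 ≤ lap ut v := by
    intro v hv
    have h1 := hh v (hBB hv)
    rw [lap_def] at h1 ⊢
    rw [ut_in v hv]
    have := av_mono (u := ut) (v := h) (x := v) (fun e => ut_le _)
    linarith
  have mu1 : ∀ v ∈ Q z (2 * s - 1), lap ut v = 0 := by
    intro v hv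
    have h1 := hh v (hBB (Q_mono _ (by omega) hv))
    rw [← h1, lap_def, lap_def, ut_in v (Q_mono _ (by omega) hv)]
    congr 1
    refine av_congr fun e => ut_in _ ?_
    have := nb_mem_Q e hv
    rwa [show 2 * s - 1 + 1 = 2 * s by omega] at this
  have rep : ∀ x, ut x = (∑ v ∈ B1, lap ut v • gr B v) x := by
    refine mp_eq B _ _ (fun x hx => ?_) (fun x hx => ?_)
    · rw [map_sum, Finset.sum_apply]
      simp only [map_smul, Pi.smul_apply, smul_eq_mul, gr_lap hx]
      by_cases hx1 : x ∈ B1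
      · rw [Finset.sum_eq_single x]
        · rw [ind_mem (Set.mem_singleton _), mul_one]
        · intro v _ hvx; rw [ind_not (by simpa using hvx.symm), mul_zero]
        · exact fun h => absurd hx1 h
      · rw [sum_eq_zero]
        · rw [hut, sol_lap (mem_sdiff.mpr ⟨hx, hx1⟩)]; rfl
        · intro v hv; rw [ind_not (by rintro rfl; exact hx1 hv), mul_zero]
    · rw [ut_out x hx, Finset.sum_apply]
      simp [gr_off hx]
  have hsub : Q z s ⊆ B1 := Q_mono _ (by omega)
  have hs0 : (0:ℝ) < s := by exact_mod_cast (by omega : 0 < s)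
  have hc3 := c3_pos (d := d)
  have hCg := Cg_pos (d := d)
  rw [← ut_in x (hsub hx), ← ut_in y (hsub hy), rep x, rep y, Finset.sum_apply, Finset.sum_apply, mul_sum]
  refine sum_le_sum fun v hv => ?_
  simp only [Pi.smul_apply, smul_eq_mul]
  by_cases hv1 : v ∈ Q z (2 * s - 1)
  · rw [mu1 v hv1]; simp
  · have e1 : gr B v x ≤ Cg d * (1 / (s:ℝ) ^ (d - 2)) := by
      refine (gr_le B v x).trans ?_
      have : x - v ∉ Q 0 (s - 1) := by
        rw [← Q_sub]; intro h
        exact hv1 (Q_mono _ (by omega) (Q_tri (Q_symm.mp h) hx))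
      have h2 := fp_le this
      rw [show ((s - 1 : ℕ) : ℝ) + 1 = s by rw [Nat.cast_sub (by omega)]; simp] at h2
      gcongr
    have e2 : c3 d / ((3 * s : ℕ) : ℝ) ^ (d - 2) ≤ gr B v y := by
      refine gr_ge (by omega) (fun w hw => ?_) (Q_mono _ (by omega) (Q_tri hy (Q_symm.mp hv)))
      exact Q_mono _ (by nlinarith) (Q_tri hw hv)
    have e3 : Cg d * (1 / (s:ℝ) ^ (d - 2)) = CH d * (c3 d / ((3 * s : ℕ) : ℝ) ^ (d - 2)) := by
      rw [CH]; push_cast; rw [mul_pow]; field_simp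
    have h4 := mu0 v hv
    calc lap ut v * gr B v x ≤ lap ut v * (CH d * gr B v y) := by
          refine mul_le_mul_of_nonneg_left ?_ h4
          rw [e3] at e1
          exact e1.trans (mul_le_mul_of_nonneg_left e2 CH_pos.le)
      _ = _ := by ring
end

section
variable [hd : Fact (5 ≤ d)]
def tt (o : V d) (e : E d) (x : V d) : ℤ := sg e.2 * (x e.1 - o e.1)
def cc (o : V d) (e : E d) (n : ℕ) : V d := o + Pi.single e.1 (sg e.2 * n)
lemma sg_cases (b : Bool) : sg b = 1 ∨ sg b = -1 := by cases b <;> simp [sg]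
lemma tt_self (o : V d) (e : E d) : tt o e o = 0 := by simp [tt]
lemma tt_abs (o : V d) (e : E d) (x y : V d) : |tt o e x - tt o e y| = |x e.1 - y e.1| := by
  unfold tt
  rcases sg_cases e.2 with h | h <;> rw [h]
  · congr 1; ring
  · rw [abs_sub_comm (x e.1)]; congr 1; ring
lemma tt_Q {o : V d} {e : E d} {x y : V d} {r : ℕ} (h : x ∈ Q y r) : |tt o e x - tt o e y| ≤ r := by
  rw [tt_abs]; exact mem_Q.mp h _
lemma tt_nb (o : V d) (e : E d) (x : V d) (e' : E d) : |tt o e (nb x e') - tt o e x| ≤ 1 := by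
  have := tt_Q (o := o) (e := e) (nb_mem_Q e' (Q_self x 0)); simpa using this
lemma tt_cc (o : V d) (e : E d) (n : ℕ) : tt o e (cc o e n) = n := by
  unfold tt cc; rcases sg_cases e.2 with h | h <;> simp [h]
lemma cc_apply (o : V d) (e : E d) (n : ℕ) (j : Fin d) : cc o e n j = if j = e.1 then o j + sg e.2 * n else o j := by
  unfold cc; by_cases h : j = e.1
  · subst h; simp
  · simp [h]
lemma cc_Q (o : V d) (e : E d) (n : ℕ) : cc o e n ∈ Q o n := by
  rw [mem_Q]; intro j; rw [cc_apply]
  split_ifs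
  · rcases sg_cases e.2 with h | h <;> simp [h]
  · simp
def hull (z z' w : V d) : Prop := ∀ i, min (z i) (z' i) ≤ w i ∧ w i ≤ max (z i) (z' i)
lemma hull_tt {o : V d} {e : E d} {z z' w : V d} (h : hull z z' w) :
    min (tt o e z) (tt o e z') ≤ tt o e w := by
  have := h e.1
  unfold tt; rcases sg_cases e.2 with h | h <;> rw [h] <;> omega
lemma hull_Q {o : V d} {r : ℕ} {z z' w : V d} (h : hull z z' w) (h1 : z ∈ Q o r) (h2 : z' ∈ Q o r) : w ∈ Q o r := by
  rw [mem_Q] at *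
  intro i
  have := h i; have h1 := abs_le.mp (h1 i); have h2 := abs_le.mp (h2 i)
  rw [abs_le]; omega
lemma hm_super {A : Finset (V d)} {R : Set (V d)} {x : V d} (h : x ∈ A ∨ x ∈ R) : 0 ≤ lap (hm A R) x := by
  by_cases hA : x ∈ A
  · rw [hm_lap hA]
  · have hR : x ∈ R := h.resolve_left hA
    rw [lap_def, hm_off hA, ind_mem hR]
    have := av_mono (u := hm A R) (v := fun _ => 1) (x := x) (fun e => hm_le_one _ _ _)
    rw [av_const] at this; linarith
noncomputable def Th (d : ℕ) [hd : Fact (5 ≤ d)] : ℕ := 4 * M0 d + 4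
noncomputable def MM (d : ℕ) [hd : Fact (5 ≤ d)] : ℕ := 16 * M0 d + 16
noncomputable def SS (o : V d) (e : E d) (s : ℕ) : Finset (V d) := Q (cc o e (Th d * s)) s
noncomputable def qq (K : Finset (V d)) (o : V d) (e : E d) (s : ℕ) : V d → ℝ :=
  hm ((Q o (MM d * s) \ K) \ SS o e s) (SS o e s)
noncomputable def vv (K : Finset (V d)) (o : V d) (r : ℕ) : V d → ℝ := hm (Q o r \ K) {x | x ∉ K}
section
variable {K : Finset (V d)} {o : V d} {e : E d}
lemma notK (hK : ∀ k ∈ K, tt o e k < 0) {x : V d} (h : 0 ≤ tt o e x) : x ∉ K := fun h' => by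
  have := hK x h'; omega
lemma SS_tt {s : ℕ} {x : V d} (h : x ∈ SS o e s) : ((Th d * s : ℕ) : ℤ) - s ≤ tt o e x := by
  have := abs_le.mp (tt_Q (o := o) (e := e) h); rw [tt_cc] at this; omega
lemma SS_Q {s : ℕ} {x : V d} (h : x ∈ SS o e s) : x ∈ Q o ((Th d + 1) * s) := by
  have := Q_tri h (cc_Q o e (Th d * s)); rwa [show s + Th d * s = (Th d + 1) * s by ring] at this
lemma qq_super {s : ℕ} {x : V d} (h : x ∈ Q o (MM d * s)) (hx : x ∉ K) : 0 ≤ lap (qq K o e s) x := by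
  refine hm_super ?_
  by_cases h1 : x ∈ SS o e s
  · right; exact h1
  · left; simp [h, hx, h1]
lemma qq_nonneg (s : ℕ) (x : V d) : 0 ≤ qq K o e s x := hm_nonneg _ _ _
lemma qq_SS {s : ℕ} {x : V d} (h : x ∈ SS o e s) : qq K o e s x = 1 := by
  unfold qq; rw [hm_off (by simp [h]), ind_mem (by exact h)]
lemma chainK (hK : ∀ k ∈ K, tt o e k < 0) {u : V d → ℝ} (hu : ∀ x, 0 ≤ u x) {r W n : ℕ} (hr : l0 d ≤ r)
    (hs : ∀ x ∈ Q o (W + 2 * M0 d * r), x ∉ K → 0 ≤ lap u x) {z z' : V d} {θ : ℝ} (hθ : 0 ≤ θ)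
    (hz : z ∈ Q o W) (hz' : z' ∈ Q o W) (hzt : ((2 * M0 d * r : ℕ) : ℤ) ≤ tt o e z) (hzt' : ((2 * M0 d * r : ℕ) : ℤ) ≤ tt o e z')
    (hn : ∀ i, |z i - z' i| ≤ (n * r : ℕ)) (h : ∀ x ∈ Q z r, θ ≤ u x) : ∀ x ∈ Q z' r, c2 d ^ n * θ ≤ u x := by
  refine chain hr hu n hθ hn (fun w hw x hx => ?_) h
  have h1 : w ∈ Q o W := hull_Q hw hz hz'
  have h2 := hull_tt (o := o) (e := e) hw
  have h3 := abs_le.mp (tt_Q (o := o) (e := e) hx)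
  refine hs x ?_ (notK hK (by omega))
  have := Q_tri hx h1; rwa [add_comm] at this
lemma qq_double (hK : ∀ k ∈ K, tt o e k < 0) {s : ℕ} (hs : l0 d ≤ s) (x : V d) :
    c2 d ^ (Th d) * qq K o e s x ≤ qq K o e (2 * s) x := by
  have hc := c2_pos (d := d)
  have hM := M0_one (d := d)
  have h1 : ∀ y ∈ SS o e s, c2 d ^ (Th d) * 1 ≤ qq K o e (2 * s) y := by
    refine chainK (W := Th d * (2 * s)) hK (qq_nonneg _) (r := s) hs (fun x hx hxK => qq_super ?_ hxK) zero_le_one (cc_Q o e _)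
      (Q_mono _ (by nlinarith) (cc_Q o e (Th d * s))) ?_ ?_ ?_ (z := cc o e (Th d * (2 * s))) (fun x hx => ?_)
    · exact Q_mono _ (by simp only [Th, MM]; nlinarith) hx
    · rw [tt_cc]; norm_cast; simp only [Th]; nlinarith
    · rw [tt_cc]; norm_cast; simp only [Th]; nlinarith
    · intro i; rw [cc_apply, cc_apply]
      split_ifs
      · rcases sg_cases e.2 with h | h <;> rw [h] <;> push_cast <;> rw [abs_le] <;> constructor <;> nlinarith
      · simp; positivity
    · exact (qq_SS (Q_mono _ (by omega) hx)).ge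
  have key : ∀ x, (c2 d ^ (Th d) • qq K o e s) x ≤ qq K o e (2 * s) x := by
    refine mp_le' ((Q o (MM d * s) \ K) \ SS o e s) _ _ (fun x hx => ?_) (fun x hx => ?_)
    · rw [map_smul, Pi.smul_apply, qq, hm_lap hx, smul_zero]
      simp only [mem_sdiff] at hx
      exact qq_super (Q_mono _ (by nlinarith) hx.1.1) hx.1.2
    · by_cases h : x ∈ SS o e s
      · rw [Pi.smul_apply, qq_SS h]; exact h1 x h
      · rw [Pi.smul_apply, qq, hm_off hx, ind_not (by exact h), smul_zero]; exact qq_nonneg _ _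
  exact key x
end
end

section
variable [hd : Fact (5 ≤ d)]
lemma lap_sqr (j : Fin d) (a : ℝ) (x : V d) : lap (fun x : V d => ((x j : ℝ) - a) ^ 2) x = -1 / d := by
  have hp := dpos (d := d)
  rw [lap_def, av_def]
  have : ∀ e : E d, (((nb x e) j : ℝ) - a) ^ 2 = ((x j : ℝ) + (if e.1 = j then (sg e.2 : ℝ) else 0) - a) ^ 2 := by
    intro e; simp only [nb, Pi.add_apply, Int.cast_add]
    by_cases h : e.1 = j
    · subst h; simp
    · simp [h]
  simp only [this]
  rw [sumE (fun i s => ((x j : ℝ) + (if i = j then s else 0) - a) ^ 2),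
    sum_congr rfl (fun i _ => show _ = 2 * ((x j : ℝ) - a) ^ 2 + (if i = j then (2:ℝ) else 0) by split_ifs <;> ring)]
  rw [sum_add_distrib]; simp
  field_simp; ring
def rf (a : ℤ) (i : Fin d) (x : V d) : V d := Function.update x i (a - x i)
lemma rf_apply (a : ℤ) (i : Fin d) (x : V d) (j : Fin d) : rf a i x j = if j = i then a - x j else x j := by
  unfold rf; by_cases h : j = i
  · subst h; simp
  · simp [h]
lemma rf_nb (a : ℤ) (i : Fin d) (x : V d) (e : E d) : rf a i (nb x e) = nb (rf a i x) (e.1, if e.1 = i then !e.2 else e.2) := by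
  funext j
  simp only [nb, rf_apply, Pi.add_apply, Pi.single_apply]
  by_cases h : j = i <;> by_cases h' : e.1 = i <;> by_cases h2 : j = e.1 <;> simp_all [sg] <;> (try (cases e.2 <;> simp <;> ring))
lemma lap_rf (a : ℤ) (i : Fin d) (u : V d → ℝ) (x : V d) : lap (fun x => u (rf a i x)) x = lap u (rf a i x) := by
  rw [lap_def, lap_def, av_def, av_def]; congr 2
  simp only [rf_nb]
  have hi : Function.Involutive (fun e : E d => ((e.1, if e.1 = i then !e.2 else e.2) : E d)) := by
    intro e; by_cases h : e.1 = i <;> simp [h]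
    ext <;> simp [h]
  exact hi.bijective.sum_comp (fun e => u (nb (rf a i x) e))
lemma rf_Q {a : ℤ} {i : Fin d} {x o : V d} {r : ℕ} (h : a = 2 * o i) : rf a i x ∈ Q o r ↔ x ∈ Q o r := by
  rw [mem_Q, mem_Q]; refine forall_congr' fun j => ?_
  rw [rf_apply]; split_ifs with hj
  · subst hj; rw [h, show 2 * o j - x j - o j = -(x j - o j) by ring, abs_neg]
  · rfl
lemma tt_rf (o : V d) (e : E d) (x : V d) (τ : ℤ) : tt o e (rf (2 * (o e.1 + sg e.2 * τ)) e.1 x) = 2 * τ - tt o e x := by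
  unfold tt; rw [rf_apply, if_pos rfl]; rcases sg_cases e.2 with h | h <;> rw [h] <;> ring
section
variable {K : Finset (V d)} {o : V d} {e : E d}
noncomputable def Sl (o : V d) (e : E d) (W : ℕ) (D : ℤ) : Finset (V d) := (Q o W).filter (fun x => |tt o e x| < D)
lemma mem_Sl {o : V d} {e : E d} {W : ℕ} {D : ℤ} {x : V d} : x ∈ Sl o e W D ↔ x ∈ Q o W ∧ |tt o e x| < D := by
  simp [Sl]
lemma top_bot (hK : ∀ k ∈ K, tt o e k < 0) (W : ℕ) {D : ℤ} (hD : 0 < D) :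
    hm (Sl o e W D \ K) {x | x ∉ K ∧ tt o e x ≤ -D} o ≤ hm (Sl o e W D \ K) {x | D ≤ tt o e x} o := by
  set U := (Sl o e W D).filter (fun x => 0 < tt o e x) with hU
  set L := (Sl o e W D \ K).filter (fun x => tt o e x < 0) with hL
  set T0 := hm U {x | D ≤ tt o e x} with hT0
  set B0 := hm L {x | x ∉ K ∧ tt o e x ≤ -D} with hB0
  have hrf : ∀ x, tt o e (rf (2 * o e.1) e.1 x) = - tt o e x := fun x => by
    have := tt_rf o e x 0; simpa using this
  have hrS : ∀ x, rf (2 * o e.1) e.1 x ∈ Sl o e W D ↔ x ∈ Sl o e W D := fun x => by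
    rw [mem_Sl, mem_Sl, rf_Q rfl, hrf, abs_neg]
  have hBT : ∀ x, B0 x ≤ T0 (rf (2 * o e.1) e.1 x) := by
    refine mp_le' L B0 (fun x => T0 (rf (2 * o e.1) e.1 x)) (fun x hx => ?_) (fun x hx => ?_)
    · rw [lap_rf, hB0, hm_lap hx, hT0, hm_lap]
      simp only [hL, hU, mem_filter, mem_sdiff, hrf, hrS] at hx ⊢
      exact ⟨hx.1.1, by omega⟩
    · rw [hB0, hm_off hx]
      by_cases h : x ∈ {x | x ∉ K ∧ tt o e x ≤ -D}
      · refine (ind_le _ _).trans ?_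
        rw [hT0, hm_off, ind_mem]
        · simp only [Set.mem_setOf_eq, hrf]; have := h.2; omega
        · simp only [hU, mem_filter, mem_Sl, hrf, abs_neg]; intro h'; have := abs_lt.mp h'.1.2; have := h.2; omega
      · rw [ind_not h]; exact hm_nonneg _ _ _
  have hT00 : ∀ x, tt o e x ≤ 0 → T0 x = 0 := fun x hx => by
    rw [hT0, hm_off, ind_not]
    · simp only [Set.mem_setOf_eq]; omega
    · simp only [hU, mem_filter]; omega
  have hB00 : ∀ x, 0 ≤ tt o e x → B0 x = 0 := fun x hx => by
    rw [hB0, hm_off, ind_not]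
    · simp only [Set.mem_setOf_eq]; omega
    · simp only [hL, mem_filter]; omega
  have key : ∀ x, (hm (Sl o e W D \ K) {x | x ∉ K ∧ tt o e x ≤ -D} - B0) x ≤ (hm (Sl o e W D \ K) {x | D ≤ tt o e x} - T0) x := by
    refine mp_le' (Sl o e W D \ K) _ _ (fun x hx => ?_) (fun x hx => ?_)
    · rw [map_sub, map_sub, Pi.sub_apply, Pi.sub_apply, hm_lap hx, hm_lap hx]
      suffices h : lap T0 x ≤ lap B0 x by linarith
      have hx' := mem_sdiff.mp hx
      rcases lt_trichotomy (tt o e x) 0 with h | h | h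
      · have hxL : x ∈ L := mem_filter.mpr ⟨hx, h⟩
        rw [hB0, hm_lap hxL, lap_def, hT00 x h.le]
        have := nonneg_avg (u := T0) (fun y => hm_nonneg _ _ _) x
        linarith
      · rw [lap_def, lap_def, hT00 x h.le, hB00 x h.ge]
        have h1 : av B0 x ≤ av (fun y => T0 (rf (2 * o e.1) e.1 y)) x := av_mono (fun e' => hBT _)
        have h2 := lap_rf (2 * o e.1) e.1 T0 x
        rw [lap_def, lap_def] at h2
        have h3 : rf (2 * o e.1) e.1 x = x := by
          funext j; rw [rf_apply]; split_ifs with hj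
          · subst hj; unfold tt at h; rcases sg_cases e.2 with h' | h' <;> rw [h'] at h <;> linarith
          · rfl
        rw [h3] at h2; linarith
      · have hxU : x ∈ U := mem_filter.mpr ⟨hx'.1, h⟩
        rw [hT0, hm_lap hxU, hB0]
        have : lap B0 x = B0 x - av B0 x := lap_def _ _
        have h0 : av B0 x = av (fun _ => 0) x := av_congr (fun e' => hB00 _ (by have := abs_le.mp (tt_nb o e x e'); omega))
        rw [hB00 x h.le, h0, av_const] at this
        rw [this]; simp
    · rw [Pi.sub_apply, Pi.sub_apply, hm_off hx, hm_off hx, hB0, hm_off, hT0]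
      · by_cases hU' : x ∈ U
        · have : x ∈ K := by
            by_contra h; exact hx (mem_sdiff.mpr ⟨(mem_filter.mp hU').1, h⟩)
          have h1 := hK x this; have h2 := (mem_filter.mp hU').2; omega
        · rw [hm_off hU']; simp
      · exact fun h => hx (mem_filter.mp h).1
  have := key o
  simp only [Pi.sub_apply] at this
  rw [hT00 o (by rw [tt_self]), hB00 o (by rw [tt_self])] at this
  simpa using this
lemma lat_le (hK : ∀ k ∈ K, tt o e k < 0) {s : ℕ} {D : ℕ} (hs : 1 ≤ s) (hD : D ≤ s) :
    hm (Sl o e (2 * s) D \ K) {x | x ∉ K ∧ |tt o e x| < D ∧ x ∉ Q o (2 * s)} o ≤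
      ((d : ℝ) * D ^ 2 / s ^ 2) * vv K o s o := by
  have hs' : (0:ℝ) < s := by exact_mod_cast hs
  have hdp := dpos (d := d)
  set S := Sl o e (2 * s) D \ K with hS
  set la := hm S {x | x ∉ K ∧ |tt o e x| < D ∧ x ∉ Q o (2 * s)} with hla
  have hnn : 0 ≤ (d : ℝ) * D ^ 2 / s ^ 2 := by positivity
  have hF : ∀ y ∈ Q o (s + 1), la y ≤ (d : ℝ) * D ^ 2 / s ^ 2 := by
    intro y hy
    by_cases hyS : y ∈ S
    swap
    · rw [hla, hm_off hyS]
      by_cases hc : |tt o e y| < D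
      · by_cases hyK : y ∈ K
        · rw [ind_not (fun h => h.1 hyK)]; exact hnn
        · have h3 : y ∉ Q o (2 * s) := fun h => hyS (by simp only [hS, mem_sdiff, mem_Sl]; exact ⟨⟨h, hc⟩, hyK⟩)
          exact absurd (Q_mono _ (by omega) hy) h3
      · rw [ind_not (fun h => hc h.2.1)]; exact hnn
    set F : V d → ℝ := fun x => (1 / s ^ 2 : ℝ) * (∑ j ∈ Finset.univ.erase e.1, ((x j : ℝ) - y j) ^ 2 + ((d : ℝ) - 1) * (D ^ 2 - ((x e.1 : ℝ) - o e.1) ^ 2)) with hFdef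
    have hFe : F = (1 / s ^ 2 : ℝ) • (∑ j ∈ Finset.univ.erase e.1, (fun x : V d => ((x j : ℝ) - y j) ^ 2) + ((d : ℝ) - 1) • ((fun _ => (D ^ 2 : ℝ)) - fun x : V d => ((x e.1 : ℝ) - o e.1) ^ 2)) := by
      funext x; simp [hFdef, Finset.sum_apply]
    have hd1 : (0:ℝ) ≤ (d : ℝ) - 1 := by have := d5 (d := d); linarith
    have htt : ∀ x : V d, ((x e.1 : ℝ) - o e.1) ^ 2 = (tt o e x : ℝ) ^ 2 := fun x => by
      unfold tt; rcases sg_cases e.2 with h | h <;> rw [h] <;> push_cast <;> ring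
    have hFn : ∀ x, |tt o e x| ≤ D → 0 ≤ D ^ 2 - ((x e.1 : ℝ) - o e.1) ^ 2 := fun x hx => by
      rw [htt]
      have : |(tt o e x : ℝ)| ≤ D := by exact_mod_cast hx
      have := sq_le_sq' (by linarith [abs_le.mp this]) (abs_le.mp this).2
      linarith
    have key : la y ≤ F y := by
      refine mp_le S la F (fun x hx => ?_) (fun x hx => ?_) y hyS
      · rw [hla, hm_lap hx, hFe, map_smul, map_add, map_smul, map_sub, map_sum, Pi.smul_apply, Pi.add_apply, Pi.smul_apply, Pi.sub_apply, Finset.sum_apply, lap_const, lap_sqr]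
        simp only [lap_sqr, sum_const, Finset.card_erase_of_mem (mem_univ _), card_univ, Fintype.card_fin]
        rw [nsmul_eq_mul, Nat.cast_sub (by have := hd.out; omega)]
        apply le_of_eq; simp only [smul_eq_mul]; field_simp; push_cast; ring
      · obtain ⟨hx, x', hx', e', rfl⟩ := hx
        simp only [hS, mem_sdiff, mem_Sl] at hx'
        have h1 := abs_le.mp (tt_nb o e x' e')
        have h2 := abs_lt.mp hx'.1.2
        have h3 : |tt o e (nb x' e')| ≤ D := abs_le.mpr (by omega)
        have h4 := mul_nonneg hd1 (hFn _ h3)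
        rw [hla, hm_off hx]
        by_cases hc : nb x' e' ∈ {x | x ∉ K ∧ |tt o e x| < D ∧ x ∉ Q o (2 * s)}
        · rw [ind_mem hc]
          obtain ⟨-, hc1, hc2⟩ := hc
          rw [mem_Q] at hc2; push Not at hc2
          obtain ⟨j, hj⟩ := hc2
          have hje : j ≠ e.1 := by
            rintro rfl
            have := tt_abs o e (nb x' e') o; rw [tt_self, sub_zero] at this
            push_cast at hj; omega
          have h5 : s ^ 2 ≤ (((nb x' e') j : ℝ) - y j) ^ 2 := by
            have hyj := mem_Q.mp hy j
            have : (s : ℤ) ≤ |(nb x' e') j - y j| := by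
              have h7 := abs_sub_le ((nb x' e') j) (y j) (o j); push_cast at hj hyj; omega
            have h8 : (s : ℝ) ≤ |((nb x' e') j : ℝ) - y j| := by exact_mod_cast this
            rw [← sq_abs (_ - _)]; gcongr
          have h6 := single_le_sum (f := fun j => (((nb x' e') j : ℝ) - y j) ^ 2) (fun _ _ => sq_nonneg _) (mem_erase.mpr ⟨hje, mem_univ j⟩)
          simp only [hFdef]
          rw [one_div, ← div_eq_inv_mul, le_div_iff₀ (by positivity)]
          linarith
        · rw [ind_not hc]
          simp only [hFdef]
          have := sum_nonneg (s := Finset.univ.erase e.1) (f := fun j => (((nb x' e') j : ℝ) - y j) ^ 2) (fun _ _ => sq_nonneg _)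
          positivity
    refine key.trans ?_
    simp only [hFdef]
    rw [sum_eq_zero (fun j _ => by simp), one_div, ← div_eq_inv_mul, zero_add]
    have h9 := mul_nonneg hd1 (sq_nonneg ((y e.1 : ℝ) - o e.1))
    have h10 := sq_nonneg (D : ℝ)
    rw [div_le_div_iff_of_pos_right (by positivity)]
    linarith
  have key : ∀ x, la x ≤ (((d : ℝ) * D ^ 2 / s ^ 2) • vv K o s) x ∨ x ∉ (S ∩ Q o s) := by
    intro x
    by_cases hx : x ∈ S ∩ Q o s
    swap
    · exact Or.inr hx
    left
    refine mp_le (S ∩ Q o s) la _ (fun x hx => ?_) (fun x hx => ?_) x hx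
    · rw [mem_inter] at hx
      rw [hla, hm_lap hx.1, map_smul, Pi.smul_apply, vv, hm_lap, smul_zero]
      simp only [hS, mem_sdiff] at hx ⊢; exact ⟨hx.2, hx.1.2⟩
    · obtain ⟨hx, x', hx', e', rfl⟩ := hx
      rw [mem_inter] at hx'
      rw [Pi.smul_apply, smul_eq_mul]
      have hv := hm_nonneg (Q o s \ K) {x | x ∉ K} (nb x' e')
      by_cases hzero : la (nb x' e') = 0
      · rw [hzero]; exact mul_nonneg hnn hv
      · have h1 := hF _ (nb_mem_Q e' hx'.2)
        have hnK : nb x' e' ∉ K := fun h => hzero (by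
          rw [hla, hm_off (by simp [hS, h]), ind_not (fun h' => h'.1 h)])
        have h2 : nb x' e' ∉ Q o s := by
          intro h
          refine hzero ?_
          have h3 : nb x' e' ∉ S := fun h' => hx (mem_inter.mpr ⟨h', h⟩)
          rw [hla, hm_off h3, ind_not]
          exact fun h' => h'.2.2 (Q_mono _ (by omega) h)
        rw [vv, hm_off (by simp [h2]), ind_mem (by exact hnK), mul_one]; exact h1
  by_cases hD0 : D = 0
  · have : o ∉ S := by simp [hS, mem_Sl, hD0, tt_self]
    rw [hla, hm_off this, ind_not]
    · exact mul_nonneg hnn (hm_nonneg _ _ _)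
    · simp [Q_self]
  · rcases key o with h | h
    · exact h
    · exfalso; apply h
      simp only [hS, mem_inter, mem_sdiff, mem_Sl, tt_self, Q_self, abs_zero]
      exact ⟨⟨⟨trivial, by exact_mod_cast Nat.pos_of_ne_zero hD0⟩, notK hK (by rw [tt_self])⟩, trivial⟩
end
end

section
variable [hd : Fact (5 ≤ d)]
lemma JJ_exists : ∃ J : ℕ, 2 * M0 d + 1 ≤ J ∧ (d : ℝ) * (2 * M0 d) ^ 2 / J ^ 2 ≤ c2 d ^ Th d / 2 := by
  have hc : 0 < c2 d ^ Th d / 2 := by have := c2_pos (d := d); positivity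
  obtain ⟨n, hn⟩ := exists_nat_gt ((d : ℝ) * (2 * M0 d) ^ 2 / (c2 d ^ Th d / 2))
  refine ⟨n + 2 * M0 d + 1, by omega, ?_⟩
  rw [div_lt_iff₀ hc] at hn
  rw [div_le_iff₀ (by positivity)]
  push_cast
  have h1 : (n : ℝ) ≤ ((n : ℝ) + 2 * M0 d + 1) ^ 2 := by nlinarith [(Nat.cast_nonneg n : (0:ℝ) ≤ n), (Nat.cast_nonneg (M0 d) : (0:ℝ) ≤ M0 d)]
  nlinarith
noncomputable def JJ (d : ℕ) [hd : Fact (5 ≤ d)] : ℕ := (JJ_exists (d := d)).choose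
lemma JJ_ge : 2 * M0 d + 1 ≤ JJ d := (JJ_exists (d := d)).choose_spec.1
lemma JJ_eps : (d : ℝ) * (2 * M0 d) ^ 2 / JJ d ^ 2 ≤ c2 d ^ Th d / 2 := (JJ_exists (d := d)).choose_spec.2
noncomputable def sc (d : ℕ) [hd : Fact (5 ≤ d)] (i : ℕ) : ℕ := 2 ^ i * (JJ d * l0 d)
lemma sc_succ (i : ℕ) : sc d (i + 1) = 2 * sc d i := by unfold sc; ring
lemma sc_ge (i : ℕ) : l0 d ≤ sc d i := by
  have := JJ_ge (d := d)
  unfold sc; calc l0 d = 1 * (1 * l0 d) := by ring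
    _ ≤ _ := Nat.mul_le_mul Nat.one_le_two_pow (Nat.mul_le_mul (by omega) le_rfl)
lemma sc_one (i : ℕ) : 1 ≤ sc d i := l0_one.trans (sc_ge i)
noncomputable def cd (d : ℕ) [hd : Fact (5 ≤ d)] : ℝ := c2 d ^ ((2 * Th d + 3) * JJ d)
noncomputable def Csep (d : ℕ) [hd : Fact (5 ≤ d)] : ℝ := 4 / cd d + (2 * d) ^ (Th d * sc d 0)
lemma cd_pos : 0 < cd d := by have := c2_pos (d := d); unfold cd; positivity
lemma Csep_pos : 0 < Csep d := by have := cd_pos (d := d); have := dpos (d := d); unfold Csep; positivity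
variable {K : Finset (V d)} {o : V d} {e : E d}
lemma top_le (hK : ∀ k ∈ K, tt o e k < 0) {r : ℕ} (hr : l0 d ≤ r) (x : V d) :
    cd d * hm (Sl o e (2 * (JJ d * r)) (2 * M0 d * r : ℕ) \ K) {x | ((2 * M0 d * r : ℕ) : ℤ) ≤ tt o e x} x ≤ qq K o e (2 * (JJ d * r)) x
      ∨ x ∉ Sl o e (2 * (JJ d * r)) (2 * M0 d * r : ℕ) \ K := by
  have hM := M0_one (d := d)
  have hJ := JJ_ge (d := d)
  have hl := l0_one (d := d)
  set S := Sl o e (2 * (JJ d * r)) (2 * M0 d * r : ℕ) \ K with hS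
  by_cases hx : x ∈ S
  swap
  · exact Or.inr hx
  left
  refine mp_le S (cd d • hm S {x | ((2 * M0 d * r : ℕ) : ℤ) ≤ tt o e x}) _ (fun x hx => ?_) (fun x hx => ?_) x hx
  · rw [map_smul, Pi.smul_apply, hm_lap hx, smul_zero]
    simp only [hS, mem_sdiff, mem_Sl] at hx
    exact qq_super (Q_mono _ (Nat.le_mul_of_pos_left _ (by unfold MM; omega)) hx.1.1) hx.2
  · rw [Pi.smul_apply, hm_off hx.1, smul_eq_mul]
    by_cases ht : ((2 * M0 d * r : ℕ) : ℤ) ≤ tt o e x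
    swap
    · rw [ind_not (by exact ht), mul_zero]; exact qq_nonneg _ _
    rw [ind_mem (by exact ht)]
    obtain ⟨-, x', hx', e', rfl⟩ := hx
    simp only [hS, mem_sdiff, mem_Sl] at hx'
    have hQ := nb_mem_Q e' hx'.1.1
    have hJr : 1 ≤ JJ d * r := Nat.mul_pos (by omega) (by omega)
    refine chainK (W := Th d * (2 * (JJ d * r))) hK (qq_nonneg _) (r := r) hr (fun x hx hxK => qq_super ?_ hxK) zero_le_one (cc_Q o e _)
      (Q_mono _ ?_ hQ) ?_ ht ?_ (z := cc o e (Th d * (2 * (JJ d * r)))) (fun x hx => ?_) _ (Q_self _ _)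
    · refine Q_mono _ ?_ hx
      simp only [Th, MM]; nlinarith [Nat.mul_le_mul (show 2 * M0 d ≤ JJ d by omega) (le_refl r)]
    · simp only [Th]; nlinarith
    · rw [tt_cc]; norm_cast; simp only [Th]; nlinarith [Nat.mul_le_mul (show 2 * M0 d ≤ JJ d by omega) (le_refl r)]
    · intro i
      have h1 := mem_Q.mp (cc_Q o e (Th d * (2 * (JJ d * r)))) i
      have h2 := mem_Q.mp hQ i
      have h3 := abs_sub_le (cc o e (Th d * (2 * (JJ d * r))) i) (o i) (nb x' e' i)
      rw [abs_sub_comm (o i)] at h3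
      have h4 : Th d * (2 * (JJ d * r)) + (2 * (JJ d * r) + 1) ≤ (2 * Th d + 3) * JJ d * r := by nlinarith
      have h5 : ((Th d * (2 * (JJ d * r)) + (2 * (JJ d * r) + 1) : ℕ) : ℤ) ≤ ((2 * Th d + 3) * JJ d * r : ℕ) := by exact_mod_cast h4
      rw [Nat.cast_add] at h5
      linarith
    · refine (qq_SS (Q_mono _ ?_ hx)).ge
      nlinarith
lemma vv_le (hK : ∀ k ∈ K, tt o e k < 0) (W : ℕ) (D : ℤ) (x : V d) : vv K o W x ≤
    hm (Sl o e W D \ K) {x | D ≤ tt o e x} x + hm (Sl o e W D \ K) {x | x ∉ K ∧ tt o e x ≤ -D} x +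
      hm (Sl o e W D \ K) {x | x ∉ K ∧ |tt o e x| < D ∧ x ∉ Q o W} x := by
  refine mp_le' (Sl o e W D \ K) (vv K o W) (hm (Sl o e W D \ K) {x | D ≤ tt o e x} + hm (Sl o e W D \ K) {x | x ∉ K ∧ tt o e x ≤ -D} +
      hm (Sl o e W D \ K) {x | x ∉ K ∧ |tt o e x| < D ∧ x ∉ Q o W}) (fun x hx => ?_) (fun x hx => ?_) x
  · rw [map_add, map_add, Pi.add_apply, Pi.add_apply, hm_lap hx, hm_lap hx, hm_lap hx, vv, hm_lap]
    · simp
    · simp only [mem_sdiff, mem_Sl] at hx ⊢; exact ⟨hx.1.1, hx.2⟩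
  · rw [Pi.add_apply, Pi.add_apply, hm_off hx, hm_off hx, hm_off hx]
    have h1 := ind_nonneg {x | D ≤ tt o e x} x
    have h2 := ind_nonneg {x | x ∉ K ∧ tt o e x ≤ -D} x
    have h3 := ind_nonneg {x | x ∉ K ∧ |tt o e x| < D ∧ x ∉ Q o W} x
    by_cases hxK : x ∈ K
    · rw [vv, hm_off (by simp [hxK]), ind_not (by simp [hxK])]; linarith
    · have hv : vv K o W x ≤ 1 := hm_le_one _ _ _
      by_cases h : |tt o e x| < D
      · have : x ∉ Q o W := fun h' => hx (by simp only [mem_sdiff, mem_Sl]; exact ⟨⟨h', h⟩, hxK⟩)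
        rw [ind_mem (R := {x | x ∉ K ∧ |tt o e x| < D ∧ x ∉ Q o W}) ⟨hxK, h, this⟩]; linarith
      · push Not at h
        rcases le_abs.mp h with h | h
        · rw [ind_mem (R := {x | D ≤ tt o e x}) h]; linarith
        · rw [ind_mem (R := {x | x ∉ K ∧ tt o e x ≤ -D}) ⟨hxK, by omega⟩]; linarith
lemma sep_base (hK : ∀ k ∈ K, tt o e k < 0) (s : ℕ) : 1 ≤ (2 * d) ^ (Th d * s) * qq K o e s o := by
  have hM := M0_one (d := d)
  have h2 := d2pos (d := d)
  set p : V d := fun i => min (o i) (cc o e (Th d * s) i)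
  set q : V d := fun i => max (o i) (cc o e (Th d * s) i)
  have hin : ∀ x, x ∈ Finset.Icc p q ↔ hull o (cc o e (Th d * s)) x := fun x => by
    rw [mem_Icc, Pi.le_def, Pi.le_def, ← forall_and]; rfl
  have := steps (u := qq K o e s) (qq_nonneg s) (p := p) (q := q) (y := cc o e (Th d * s)) (by rw [hin]; intro i; simp)
    (fun x hx => ?_) (Th d * s) o (by rw [hin]; intro i; simp) ?_
  · rw [qq_SS (by exact Q_self _ _), div_le_iff₀ (by positivity)] at this; linarith
  · rw [hin] at hx
    refine qq_super ?_ (notK hK ?_)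
    · refine Q_mono _ ?_ (hull_Q hx (Q_self _ _) (cc_Q o e (Th d * s)))
      simp only [Th, MM]; nlinarith
    · have := hull_tt (o := o) (e := e) hx
      rw [tt_self, tt_cc] at this; omega
  · rw [Finset.sum_eq_single e.1]
    · rw [cc_apply, if_pos rfl]; rcases sg_cases e.2 with h | h <;> rw [h] <;> simp <;> omega
    · intro j _ hj; rw [cc_apply, if_neg hj]; simp
    · simp
lemma sep (hK : ∀ k ∈ K, tt o e k < 0) (i : ℕ) : vv K o (sc d i) o ≤ Csep d * qq K o e (sc d i) o := by
  have hcd := cd_pos (d := d)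
  have hc2 := c2_pos (d := d)
  have hC := Csep_pos (d := d)
  have hM := M0_one (d := d)
  have hl := l0_one (d := d)
  have hdp := dpos (d := d)
  induction i with
  | zero =>
    have h1 := sep_base hK (sc d 0)
    have h2 : vv K o (sc d 0) o ≤ 1 := hm_le_one _ _ _
    have h3 := qq_nonneg (K := K) (o := o) (e := e) (sc d 0) o
    unfold Csep
    have : 0 ≤ 4 / cd d * qq K o e (sc d 0) o := by positivity
    linarith
  | succ i ih =>
    set s := sc d i with hs
    rw [sc_succ, ← hs]
    set r := 2 ^ i * l0 d with hr
    have hsr : s = JJ d * r := by rw [hs, hr, sc]; ring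
    have hr0 : l0 d ≤ r := by rw [hr]; exact Nat.le_mul_of_pos_left _ (by positivity)
    set D := 2 * M0 d * r with hD
    have hDs : D ≤ s := by rw [hsr, hD]; exact Nat.mul_le_mul (by have := JJ_ge (d := d); omega) le_rfl
    have hD0 : 0 < D := by rw [hD]; exact Nat.mul_pos (by omega) (by omega)
    have h1 := vv_le hK (2 * s) D o
    have h2 := top_bot hK (2 * s) (D := D) (by exact_mod_cast hD0)
    have h3 := lat_le hK (s := s) (D := D) (by omega) hDs
    have h4 := (top_le hK hr0 o).resolve_right (by
      rw [not_not]; simp only [mem_sdiff, mem_Sl, tt_self, Q_self, abs_zero]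
      exact ⟨⟨trivial, by exact_mod_cast hD0⟩, notK hK (by rw [tt_self])⟩)
    rw [← hsr, ← hD] at h4
    have h5 := qq_double hK (sc_ge i) o
    rw [← hs] at h5
    have h6 : (d : ℝ) * D ^ 2 / s ^ 2 ≤ c2 d ^ Th d / 2 := by
      refine le_trans (le_of_eq ?_) (JJ_eps (d := d))
      have : (r : ℝ) ≠ 0 := by have : r ≠ 0 := by omega
                               exact_mod_cast this
      have : (JJ d : ℝ) ≠ 0 := by have : JJ d ≠ 0 := by have := JJ_ge (d := d); omega
                                  exact_mod_cast this
      rw [hsr, hD]; push_cast; field_simp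
    have h7 : 0 ≤ vv K o s o := hm_nonneg _ _ _
    have h8 := qq_nonneg (K := K) (o := o) (e := e) (2 * s) o
    have h9 : (d : ℝ) * D ^ 2 / s ^ 2 * vv K o s o ≤ Csep d / 2 * qq K o e (2 * s) o := by
      calc _ ≤ c2 d ^ Th d / 2 * (Csep d * qq K o e s o) := mul_le_mul h6 ih h7 (by positivity)
        _ = Csep d / 2 * (c2 d ^ Th d * qq K o e s o) := by ring
        _ ≤ _ := by gcongr
    have h10 : hm (Sl o e (2 * s) D \ K) {x | (D : ℤ) ≤ tt o e x} o ≤ 1 / cd d * qq K o e (2 * s) o := by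
      rw [one_div, ← div_eq_inv_mul, le_div_iff₀ hcd]; linarith
    have h11 : 4 / cd d * qq K o e (2 * s) o ≤ Csep d * qq K o e (2 * s) o := by
      refine mul_le_mul_of_nonneg_right ?_ h8
      unfold Csep
      have : (0:ℝ) ≤ (2 * d) ^ (Th d * sc d 0) := by positivity
      linarith
    have h12 : 4 / cd d * qq K o e (2 * s) o = 4 * (1 / cd d * qq K o e (2 * s) o) := by ring
    linarith
end

section
variable [hd : Fact (5 ≤ d)]
noncomputable def La (d : ℕ) [hd : Fact (5 ≤ d)] : ℕ := ⌈2 / cf d⌉₊ + 8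
lemma La_ge : 8 ≤ La d := by unfold La; omega
lemma La_cf : 2 / cf d ≤ La d := (Nat.le_ceil _).trans (by unfold La; push_cast; linarith)
structure Geo (A0 K : Finset (V d)) (o : V d) (e : E d) (N' N s : ℕ) : Prop where
  hA : Q 0 (4 * N) ⊆ A0
  hK : ∀ k ∈ K, tt o e k < 0
  hK' : K ⊆ Q 0 N'
  ho : o ∈ Q 0 N'
  hs : l0 d ≤ s
  hsN : 4 * MM d * s ≤ N'
  hN : La d * N' ≤ N
noncomputable def hh (A0 K : Finset (V d)) : V d → ℝ := hm (A0 \ K) {x | x ∉ A0}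
noncomputable def Ccar (d : ℕ) [hd : Fact (5 ≤ d)] : ℝ := 2 * CH d / c2 d ^ (4 * MM d)
lemma Ccar_pos : 0 < Ccar d := by have := c2_pos (d := d); have := CH_pos (d := d); unfold Ccar; positivity
lemma hh_nonneg (A0 K : Finset (V d)) (x : V d) : 0 ≤ hh A0 K x := hm_nonneg _ _ _
lemma hh_K {A0 K : Finset (V d)} {x : V d} (h : x ∈ K) (h' : x ∈ A0) : hh A0 K x = 0 := by
  rw [hh, hm_off (by simp [h]), ind_not (by simp [h'])]
lemma hh_lap {A0 K : Finset (V d)} {x : V d} (h : x ∉ K) (h' : x ∈ A0) : lap (hh A0 K) x = 0 := hm_lap (by simp [h, h'])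
namespace Geo
variable {A0 K : Finset (V d)} {o : V d} {e : E d} {N' N s : ℕ}
lemma N1 (G : Geo A0 K o e N' N s) : 8 * N' ≤ N := (Nat.mul_le_mul_right _ La_ge).trans G.hN
lemma s1 (G : Geo A0 K o e N' N s) : 1 ≤ s := l0_one.trans G.hs
lemma N'1 (G : Geo A0 K o e N' N s) : 1 ≤ N' := by
  have h1 := G.hsN; have h2 := G.s1
  have : 1 ≤ 4 * MM d * s := Nat.mul_pos (by unfold MM; omega) h2
  omega
lemma QA (G : Geo A0 K o e N' N s) {x : V d} {W : ℕ} (h : x ∈ Q o W) (hW : W ≤ 2 * N) : x ∈ A0 := by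
  have := G.N1
  exact G.hA (Q_mono _ (by omega) (Q_tri h G.ho))
lemma lap0 (G : Geo A0 K o e N' N s) {x : V d} {W : ℕ} (h : x ∈ Q o W) (hW : W ≤ 4 * MM d * s) (h' : x ∉ K) : lap (hh A0 K) x = 0 :=
  hh_lap h' (G.QA h (by have := G.N1; have := G.hsN; omega))
lemma h_far (G : Geo A0 K o e N' N s) {x : V d} (hx : x ∉ Q 0 N) : 1 / 2 ≤ hh A0 K x := by
  have hcf := cf_pos (d := d)
  have hN' := G.N'1
  have hN1 := G.N1
  have hN'' : (0:ℝ) < N' := by exact_mod_cast hN'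
  set c : ℝ := (N' : ℝ) ^ (d - 2) / cf d with hc
  have hc0 : 0 < c := by positivity
  have key : ∀ x, ((fun _ => (1:ℝ)) - c • fp : V d → ℝ) x ≤ hh A0 K x := by
    refine mp_le' (A0 \ K) _ _ (fun x hx => ?_) (fun x hx => ?_)
    · rw [map_sub, map_smul, Pi.sub_apply, Pi.smul_apply, lap_const, hh, hm_lap hx, smul_eq_mul]
      have := mul_pos hc0 (fp_lap_pos x); linarith
    · simp only [Pi.sub_apply, Pi.smul_apply, smul_eq_mul]
      have hp := mul_pos hc0 (fp_pos x)
      by_cases h : x ∈ A0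
      · have hxK : x ∈ K := by by_contra h'; exact hx (by simp [h, h'])
        have h1 := fp_ge hN' (G.hK' hxK)
        have h2 : 1 ≤ c * fp x := by
          calc (1:ℝ) = c * (cf d / (N' : ℝ) ^ (d - 2)) := by rw [hc]; field_simp
            _ ≤ _ := by gcongr
        have := hh_nonneg A0 K x; linarith
      · rw [hh, hm_off hx, ind_mem (by exact h)]; linarith
  refine le_trans ?_ (key x)
  simp only [Pi.sub_apply, Pi.smul_apply, smul_eq_mul]
  have h1 := fp_le hx
  have h2 : c * fp x ≤ 1 / 2 := by
    calc c * fp x ≤ c * (1 / ((N : ℝ) + 1) ^ (d - 2)) := by gcongr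
      _ ≤ c * (1 / ((La d : ℝ) * N') ^ (d - 2)) := by
          have : (La d : ℝ) * N' ≤ N := by exact_mod_cast G.hN
          have hl : (0:ℝ) < La d := by have := La_ge (d := d); exact_mod_cast (by omega : 0 < La d)
          gcongr; linarith
      _ = 1 / (cf d * (La d : ℝ) ^ (d - 2)) := by rw [hc, mul_pow]; field_simp
      _ ≤ 1 / 2 := by
          have hl : (1:ℝ) ≤ La d := by have := La_ge (d := d); exact_mod_cast (by omega : 1 ≤ La d)
          have h3 : (La d : ℝ) ≤ (La d : ℝ) ^ (d - 2) := le_self_pow₀ hl (by have := hd.out; omega)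
          have h4 := La_cf (d := d)
          rw [div_le_iff₀ hcf] at h4
          apply one_div_le_one_div_of_le (by norm_num)
          nlinarith
  linarith
lemma refl (G : Geo A0 K o e N' N s) {x : V d} (hx : x ∈ Q o (MM d * s)) :
    hh A0 K x ≤ 2 * hh A0 K (rf (2 * (o e.1 + sg e.2 * (MM d * s : ℕ))) e.1 x) := by
  set τ : ℤ := ((MM d * s : ℕ) : ℤ) with hτ
  have hN1 := G.N1
  have hsN := G.hsN
  have hN' := G.N'1
  have hτN : 4 * τ ≤ N' := by rw [hτ]; norm_cast; linarith
  have hτ0 : 0 ≤ τ := by positivity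
  have hfix : ∀ y, tt o e y = τ → rf (2 * (o e.1 + sg e.2 * τ)) e.1 y = y := fun y hy => by
    funext j; rw [rf_apply]; split_ifs with hj
    · subst hj; unfold tt at hy; rcases sg_cases e.2 with h' | h' <;> rw [h'] at hy ⊢ <;> linarith
    · rfl
  set B := (A0 \ K).filter (fun x => x ∈ Q 0 (2 * N) ∧ tt o e x < τ) with hB
  have hoe := abs_le.mp (mem_Q.mp G.ho e.1)
  simp only [Pi.zero_apply, sub_zero] at hoe
  have key : ∀ x ∈ B, hh A0 K x ≤ ((2:ℝ) • fun x => hh A0 K (rf (2 * (o e.1 + sg e.2 * τ)) e.1 x)) x := by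
    refine mp_le B _ _ (fun x hx => ?_) (fun x hx => ?_)
    · simp only [hB, mem_filter, mem_sdiff] at hx
      rw [hh_lap hx.1.2 hx.1.1, map_smul, Pi.smul_apply, lap_rf, hh_lap, smul_zero]
      · refine notK G.hK ?_; rw [tt_rf]; omega
      · refine G.hA (mem_Q.mpr fun j => ?_)
        have h2 := abs_le.mp (mem_Q.mp hx.2.1 j)
        simp only [Pi.zero_apply, sub_zero] at h2
        rw [rf_apply, Pi.zero_apply, sub_zero]
        split_ifs with hj
        · subst hj; rcases sg_cases e.2 with h | h <;> rw [h] <;> push_cast at h2 ⊢ <;> rw [abs_le] <;> omega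
        · rw [abs_le]; push_cast at h2 ⊢; omega
    · obtain ⟨hx, x', hx', e', rfl⟩ := hx
      simp only [hB, mem_filter, mem_sdiff] at hx'
      set y := nb x' e' with hy
      rw [Pi.smul_apply, smul_eq_mul]
      have hyA : y ∈ A0 := G.hA (Q_mono _ (by omega) (nb_mem_Q e' hx'.2.1))
      by_cases hyK : y ∈ K
      · rw [hh_K hyK hyA]; exact mul_nonneg (by norm_num) (hh_nonneg _ _ _)
      by_cases hyQ : y ∈ Q 0 (2 * N)
      · have h1 : ¬ tt o e y < τ := fun h => hx (by simp only [hB, mem_filter, mem_sdiff]; exact ⟨⟨hyA, hyK⟩, hyQ, h⟩)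
        have h2 := abs_le.mp (tt_nb o e x' e')
        rw [← hy] at h2
        rw [hfix y (by omega)]; have := hh_nonneg A0 K y; linarith
      · have : rf (2 * (o e.1 + sg e.2 * τ)) e.1 y ∉ Q 0 N := by
          intro h; apply hyQ
          rw [mem_Q] at h ⊢
          intro j
          have h2 := abs_le.mp (h j)
          simp only [Pi.zero_apply, sub_zero] at h2 ⊢
          rw [rf_apply] at h2
          split_ifs at h2 with hj
          · subst hj; rcases sg_cases e.2 with h | h <;> rw [h] at h2 <;> push_cast at h2 ⊢ <;> rw [abs_le] <;> omega
          · rw [abs_le]; push_cast at h2 ⊢; omega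
        have := G.h_far this
        have h1 : hh A0 K y ≤ 1 := hm_le_one _ _ _
        linarith
  have hxA : x ∈ A0 := G.QA hx (by linarith)
  by_cases hxK : x ∈ K
  · rw [hh_K hxK hxA]; exact mul_nonneg (by norm_num) (hh_nonneg _ _ _)
  · have h1 := abs_le.mp (tt_Q (o := o) (e := e) hx)
    rw [tt_self, sub_zero] at h1
    by_cases h2 : tt o e x < τ
    · refine key x ?_
      simp only [hB, mem_filter, mem_sdiff]
      exact ⟨⟨hxA, hxK⟩, Q_mono _ (by linarith) (Q_tri hx G.ho), h2⟩
    · rw [hfix x (by omega)]; have := hh_nonneg A0 K x; linarith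
lemma car (G : Geo A0 K o e N' N s) {x : V d} (hx : x ∈ Q o (MM d * s)) :
    hh A0 K x ≤ Ccar d * hh A0 K (cc o e (Th d * s)) := by
  have hs := G.hs
  have hc2 := c2_pos (d := d)
  have hCH := CH_pos (d := d)
  set τ : ℤ := ((MM d * s : ℕ) : ℤ) with hτ
  set x' := rf (2 * (o e.1 + sg e.2 * τ)) e.1 x with hx'
  have h1 := G.refl hx
  rw [← hτ, ← hx'] at h1
  have ht := abs_le.mp (tt_Q (o := o) (e := e) hx)
  rw [tt_self, sub_zero] at ht
  have ht' : τ ≤ tt o e x' := by rw [hx', tt_rf]; omega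
  have hxQ : x' ∈ Q o (3 * MM d * s) := by
    rw [mem_Q] at hx ⊢; intro j
    have h2 := abs_le.mp (hx j)
    rw [hx', rf_apply]
    rw [show 3 * MM d * s = 3 * (MM d * s) by ring]
    split_ifs with hj
    · subst hj; rcases sg_cases e.2 with h | h <;> rw [h] <;> push_cast at h2 hτ ⊢ <;> rw [abs_le] <;> omega
    · rw [abs_le]; push_cast at h2 ⊢; omega
  have hMt : ((3 * M0 d + 3) * s : ℕ) ≤ τ := by rw [hτ]; norm_cast; exact Nat.mul_le_mul_right _ (by unfold MM; omega)
  have h2 : ∀ y ∈ Q x' s, hh A0 K x' / CH d ≤ hh A0 K y := fun y hy => by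
    rw [div_le_iff₀' hCH]
    refine harnack (hh_nonneg A0 K) hs (fun w hw => ?_) (Q_self _ _) hy
    have h3 := abs_le.mp (tt_Q (o := o) (e := e) hw)
    refine G.lap0 (Q_tri hw hxQ) ?_ (notK G.hK (by omega))
    rw [← add_mul]; exact Nat.mul_le_mul_right _ (by unfold MM; omega)
  have h3 := chainK (W := 3 * MM d * s) (n := 4 * MM d) G.hK (hh_nonneg A0 K) hs (fun w hw hwK => (G.lap0 hw ?_ hwK).ge)
    (by have := hh_nonneg A0 K x'; positivity) hxQ (Q_mono _ ?_ (cc_Q o e (Th d * s))) ?_ ?_ ?_ h2 _ (Q_self _ _)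
  · have h4 : hh A0 K x' ≤ CH d / c2 d ^ (4 * MM d) * hh A0 K (cc o e (Th d * s)) := by
      calc hh A0 K x' = CH d / c2 d ^ (4 * MM d) * (c2 d ^ (4 * MM d) * (hh A0 K x' / CH d)) := by field_simp
        _ ≤ _ := by gcongr
    calc _ ≤ 2 * (CH d / c2 d ^ (4 * MM d) * hh A0 K (cc o e (Th d * s))) := by linarith
      _ = _ := by unfold Ccar; ring
  · rw [← add_mul]; exact Nat.mul_le_mul_right _ (by unfold MM; omega)
  · exact Nat.mul_le_mul_right _ (by unfold MM Th; omega)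
  · refine le_trans ?_ ht'; rw [hτ]; norm_cast; exact Nat.mul_le_mul_right _ (by unfold MM; omega)
  · rw [tt_cc]; norm_cast; exact Nat.mul_le_mul_right _ (by unfold Th; omega)
  · intro i
    have a1 := mem_Q.mp (cc_Q o e (Th d * s)) i
    have a2 := mem_Q.mp hxQ i
    have a3 := abs_sub_le (x' i) (o i) (cc o e (Th d * s) i)
    rw [abs_sub_comm (o i)] at a3
    have a4 : ((3 * MM d * s + Th d * s : ℕ) : ℤ) ≤ (4 * MM d * s : ℕ) := by
      norm_cast; rw [← add_mul]; exact Nat.mul_le_mul_right _ (by unfold MM Th; omega)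
    rw [Nat.cast_add] at a4; linarith
lemma SS_h (G : Geo A0 K o e N' N s) {y : V d} (hy : y ∈ SS o e s) : hh A0 K (cc o e (Th d * s)) ≤ CH d * hh A0 K y := by
  refine harnack (hh_nonneg A0 K) G.hs (fun w hw => ?_) (Q_self _ _) hy
  have h3 := abs_le.mp (tt_Q (o := o) (e := e) hw)
  rw [tt_cc] at h3
  have h4 : ((3 * M0 d + 3) * s : ℕ) ≤ ((Th d * s : ℕ) : ℤ) := by norm_cast; exact Nat.mul_le_mul_right _ (by unfold Th; omega)
  refine G.lap0 (Q_tri hw (cc_Q _ _ _)) ?_ (notK G.hK (by omega))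
  rw [← add_mul]; exact Nat.mul_le_mul_right _ (by unfold MM Th; omega)
lemma bd1 (G : Geo A0 K o e N' N s) (x : V d) : hh A0 K (cc o e (Th d * s)) * qq K o e s x ≤ CH d * hh A0 K x := by
  have hCH := CH_pos (d := d)
  refine mp_le' ((Q o (MM d * s) \ K) \ SS o e s) (hh A0 K (cc o e (Th d * s)) • qq K o e s) (CH d • hh A0 K) (fun x hx => ?_) (fun x hx => ?_) x
  · rw [map_smul, map_smul, Pi.smul_apply, Pi.smul_apply, qq, hm_lap hx]
    simp only [mem_sdiff] at hx
    rw [G.lap0 hx.1.1 (Nat.mul_le_mul_right _ (by omega)) hx.1.2]; simp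
  · rw [Pi.smul_apply, Pi.smul_apply, smul_eq_mul, smul_eq_mul]
    by_cases h : x ∈ SS o e s
    · rw [qq_SS h, mul_one]; exact G.SS_h h
    · rw [qq, hm_off hx, ind_not (by exact h), mul_zero]; exact mul_nonneg hCH.le (hh_nonneg _ _ _)
lemma hoK (G : Geo A0 K o e N' N s) : o ∉ K := notK G.hK (by rw [tt_self])
lemma bd2 (G : Geo A0 K o e N' N s) {i : ℕ} (hi : s = sc d i) :
    hh A0 K o ≤ Ccar d * Csep d * hh A0 K (cc o e (Th d * s)) * qq K o e s o := by
  have hc := Ccar_pos (d := d)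
  have h0 := hh_nonneg A0 K (cc o e (Th d * s))
  have h1 : hh A0 K o ≤ ((Ccar d * hh A0 K (cc o e (Th d * s))) • vv K o s) o := by
    refine mp_le (Q o s \ K) _ _ (fun x hx => ?_) (fun x hx => ?_) o (by simp [Q_self, G.hoK])
    · rw [map_smul, Pi.smul_apply, vv, hm_lap hx]
      simp only [mem_sdiff] at hx
      rw [G.lap0 hx.1 (Nat.le_mul_of_pos_left _ (by unfold MM; omega)) hx.2]; simp
    · obtain ⟨hx, x', hx', e', rfl⟩ := hx
      have hQ : nb x' e' ∈ Q o (MM d * s) := by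
        refine Q_mono _ ?_ (nb_mem_Q e' (mem_sdiff.mp hx').1)
        have := G.s1; unfold MM; nlinarith
      rw [Pi.smul_apply, smul_eq_mul]
      by_cases hK : nb x' e' ∈ K
      · rw [hh_K hK (G.QA hQ (by have := G.N1; have := G.hsN; linarith))]
        exact mul_nonneg (by positivity) (hm_nonneg _ _ _)
      · rw [vv, hm_off hx, ind_mem (by exact hK), mul_one]; exact G.car hQ
  rw [Pi.smul_apply, smul_eq_mul] at h1
  have h2 := sep G.hK i
  rw [← hi] at h2
  calc _ ≤ _ := h1
    _ ≤ Ccar d * hh A0 K (cc o e (Th d * s)) * (Csep d * qq K o e s o) := by gcongr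
    _ = _ := by ring
end Geo
lemma qq_scale {K : Finset (V d)} {o : V d} {e : E d} (hK : ∀ k ∈ K, tt o e k < 0) (i k : ℕ) (x : V d) :
    (c2 d ^ Th d) ^ k * qq K o e (sc d i) x ≤ qq K o e (sc d (i + k)) x := by
  have hc2 := c2_pos (d := d)
  induction k with
  | zero => simp
  | succ k ih =>
    have := qq_double hK (sc_ge (d := d) (i + k)) x
    rw [← add_assoc, sc_succ]
    calc _ = c2 d ^ Th d * ((c2 d ^ Th d) ^ k * qq K o e (sc d i) x) := by ring
      _ ≤ c2 d ^ Th d * qq K o e (sc d (i + k)) x := by gcongr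
      _ ≤ _ := this
lemma bd3 {A K : Finset (V d)} {o : V d} {e : E d} (hK : ∀ k ∈ K, tt o e k < 0) (hoA : o ∈ A) {i : ℕ} {v : V d}
    (hv : v ∉ Q o (2 * sc d i)) : gr (A \ K) v o ≤ Cg d / (sc d i : ℝ) ^ (d - 2) * (Csep d * qq K o e (sc d i) o) := by
  have hCg := Cg_pos (d := d)
  set r := sc d i with hr
  have hr1 : 1 ≤ r := sc_one i
  have hr0 : (0:ℝ) < r := by exact_mod_cast hr1
  have hc : 0 ≤ Cg d / (r : ℝ) ^ (d - 2) := by positivity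
  have h1 : gr (A \ K) v o ≤ ((Cg d / (r : ℝ) ^ (d - 2)) • vv K o r) o := by
    have hoK : o ∉ K := notK hK (by rw [tt_self])
    refine mp_le ((Q o r ∩ A) \ K) _ _ (fun x hx => ?_) (fun x hx => ?_) o (by simp [Q_self, hoA, hoK])
    · simp only [mem_sdiff, mem_inter] at hx
      rw [map_smul, Pi.smul_apply, vv, hm_lap (by simp [hx]), gr_lap (by simp [hx]), ind_not, smul_zero]
      rintro rfl; exact hv (Q_mono _ (by omega) hx.1.1)
    · obtain ⟨hx, x', hx', e', rfl⟩ := hx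
      have hQ := nb_mem_Q e' (mem_inter.mp (mem_sdiff.mp hx').1).1
      rw [Pi.smul_apply, smul_eq_mul]
      have h0 := mul_nonneg hc (hm_nonneg (Q o r \ K) {x | x ∉ K} (nb x' e'))
      by_cases hxK : nb x' e' ∈ A \ K
      · have hK' := (mem_sdiff.mp hxK)
        have h2 : nb x' e' ∉ Q o r := fun h => hx (by simp [h, hK'])
        rw [vv, hm_off (by simp [h2]), ind_mem (by exact hK'.2), mul_one]
        refine (gr_le _ _ _).trans ?_
        rw [div_eq_mul_one_div]
        have h3 : nb x' e' - v ∉ Q 0 (r - 1) := by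
          rw [← Q_sub, Q_symm]; intro h; apply hv
          have := Q_tri h hQ; rwa [show r - 1 + (r + 1) = 2 * r by omega] at this
        have := fp_le h3
        rw [Nat.cast_sub hr1] at this
        simp only [Nat.cast_one, sub_add_cancel] at this
        gcongr
      · rw [gr_off hxK]; exact h0
  refine h1.trans ?_
  rw [Pi.smul_apply, smul_eq_mul]
  exact mul_le_mul_of_nonneg_left (sep hK i) hc
end

section
variable [hd : Fact (5 ≤ d)]
namespace Geo
variable {A0 K : Finset (V d)} {o : V d} {e : E d} {N' N s : ℕ}
lemma LA (G : Geo A0 K o e N' N s) : Q o (MM d * s) ⊆ A0 := fun x hx => G.QA hx (by have := G.N1; have := G.hsN; linarith)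
lemma SS_far (G : Geo A0 K o e N' N s) {w : V d} (hw : w ∈ SS o e s) : w ∉ Q o (2 * s) := by
  intro h
  have h1 := SS_tt hw
  have h2 := abs_le.mp (tt_Q (o := o) (e := e) h)
  rw [tt_self] at h2
  have h4 : ((4 * s : ℕ) : ℤ) ≤ ((Th d * s : ℕ) : ℤ) := by norm_cast; exact Nat.mul_le_mul_right _ (by unfold Th; omega)
  have := G.s1
  omega
lemma SS_K (G : Geo A0 K o e N' N s) {z x : V d} (hz : z ∈ SS o e s) (hx : x ∈ Q z (M0 d * (2 * s))) : x ∈ Q o (MM d * s) \ K := by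
  have h1 := SS_tt hz
  have h2 := abs_le.mp (tt_Q (o := o) (e := e) hx)
  have h4 : ((M0 d * (2 * s) + s : ℕ) : ℤ) ≤ ((Th d * s : ℕ) : ℤ) := by norm_cast; unfold Th; nlinarith
  rw [mem_sdiff]
  refine ⟨Q_mono _ ?_ (Q_tri hx (SS_Q hz)), notK G.hK (by omega)⟩
  unfold MM Th; nlinarith
lemma psi_le (G : Geo A0 K o e N' N s) {r : ℕ} (hr : 1 ≤ r) {l : List (V d)} (hl : ∀ v ∈ l, v ∈ A0 \ K ∧ v ∈ Q o (MM d * s))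
    {w : V d} (hw : w ∈ SS o e s) :
    hh A0 K (cc o e (Th d * s)) / CH d - Ccar d * hh A0 K (cc o e (Th d * s)) *
      ((2 * r : ℝ) ^ (d - 2) / cf d * fp (w - o) + Cg d * ∑ v ∈ l.toFinset \ Q o (2 * r), fp (w - v)) ≤ hm ((A0 \ K) \ l.toFinset) {x | x ∉ A0} w := by
  have hcf := cf_pos (d := d)
  have hCH := CH_pos (d := d)
  set h0 := hh A0 K (cc o e (Th d * s)) with hh0
  have h00 : 0 ≤ h0 := hh_nonneg _ _ _
  have hCc := Ccar_pos (d := d)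
  have hr0 : (0:ℝ) < r := by exact_mod_cast hr
  set c : ℝ := (2 * r : ℝ) ^ (d - 2) / cf d with hc
  have hc0 : 0 < c := by positivity
  set g : V d → ℝ := ∑ v ∈ l.toFinset \ Q o (2 * r), gr (A0 \ K) v with hg
  have hgn : ∀ x, 0 ≤ g x := fun x => by rw [hg, Finset.sum_apply]; exact sum_nonneg fun v _ => gr_nonneg _ _ _
  have key := mp_le' ((A0 \ K) \ l.toFinset) (hh A0 K - (Ccar d * h0) • (c • (fun x => fp (x - o)) + g)) (hm ((A0 \ K) \ l.toFinset) {x | x ∉ A0}) (fun x hx => ?_) (fun x hx => ?_) w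
  · refine le_trans ?_ key
    simp only [Pi.sub_apply, Pi.smul_apply, Pi.add_apply, smul_eq_mul, hg, Finset.sum_apply]
    have h1 := G.SS_h hw
    rw [← hh0, ← div_le_iff₀' hCH] at h1
    have h2 : ∑ v ∈ l.toFinset \ Q o (2 * r), gr (A0 \ K) v w ≤ Cg d * ∑ v ∈ l.toFinset \ Q o (2 * r), fp (w - v) := by
      rw [mul_sum]; exact sum_le_sum fun v _ => gr_le _ _ _
    gcongr
  · have hx' := (mem_sdiff.mp hx).1
    rw [hm_lap hx, map_sub, map_smul, map_add, map_smul, hg, map_sum]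
    simp only [Pi.sub_apply, Pi.smul_apply, Pi.add_apply, smul_eq_mul, Finset.sum_apply]
    rw [hh, hm_lap hx', lap_trans]
    have h1 := mul_pos hc0 (fp_lap_pos (x - o))
    have h2 : 0 ≤ ∑ v ∈ l.toFinset \ Q o (2 * r), lap (gr (A0 \ K) v) x := sum_nonneg fun v _ => by
      rw [gr_lap hx']; exact ind_nonneg _ _
    have : 0 ≤ Ccar d * h0 * (c * lap fp (x - o) + ∑ v ∈ l.toFinset \ Q o (2 * r), lap (gr (A0 \ K) v) x) := by positivity
    linarith
  · simp only [Pi.sub_apply, Pi.smul_apply, Pi.add_apply, smul_eq_mul]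
    have hfx := fp_pos (x - o)
    have hgx := hgn x
    by_cases hxA : x ∈ A0 \ K
    · have hxl : x ∈ l.toFinset := by by_contra h; exact hx (mem_sdiff.mpr ⟨hxA, h⟩)
      have hxl' := hl x (by simpa using hxl)
      have h1 := G.car hxl'.2
      rw [← hh0] at h1
      have h2 := hm_nonneg ((A0 \ K) \ l.toFinset) {x | x ∉ A0} x
      have h3 : 1 ≤ c * fp (x - o) + g x := by
        by_cases hxQ : x ∈ Q o (2 * r)
        · have := fp_ge (by omega) (Q_sub.mp hxQ)
          have h4 : 1 ≤ c * fp (x - o) := by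
            calc (1:ℝ) = c * (cf d / ((2 * r : ℕ) : ℝ) ^ (d - 2)) := by rw [hc]; push_cast; field_simp
              _ ≤ _ := by gcongr
          linarith
        · have h5 : gr (A0 \ K) x x ≤ g x := by
            rw [hg, Finset.sum_apply]
            exact single_le_sum (f := fun v => gr (A0 \ K) v x) (fun v _ => gr_nonneg _ _ _) (mem_sdiff.mpr ⟨hxl, hxQ⟩)
          have h6 := gr_self_ge hxA
          have : 0 < c * fp (x - o) := by positivity
          linarith
      have h7 := mul_le_mul_of_nonneg_left h3 (by positivity : 0 ≤ Ccar d * h0)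
      linarith
    · rw [hm_off hx, hh, hm_off hxA]
      have : 0 ≤ Ccar d * h0 * (c * fp (x - o) + g x) := by positivity
      linarith
lemma hmb_ge (G : Geo A0 K o e N' N s) {z : V d} {ℓ : ℕ} (hz : z ∈ SS o e s) (hℓ : l0 d ≤ ℓ) (hℓs : ℓ ≤ s) (x : V d) :
    c1 d * ((ℓ : ℝ) / (2 * s)) ^ (d - 2) * qq K o e s x ≤ hm ((Q o (MM d * s) \ K) \ Q z ℓ) (Q z ℓ) x := by
  have hc1 := c1_pos (d := d)
  set u := hm ((Q o (MM d * s) \ K) \ Q z ℓ) (Q z ℓ) with hu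
  have hsup : ∀ x ∈ Q o (MM d * s) \ K, 0 ≤ lap u x := fun x hx => hm_super (by
    by_cases h : x ∈ Q z ℓ
    · right; exact h
    · left; exact mem_sdiff.mpr ⟨hx, h⟩)
  have h1 := H1 (z := z) (r := 2 * s) (u := u) (θ := 1) hℓ (by omega) (fun x => hm_nonneg _ _ _) zero_le_one (fun x hx _ => hsup x (G.SS_K hz hx))
    (fun x hx => by rw [hu, hm_off (by simp [hx]), ind_mem (by exact hx)])
  refine mp_le' ((Q o (MM d * s) \ K) \ SS o e s) ((c1 d * ((ℓ : ℝ) / (2 * s)) ^ (d - 2)) • qq K o e s) u (fun x hx => ?_) (fun x hx => ?_) x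
  · rw [map_smul, Pi.smul_apply, qq, hm_lap hx, smul_zero]; exact hsup x (mem_sdiff.mp hx).1
  · rw [Pi.smul_apply, smul_eq_mul]
    by_cases h : x ∈ SS o e s
    · rw [qq_SS h]
      have := h1 x (by have := Q_tri h (Q_symm.mp hz); rwa [show s + s = 2 * s by ring] at this)
      push_cast at this; exact this
    · rw [qq, hm_off hx, ind_not (by exact h), mul_zero]; exact hm_nonneg _ _ _
lemma far_sum (G : Geo A0 K o e N' N s) {i j : ℕ} (z : V d) (hob : o ∉ Q z (2 ^ j)) :
    LW (Q z (2 ^ j)) ((Q o (MM d * s) \ K) \ Q z (2 ^ j)) o (fun l => ∑ v ∈ l.toFinset \ Q o (2 * sc d i), fp (z - v)) ≤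
      Cg d / (sc d i : ℝ) ^ (d - 2) * (Csep d * qq K o e (sc d i) o) * (((2 ^ j : ℕ) : ℝ) ^ (d - 2) / cf d) * (8 ^ d * (2 / 2 ^ j)) := by
  have hCg := Cg_pos (d := d)
  have hCs := Csep_pos (d := d)
  have hcf := cf_pos (d := d)
  set A1 := (Q o (MM d * s) \ K) \ Q z (2 ^ j) with hA1
  have hq := qq_nonneg (K := K) (o := o) (e := e) (sc d i) o
  calc _ ≤ LW (Q z (2 ^ j)) A1 o (fun l => ∑ v ∈ A1 \ Q o (2 * sc d i), fp (z - v) * ib (v ∈ l)) := by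
        refine LW_mono' _ _ _ fun l hl => ?_
        have : l.toFinset \ Q o (2 * sc d i) ⊆ A1 \ Q o (2 * sc d i) := Finset.sdiff_subset_sdiff (fun v hv => hl v (by simpa using hv)) le_rfl
        refine le_trans (le_of_eq ?_) (sum_le_sum_of_subset_of_nonneg this fun v _ _ => mul_nonneg (fp_pos _).le (ib_nonneg _))
        refine sum_congr rfl fun v hv => ?_
        rw [ib_true (by simpa using (mem_sdiff.mp hv).1), mul_one]
    _ = ∑ v ∈ A1 \ Q o (2 * sc d i), fp (z - v) * LW (Q z (2 ^ j)) A1 o (fun l => ib (v ∈ l)) := by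
        rw [LW_sum]; exact sum_congr rfl fun v _ => LW_smul _ _ _ _ _
    _ ≤ ∑ v ∈ A1 \ Q o (2 * sc d i), (Cg d / (sc d i : ℝ) ^ (d - 2) * (Csep d * qq K o e (sc d i) o) * (((2 ^ j : ℕ) : ℝ) ^ (d - 2) / cf d)) * fp (v - z) ^ 2 := by
        refine sum_le_sum fun v hv => ?_
        have h1 := LW_pt (Q z (2 ^ j)) v A1 o (fun y hy => by have hy' : y ∈ Q z (2 ^ j) := hy
                                                              simp [hA1, hy'])
        have h2 := hm_le_fp A1 (z := z) (ℓ := 2 ^ j) (R := Q z (2 ^ j)) Nat.one_le_two_pow (fun y hy => hy) v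
        have h3 : gr A1 v o ≤ Cg d / (sc d i : ℝ) ^ (d - 2) * (Csep d * qq K o e (sc d i) o) := by
          have := bd3 (A := Q o (MM d * s) \ Q z (2 ^ j)) G.hK (by simp [Q_self, hob]) (mem_sdiff.mp hv).2
          rwa [sdiff_right_comm] at this
        have h4 := fp_pos (v - z)
        rw [fp_symm z v]
        calc _ ≤ fp (v - z) * ((Cg d / (sc d i : ℝ) ^ (d - 2) * (Csep d * qq K o e (sc d i) o)) * (((2 ^ j : ℕ) : ℝ) ^ (d - 2) / cf d * fp (v - z))) := by
              refine mul_le_mul_of_nonneg_left (h1.trans ?_) h4.le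
              exact mul_le_mul h3 h2 (hm_nonneg _ _ _) (by positivity)
          _ = _ := by ring
    _ ≤ _ := by
        rw [← mul_sum]
        refine mul_le_mul_of_nonneg_left (sum_fp2_tail j _ z fun v hv => ?_) (by positivity)
        exact (mem_sdiff.mp (mem_sdiff.mp hv).1).2
end Geo
lemma pow_small (c : ℝ) (hc : 0 < c) (C : ℝ) (m : ℕ) : ∃ j, m ≤ 2 ^ j ∧ C * (1 / 2 ^ j) ≤ c := by
  obtain ⟨n, hn⟩ := exists_nat_gt (C / c)
  refine ⟨n + m, ?_, ?_⟩
  · exact (Nat.lt_two_pow_self (n := n + m)).le.trans' (by omega)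
  · rw [div_lt_iff₀ hc] at hn
    rw [mul_one_div, div_le_iff₀ (by positivity)]
    have : ((n : ℕ) : ℝ) ≤ 2 ^ (n + m) := by exact_mod_cast (by have := Nat.lt_two_pow_self (n := n + m); omega : n ≤ 2 ^ (n + m))
    nlinarith
lemma hit_lower : ∃ c : ℝ, 0 < c ∧ ∃ k j : ℕ, ∀ (A0 K : Finset (V d)) (o : V d) (e : E d) (N' N i : ℕ), Geo A0 K o e N' N (sc d (i + k)) →
    2 ^ j ≤ sc d (i + k) → ∀ z ∈ Q (cc o e (Th d * sc d (i + k))) (sc d (i + k) - 2 ^ j),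
    c / (sc d (i + k) : ℝ) ^ (d - 2) * hh A0 K o ≤ LW {x | x ∉ A0} (A0 \ K) o (fun l => ib (hits (Q o (MM d * sc d (i + k))) (Q z (2 ^ j)) l)) := by
  have hCg := Cg_pos (d := d)
  have hCs := Csep_pos (d := d)
  have hcf := cf_pos (d := d)
  have hCH := CH_pos (d := d)
  have hCc := Ccar_pos (d := d)
  have hc1 := c1_pos (d := d)
  have hc2 := c2_pos (d := d)
  have hdp := d2pos (d := d)
  obtain ⟨k, -, hk⟩ := pow_small (1 / (4 * CH d)) (by positivity) (Ccar d / cf d) 0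
  set C3 : ℝ := Ccar d * Cg d * (Cg d * Csep d * (2 ^ k) ^ (d - 2) / (c2 d ^ Th d) ^ k / cf d * (8 ^ d * 2)) with hC3
  obtain ⟨j, hj0, hj⟩ := pow_small (1 / (4 * CH d) * (c1 d / 2 ^ (d - 2))) (by positivity) C3 (l0 d)
  set c4 : ℝ := 1 / (2 * d) ^ (2 * 2 ^ j * d) with hc4
  have hc40 : 0 < c4 := by positivity
  set c5 : ℝ := c4 * (1 / (2 * CH d) * (c1 d / 2 ^ (d - 2))) * (2 ^ j) ^ (d - 2) with hc5
  refine ⟨c5 / (Ccar d * Csep d), by positivity, k, j, ?_⟩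
  intro A0 K o e N' N i G hjs z hz
  set s := sc d (i + k) with hs
  set r := sc d i with hr
  have hs1 : 1 ≤ s := sc_one _
  have hr1 : 1 ≤ r := sc_one _
  have hs0 : (0:ℝ) < s := by exact_mod_cast hs1
  have hr0 : (0:ℝ) < r := by exact_mod_cast hr1
  have hsr : (s : ℝ) = 2 ^ k * r := by rw [hs, hr, sc, sc]; push_cast; ring
  have hzS : z ∈ SS o e s := Q_mono _ (by omega) hz
  have hbS : Q z (2 ^ j) ⊆ SS o e s := fun x hx => by
    have := Q_tri hx hz; rwa [show 2 ^ j + (s - 2 ^ j) = s by omega] at this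
  have hbLK : Q z (2 ^ j) ⊆ Q o (MM d * s) \ K := fun x hx => G.SS_K hzS (Q_mono _ (by have := M0_one (d := d); nlinarith) hx)
  have hbL : Q z (2 ^ j) ⊆ Q o (MM d * s) := fun x hx => (mem_sdiff.mp (hbLK hx)).1
  have hbA : Q z (2 ^ j) ⊆ A0 \ K := fun x hx => mem_sdiff.mpr ⟨G.LA (hbL hx), (mem_sdiff.mp (hbLK hx)).2⟩
  have hob : o ∉ Q z (2 ^ j) := fun h => G.SS_far (hbS h) (Q_self _ _)
  set h0 := hh A0 K (cc o e (Th d * s)) with hh0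
  have h00 : 0 ≤ h0 := hh_nonneg _ _ _
  set ψ : List (V d) → ℝ := fun l => (c4 * h0 * (3 / (4 * CH d))) * 1 + (-(c4 * h0 * (Ccar d * Cg d))) * ∑ v ∈ l.toFinset \ Q o (2 * r), fp (z - v) with hψ
  have hlow := LW_lower {x | x ∉ A0} (Q o (MM d * s)) (Q z (2 ^ j)) (A0 \ K) o (fun y hy h => hy (mem_sdiff.mp h).1) hbA hbL ψ (fun l hl w hw => ?_)
  · refine le_trans ?_ hlow
    have hAL : (A0 \ K ∩ Q o (MM d * s)) \ Q z (2 ^ j) = (Q o (MM d * s) \ K) \ Q z (2 ^ j) := by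
      ext x; simp only [mem_sdiff, mem_inter]
      constructor
      · tauto
      · intro h; exact ⟨⟨⟨G.LA h.1.1, h.1.2⟩, h.1.1⟩, h.2⟩
    have hfar := G.far_sum (i := i) z hob
    have hge := G.hmb_ge hzS hj0 hjs o
    rw [hAL, hψ, LW_lin, LW_one _ _ _ (fun y hy => by have hy' : y ∈ Q z (2 ^ j) := hy
                                                      simp [hy'])]
    have hqs := qq_scale (e := e) G.hK i k o
    rw [← hs, ← hr] at hqs
    rw [← hr] at hfar
    set q := qq K o e s o with hq
    have hq0 : 0 ≤ q := qq_nonneg _ _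
    set X := LW (Q z (2 ^ j)) ((Q o (MM d * s) \ K) \ Q z (2 ^ j)) o (fun l => ∑ v ∈ l.toFinset \ Q o (2 * r), fp (z - v)) with hX
    have hX1 : Ccar d * Cg d * X ≤ 1 / (4 * CH d) * (c1 d / 2 ^ (d - 2)) * ((2 ^ j) ^ (d - 2) / s ^ (d - 2) * q) := by
      calc Ccar d * Cg d * X ≤ Ccar d * Cg d * (Cg d / (r : ℝ) ^ (d - 2) * (Csep d * (q / (c2 d ^ Th d) ^ k)) * (((2 ^ j : ℕ) : ℝ) ^ (d - 2) / cf d) * (8 ^ d * (2 / 2 ^ j))) := by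
            refine mul_le_mul_of_nonneg_left (hfar.trans ?_) (by positivity)
            gcongr
            rw [le_div_iff₀' (by positivity)]; exact hqs
        _ = C3 * (1 / 2 ^ j) * ((2 ^ j) ^ (d - 2) / s ^ (d - 2) * q) := by
            rw [hC3, hsr, mul_pow]; push_cast; field_simp
        _ ≤ _ := by gcongr
    have hY : c1 d / 2 ^ (d - 2) * ((2 ^ j) ^ (d - 2) / s ^ (d - 2) * q) ≤ hm ((Q o (MM d * s) \ K) \ Q z (2 ^ j)) (Q z (2 ^ j)) o := by
      refine le_trans (le_of_eq ?_) hge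
      push_cast; rw [div_pow, mul_pow]; field_simp
    set Y := hm ((Q o (MM d * s) \ K) \ Q z (2 ^ j)) (Q z (2 ^ j)) o
    have hb2 := G.bd2 hs
    rw [← hh0, ← hq] at hb2
    calc _ ≤ c5 / (Ccar d * Csep d) / s ^ (d - 2) * (Ccar d * Csep d * h0 * q) := by gcongr
      _ = c4 * h0 * (3 / (4 * CH d) * (c1 d / 2 ^ (d - 2) * ((2 ^ j) ^ (d - 2) / s ^ (d - 2) * q)) - 1 / (4 * CH d) * (c1 d / 2 ^ (d - 2)) * ((2 ^ j) ^ (d - 2) / s ^ (d - 2) * q)) := by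
          rw [hc5]; field_simp; ring
      _ ≤ c4 * h0 * (3 / (4 * CH d) * Y - Ccar d * Cg d * X) := by gcongr
      _ = _ := by ring
  · have hl' : ∀ v ∈ l, v ∈ A0 \ K ∧ v ∈ Q o (MM d * s) := fun v hv => ⟨(hl v hv).1, (hl v hv).2.1⟩
    have h1 := G.psi_le hr1 hl' hzS
    have h2 : (2 * r : ℝ) ^ (d - 2) / cf d * fp (z - o) ≤ 1 / cf d * (1 / 2 ^ k) := by
      have h3 := fp_le (fun h => G.SS_far hzS (Q_sub.mpr h))
      calc _ ≤ (2 * r : ℝ) ^ (d - 2) / cf d * (1 / (2 * s) ^ (d - 2)) := by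
            refine mul_le_mul_of_nonneg_left (h3.trans ?_) (by positivity)
            gcongr; push_cast; linarith
        _ = 1 / cf d * (1 / (2 ^ k) ^ (d - 2)) := by rw [hsr]; field_simp; rw [← mul_pow]
        _ ≤ _ := by
            gcongr
            exact le_self_pow₀ (one_le_pow₀ (by norm_num)) (by have := hd.out; omega)
    have h3 := steps_Q (u := hm ((A0 \ K) \ l.toFinset) {x | x ∉ A0}) (fun x => hm_nonneg _ _ _) hw (Q_self z _) (fun x hx => by
      rw [hm_lap]; refine mem_sdiff.mpr ⟨hbA hx, fun h => (hl x (by simpa using h)).2.2 hx⟩)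
    refine le_trans ?_ h3
    rw [div_eq_mul_one_div, mul_comm, ← hc4]
    rw [← hh0] at h1
    set Sg := ∑ v ∈ l.toFinset \ Q o (2 * r), fp (z - v)
    calc ψ l = c4 * (h0 * (3 / (4 * CH d) - Ccar d * Cg d * Sg)) := by simp only [hψ]; ring
      _ ≤ c4 * (h0 / CH d - Ccar d * h0 * ((2 * r : ℝ) ^ (d - 2) / cf d * fp (z - o) + Cg d * Sg)) := by
          refine mul_le_mul_of_nonneg_left ?_ hc40.le
          have h5 : Ccar d * ((2 * r : ℝ) ^ (d - 2) / cf d * fp (z - o)) ≤ 1 / (4 * CH d) := by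
            refine le_trans ?_ hk
            calc _ ≤ Ccar d * (1 / cf d * (1 / 2 ^ k)) := by gcongr
              _ = _ := by ring
          have h6 := mul_le_mul_of_nonneg_left h5 h00
          have h7 : h0 / CH d = h0 * (3 / (4 * CH d)) + h0 * (1 / (4 * CH d)) := by field_simp; ring
          rw [h7]; linarith
      _ ≤ _ := mul_le_mul_of_nonneg_left h1 hc40.le
end

section
variable [hd : Fact (5 ≤ d)]
def pr (L : Finset (V d)) (l : List (V d)) : List (V d) := l.takeWhile (fun v => decide (v ∈ L))
lemma pr_sub {L : Finset (V d)} {l : List (V d)} {v : V d} (h : v ∈ pr L l) : v ∈ l := (List.takeWhile_sublist _).subset h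
noncomputable def hz (B Γ : Finset (V d)) : V d → ℝ := hm (B \ Γ) Γ
noncomputable def Zb (B Γ : Finset (V d)) : ℝ := ∑ x ∈ B, hz B Γ x
lemma hz_nonneg (B Γ : Finset (V d)) (x : V d) : 0 ≤ hz B Γ x := hm_nonneg _ _ _
lemma hz_mono {B Γ Γ' : Finset (V d)} (h : Γ ⊆ Γ') (x : V d) : hz B Γ x ≤ hz B Γ' x := by
  refine mp_le' (B \ Γ') _ _ (fun x hx => ?_) (fun x hx => ?_) x
  · have h1 := mem_sdiff.mp hx
    have h2 : x ∈ B \ Γ := mem_sdiff.mpr ⟨h1.1, fun h' => h1.2 (h h')⟩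
    rw [hz, hz, hm_lap hx, hm_lap h2]
  · rw [show hz B Γ' x = ind Γ' x from hm_off hx]
    by_cases hx' : x ∈ Γ'
    · rw [ind_mem (by exact_mod_cast hx')]; exact hm_le_one _ _ _
    · have hB : x ∉ B := fun hB => hx (by simp [hB, hx'])
      rw [hz, hm_off (by simp [hB]), ind_not (fun h' => hx' (h h'))]; exact ind_nonneg _ _
lemma Zb_mono {B Γ Γ' : Finset (V d)} (h : Γ ⊆ Γ') : Zb B Γ ≤ Zb B Γ' := sum_le_sum fun x _ => hz_mono h x
lemma sum_ib (S : Finset (V d)) (p : V d → Prop) : ∑ x ∈ S, ib (p x) = ((S.filter p).card : ℝ) := by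
  unfold ib; rw [Finset.sum_boole]
lemma card_sum (S T : Finset (V d)) : ((T ∩ S).card : ℝ) = ∑ v ∈ S, ib (v ∈ T) := by
  rw [sum_ib]; congr 2; ext; simp [and_comm]
lemma first_mom : ∃ c : ℝ, 0 < c ∧ ∃ i0 : ℕ, ∀ (A0 K : Finset (V d)) (o : V d) (e : E d) (N' N i : ℕ), i0 ≤ i → Geo A0 K o e N' N (sc d i) →
    c * (sc d i : ℝ) ^ 2 * hh A0 K o ≤ LW {x | x ∉ A0} (A0 \ K) o (fun l => (((pr (Q o (MM d * sc d i)) l).toFinset ∩ SS o e (sc d i)).card : ℝ)) := by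
  obtain ⟨c, hc, k, j, H⟩ := hit_lower (d := d)
  refine ⟨c / (2 * 2 ^ j + 1) ^ d, by positivity, k + (j + 1), ?_⟩
  intro A0 K o e N' N i hi G
  obtain ⟨i', rfl⟩ : ∃ i', i = i' + k := ⟨i - k, by omega⟩
  set s := sc d (i' + k) with hs
  have hjs : 2 ^ (j + 1) ≤ s := by
    rw [hs, sc]
    calc 2 ^ (j + 1) ≤ 2 ^ (i' + k) := Nat.pow_le_pow_right (by norm_num) (by omega)
      _ ≤ _ := Nat.le_mul_of_pos_right _ (by have := sc_one (d := d) 0; rwa [sc, pow_zero, one_mul] at this)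
  have hj2 : 2 * 2 ^ j ≤ s := by rw [pow_succ] at hjs; omega
  have hs0 : (0:ℝ) < s := by exact_mod_cast sc_one (d := d) _
  set L := Q o (MM d * s)
  set Bx := Q (cc o e (Th d * s)) (s - 2 ^ j) with hBx
  have h1 := sum_le_sum fun z hz => H A0 K o e N' N i' G (by omega) z hz
  rw [← LW_sum] at h1
  have h2 : LW {x | x ∉ A0} (A0 \ K) o (fun l => ∑ z ∈ Bx, ib (hits L (Q z (2 ^ j)) l)) ≤
      LW {x | x ∉ A0} (A0 \ K) o (fun l => (2 * 2 ^ j + 1) ^ d * (((pr L l).toFinset ∩ SS o e s).card : ℝ)) := by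
    refine LW_mono _ _ _ fun l => ?_
    calc ∑ z ∈ Bx, ib (hits L (Q z (2 ^ j)) l) ≤ ∑ z ∈ Bx, ∑ v ∈ (pr L l).toFinset ∩ SS o e s, ib (z ∈ Q v (2 ^ j)) := by
          refine sum_le_sum fun z hz => ?_
          by_cases hh : hits L (Q z (2 ^ j)) l
          · obtain ⟨v, hv, hvz⟩ := hh
            have hvS : v ∈ (pr L l).toFinset ∩ SS o e s := by
              refine mem_inter.mpr ⟨List.mem_toFinset.mpr hv, ?_⟩
              have := Q_tri hvz hz; rwa [show 2 ^ j + (s - 2 ^ j) = s by omega] at this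
            refine (ib_le _).trans ?_
            calc (1:ℝ) = ib (z ∈ Q v (2 ^ j)) := (ib_true (Q_symm.mp hvz)).symm
              _ ≤ _ := single_le_sum (f := fun v => ib (z ∈ Q v (2 ^ j))) (fun v _ => ib_nonneg _) hvS
          · rw [ib_false hh]; exact sum_nonneg fun v _ => ib_nonneg _
      _ = ∑ v ∈ (pr L l).toFinset ∩ SS o e s, ∑ z ∈ Bx, ib (z ∈ Q v (2 ^ j)) := sum_comm
      _ ≤ ∑ v ∈ (pr L l).toFinset ∩ SS o e s, (2 * 2 ^ j + 1 : ℝ) ^ d := by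
          refine sum_le_sum fun v _ => ?_
          rw [← card_sum]
          have := Finset.card_le_card (Finset.inter_subset_left (s₁ := Q v (2 ^ j)) (s₂ := Bx))
          rw [card_Q] at this; exact_mod_cast this
      _ = _ := by rw [sum_const, nsmul_eq_mul, mul_comm]
  rw [LW_smul] at h2
  have h3 := h1.trans h2
  rw [sum_const, nsmul_eq_mul] at h3
  have h4 : (s : ℝ) ^ d ≤ Bx.card := by
    rw [hBx, card_Q]; exact_mod_cast Nat.pow_le_pow_left (by omega) d
  have h5 : (s : ℝ) ^ d = s ^ 2 * s ^ (d - 2) := by rw [← pow_add]; congr 1; have := hd.out; omega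
  rw [div_mul_eq_mul_div, div_mul_eq_mul_div, div_le_iff₀' (by positivity)]
  refine le_trans ?_ h3
  have h6 := hh_nonneg A0 K o
  calc c * (s:ℝ) ^ 2 * hh A0 K o = s ^ d * (c / s ^ (d - 2) * hh A0 K o) := by rw [h5]; field_simp
    _ ≤ _ := by gcongr
noncomputable def Ct (d : ℕ) [hd : Fact (5 ≤ d)] : ℝ := 2 * (Ccar d * Cg d * Csep d * CH d * Cg d)
lemma Ct_pos : 0 < Ct d := by
  have := Ccar_pos (d := d); have := Cg_pos (d := d); have := Csep_pos (d := d); have := CH_pos (d := d)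
  unfold Ct; positivity
lemma Geo.two {A0 K : Finset (V d)} {o : V d} {e : E d} {N' N i : ℕ} (G : Geo A0 K o e N' N (sc d i)) {v w : V d}
    (hv : v ∈ SS o e (sc d i)) (hw : w ∈ SS o e (sc d i)) :
    LW {x | x ∉ A0} (A0 \ K) o (fun l => ib (v ∈ l ∧ w ∈ l)) ≤ Ct d / (sc d i : ℝ) ^ (d - 2) * hh A0 K o * fp (v - w) := by
  have hCg := Cg_pos (d := d); have hCs := Csep_pos (d := d); have hCH := CH_pos (d := d); have hCc := Ccar_pos (d := d)
  set s := sc d i with hs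
  have hs0 : (0:ℝ) < s := by exact_mod_cast sc_one (d := d) _
  have key : ∀ v w : V d, v ∈ SS o e s → w ∈ SS o e s → gr (A0 \ K) v o * (gr (A0 \ K) w v * hh A0 K w) ≤
      Ct d / 2 / (s : ℝ) ^ (d - 2) * hh A0 K o * fp (v - w) := by
    intro v w hv hw
    have h1 := bd3 (A := A0) G.hK (G.LA (Q_self _ _)) (i := i) (G.SS_far hv)
    have h2 := gr_le (A0 \ K) w v
    have h3 := G.car (x := w) (Q_mono _ (Nat.mul_le_mul_right _ (by unfold Th MM; omega)) (SS_Q hw))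
    have h4 := G.bd1 o
    have h5 := fp_pos (v - w)
    have h6 := hh_nonneg A0 K (cc o e (Th d * s))
    have h7 : 0 ≤ qq K o e s o := qq_nonneg _ _
    calc _ ≤ (Cg d / (s : ℝ) ^ (d - 2) * (Csep d * qq K o e s o)) * (Cg d * fp (v - w) * (Ccar d * hh A0 K (cc o e (Th d * s)))) := by
          gcongr
          · exact mul_nonneg (gr_nonneg _ _ _) (hh_nonneg _ _ _)
          · exact hh_nonneg _ _ _
      _ = Cg d / (s : ℝ) ^ (d - 2) * Csep d * Cg d * fp (v - w) * Ccar d * (hh A0 K (cc o e (Th d * s)) * qq K o e s o) := by ring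
      _ ≤ Cg d / (s : ℝ) ^ (d - 2) * Csep d * Cg d * fp (v - w) * Ccar d * (CH d * hh A0 K o) := by gcongr
      _ = _ := by unfold Ct; ring
  refine (LW_pt2 {x | x ∉ A0} v w _ o (fun y hy h => hy (mem_sdiff.mp h).1)).trans ?_
  have k1 := key v w hv hw
  have k2 := key w v hw hv
  rw [fp_symm w v] at k2
  unfold hh at k1 k2 ⊢
  linarith [k1, k2, show Ct d / 2 / (s : ℝ) ^ (d - 2) * hm (A0 \ K) {x | x ∉ A0} o * fp (v - w) + Ct d / 2 / (s : ℝ) ^ (d - 2) * hm (A0 \ K) {x | x ∉ A0} o * fp (v - w) = Ct d / (s : ℝ) ^ (d - 2) * hm (A0 \ K) {x | x ∉ A0} o * fp (v - w) by ring]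
lemma pair_le {A0 K : Finset (V d)} {o : V d} {e : E d} {N' N i : ℕ} (G : Geo A0 K o e N' N (sc d i)) (L : Finset (V d))
    (f : V d → ℝ) (hf : ∀ x, 0 ≤ f x) {Cf : ℝ} (hCf : ∀ w, ∑ v ∈ SS o e (sc d i), f (v - w) * fp (v - w) ≤ Cf) :
    LW {x | x ∉ A0} (A0 \ K) o (fun l => ∑ w ∈ (pr L l).toFinset ∩ SS o e (sc d i), ∑ v ∈ (pr L l).toFinset ∩ SS o e (sc d i), f (v - w)) ≤
      Ct d * 3 ^ d * Cf * (sc d i : ℝ) ^ 2 * hh A0 K o := by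
  set s := sc d i with hs
  have hs1 := sc_one (d := d) i
  rw [← hs] at hs1
  have hs0 : (0:ℝ) < s := by exact_mod_cast hs1
  have hCf0 : 0 ≤ Cf := le_trans (sum_nonneg fun v _ => mul_nonneg (hf _) (fp_pos _).le) (hCf 0)
  have hCt := Ct_pos (d := d)
  have h6 := hh_nonneg A0 K o
  calc _ ≤ LW {x | x ∉ A0} (A0 \ K) o (fun l => ∑ w ∈ SS o e s, ∑ v ∈ SS o e s, f (v - w) * ib (v ∈ l ∧ w ∈ l)) := by
        refine LW_mono _ _ _ fun l => ?_
        refine (sum_le_sum fun w hw => sum_le_sum (g := fun v => f (v - w) * ib (v ∈ l ∧ w ∈ l)) fun v hv => ?_).trans ?_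
        · simp only [mem_inter, List.mem_toFinset] at hv hw
          rw [ib_true ⟨pr_sub hv.1, pr_sub hw.1⟩, mul_one]
        · refine (sum_le_sum fun w _ => sum_le_sum_of_subset_of_nonneg Finset.inter_subset_right fun v _ _ => mul_nonneg (hf _) (ib_nonneg _)).trans ?_
          exact sum_le_sum_of_subset_of_nonneg Finset.inter_subset_right fun v _ _ => sum_nonneg fun _ _ => mul_nonneg (hf _) (ib_nonneg _)
    _ = ∑ w ∈ SS o e s, ∑ v ∈ SS o e s, f (v - w) * LW {x | x ∉ A0} (A0 \ K) o (fun l => ib (v ∈ l ∧ w ∈ l)) := by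
        rw [LW_sum]; refine sum_congr rfl fun w _ => ?_
        rw [LW_sum]; refine sum_congr rfl fun v _ => ?_
        rw [LW_smul]
    _ ≤ ∑ w ∈ SS o e s, ∑ v ∈ SS o e s, Ct d / (s : ℝ) ^ (d - 2) * hh A0 K o * (f (v - w) * fp (v - w)) := by
        refine sum_le_sum fun w hw => sum_le_sum fun v hv => ?_
        calc _ ≤ f (v - w) * (Ct d / (s : ℝ) ^ (d - 2) * hh A0 K o * fp (v - w)) := mul_le_mul_of_nonneg_left (G.two hv hw) (hf _)
          _ = _ := by ring
    _ ≤ ∑ w ∈ SS o e s, Ct d / (s : ℝ) ^ (d - 2) * hh A0 K o * Cf := by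
        refine sum_le_sum fun w hw => ?_
        rw [← mul_sum]; exact mul_le_mul_of_nonneg_left (hCf w) (by positivity)
    _ ≤ (3 * s : ℝ) ^ d * (Ct d / (s : ℝ) ^ (d - 2) * hh A0 K o * Cf) := by
        rw [sum_const, nsmul_eq_mul]
        refine mul_le_mul_of_nonneg_right ?_ (by positivity)
        rw [SS, card_Q]; exact_mod_cast Nat.pow_le_pow_left (by omega) d
    _ = _ := by
        rw [mul_pow, show (s : ℝ) ^ d = s ^ 2 * s ^ (d - 2) by rw [← pow_add]; congr 1; have := hd.out; omega]; field_simp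
lemma vis {a b : ℝ} (ha : 0 < a) (hb : 0 < b) : ∃ a' > 0, ∀ (c : V d) (s : ℕ) (Γ : Finset (V d)), l0 d ≤ s → Γ ⊆ Q c s → a * (s:ℝ) ^ 2 ≤ Γ.card →
    ∑ w ∈ Γ, ∑ v ∈ Γ, fp (v - w) ≤ b * (s:ℝ) ^ 2 → a' * (s:ℝ) ^ 4 ≤ Zb (Q c ((2 * M0 d + 1) * s)) Γ := by
  have hCg := Cg_pos (d := d); have hc3 := c3_pos (d := d)
  set t := 2 * b / a with ht
  have ht0 : 0 < t := by positivity
  refine ⟨a / 2 * (c3 d / 2 ^ (d - 2)) / (Cg d * t), by positivity, ?_⟩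
  intro c s Γ hs hΓ hcard hen
  have hs0 : (0:ℝ) < s := by exact_mod_cast l0_one.trans hs
  set B := Q c ((2 * M0 d + 1) * s) with hB
  set Γ' := Γ.filter (fun w => ∑ v ∈ Γ, fp (v - w) ≤ t) with hΓ'
  have hsub : Γ' ⊆ Γ := Finset.filter_subset _ _
  have hc1 : a / 2 * (s:ℝ) ^ 2 ≤ Γ'.card := by
    have h1 : ((Γ \ Γ').card : ℝ) * t ≤ b * (s:ℝ) ^ 2 := by
      refine le_trans ?_ hen
      rw [← nsmul_eq_mul, ← sum_const]
      refine le_trans (sum_le_sum fun w hw => ?_) (sum_le_sum_of_subset_of_nonneg (sdiff_subset (s := Γ) (t := Γ')) fun w _ _ => sum_nonneg fun v _ => (fp_pos _).le)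
      have := mem_sdiff.mp hw
      by_contra hcon; push Not at hcon
      exact this.2 (mem_filter.mpr ⟨this.1, hcon.le⟩)
    have h2 : ((Γ \ Γ').card : ℝ) + Γ'.card = Γ.card := by exact_mod_cast Finset.card_sdiff_add_card_eq_card hsub
    have h3 : ((Γ \ Γ').card : ℝ) ≤ a / 2 * s ^ 2 := by
      rw [← le_div_iff₀ ht0] at h1; refine h1.trans (le_of_eq ?_); rw [ht]; field_simp
    linarith
  have hu : ∀ x, (1 / (Cg d * t)) • (∑ v ∈ Γ', gr B v) x ≤ hz B Γ' x := by
    refine mp_le' (B \ Γ') ((1 / (Cg d * t)) • (∑ v ∈ Γ', gr B v)) _ (fun x hx => ?_) (fun x hx => ?_)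
    · have h1 := mem_sdiff.mp hx
      rw [hz, hm_lap hx, map_smul, map_sum, Pi.smul_apply, Finset.sum_apply, sum_eq_zero, smul_zero]
      intro v hv
      rw [gr_lap h1.1, ind_not]; rintro rfl; exact h1.2 hv
    · rw [hz, hm_off hx, Pi.smul_apply, Finset.sum_apply, smul_eq_mul]
      by_cases hx' : x ∈ Γ'
      · rw [ind_mem (by exact_mod_cast hx'), one_div, inv_mul_le_iff₀ (by positivity), mul_one]
        calc _ ≤ ∑ v ∈ Γ', Cg d * fp (v - x) := sum_le_sum fun v _ => by rw [fp_symm]; exact gr_le _ _ _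
          _ ≤ ∑ v ∈ Γ, Cg d * fp (v - x) := sum_le_sum_of_subset_of_nonneg hsub fun v _ _ => by have := fp_pos (v - x); positivity
          _ ≤ _ := by rw [← mul_sum]; exact mul_le_mul_of_nonneg_left (mem_filter.mp hx').2 hCg.le
      · have hB' : x ∉ B := fun hB => hx (by simp [hB, hx'])
        rw [sum_eq_zero fun v _ => gr_off hB', mul_zero]; exact ind_nonneg _ _
  refine le_trans ?_ (Zb_mono hsub)
  have hsB : Q c s ⊆ B := Q_mono _ (Nat.le_mul_of_pos_left _ (by omega))
  calc a / 2 * (c3 d / 2 ^ (d - 2)) / (Cg d * t) * (s:ℝ) ^ 4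
      = s ^ d * (1 / (Cg d * t) * (a / 2 * s ^ 2 * (c3 d / (2 * s) ^ (d - 2)))) := by
        rw [mul_pow, show (s : ℝ) ^ d = s ^ 2 * s ^ (d - 2) by rw [← pow_add]; congr 1; have := hd.out; omega]; field_simp
    _ ≤ (Q c s).card * (1 / (Cg d * t) * (Γ'.card * (c3 d / (2 * s) ^ (d - 2)))) := by
        gcongr
        rw [card_Q]; exact_mod_cast Nat.pow_le_pow_left (by omega) d
    _ = ∑ x ∈ Q c s, (1 / (Cg d * t)) * ∑ v ∈ Γ', c3 d / (2 * s) ^ (d - 2) := by simp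
    _ ≤ ∑ x ∈ Q c s, hz B Γ' x := by
        refine sum_le_sum fun x hx => le_trans (mul_le_mul_of_nonneg_left ?_ (by positivity)) (hu x)
        rw [Finset.sum_apply]
        refine sum_le_sum fun v hv => ?_
        have := gr_ge (B := B) (v := v) (y := x) (r := 2 * s) (by omega) (fun y hy => ?_) ?_
        · push_cast at this; exact this
        · have := Q_tri hy (hΓ (hsub hv)); refine Q_mono _ (le_of_eq ?_) this; ring
        · have := Q_tri hx (Q_symm.mp (hΓ (hsub hv))); rwa [← two_mul] at this
    _ ≤ _ := sum_le_sum_of_subset_of_nonneg hsB fun x _ _ => hz_nonneg _ _ _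
lemma key : ∃ a p : ℝ, 0 < a ∧ 0 < p ∧ ∃ i0 : ℕ, ∀ (A0 K : Finset (V d)) (o : V d) (e : E d) (N' N i : ℕ), i0 ≤ i → Geo A0 K o e N' N (sc d i) →
    p * hh A0 K o ≤ LW {x | x ∉ A0} (A0 \ K) o (fun l => ib (a * (sc d i : ℝ) ^ 4 ≤
      Zb (Q (cc o e (Th d * sc d i)) ((2 * M0 d + 1) * sc d i)) (pr (Q o (MM d * sc d i)) l).toFinset)) := by
  obtain ⟨c, hc, i0, H1⟩ := first_mom (d := d)
  have hCt := Ct_pos (d := d)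
  set C := Ct d * 3 ^ d * (64 * 8 ^ d) with hC
  set Ce := Ct d * 3 ^ d * (3 * 8 ^ d) with hCe
  have hC0 : 0 < C := by positivity
  have hCe0 : 0 < Ce := by positivity
  obtain ⟨a, ha, Hv⟩ := vis (d := d) (a := c / 2) (b := 8 * C * Ce / c ^ 2) (by positivity) (by positivity)
  refine ⟨a, c ^ 2 / (8 * C), ha, by positivity, i0, ?_⟩
  intro A0 K o e N' N i hi G
  have h1 := H1 A0 K o e N' N i hi G
  have hs1 := sc_one (d := d) i
  set s := sc d i with hs
  have hs0 : (0:ℝ) < s := by exact_mod_cast hs1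
  set L := Q o (MM d * s)
  have h6 := hh_nonneg A0 K o
  set W := LW {x | x ∉ A0} (A0 \ K) o with hW
  set X : List (V d) → ℝ := fun l => (((pr L l).toFinset ∩ SS o e s).card : ℝ) with hX
  set En : List (V d) → ℝ := fun l => ∑ w ∈ (pr L l).toFinset ∩ SS o e s, ∑ v ∈ (pr L l).toFinset ∩ SS o e s, fp (v - w) with hEn
  have h2 : W (fun l => X l ^ 2) ≤ C * s ^ 4 * hh A0 K o := by
    have := pair_le G L (fun _ => 1) (fun _ => zero_le_one) (Cf := 64 * 8 ^ d * (s:ℝ) ^ 2) (fun w => by simp only [one_mul]; exact sum_fp s hs1 _ w)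
    simp only [sum_const, nsmul_eq_mul, mul_one, ← pow_two] at this
    refine this.trans (le_of_eq ?_); rw [hC]; ring
  have h3 : W En ≤ Ce * s ^ 2 * hh A0 K o :=
    pair_le G L fp (fun x => (fp_pos x).le) (Cf := 3 * 8 ^ d) (fun w => by simpa [pow_two] using sum_fp2 _ w)
  have h4 : W (fun _ => 1) = hh A0 K o := LW_one _ _ _ (fun y hy h => hy (mem_sdiff.mp h).1)
  set good : List (V d) → Prop := fun l => a * (s : ℝ) ^ 4 ≤ Zb (Q (cc o e (Th d * s)) ((2 * M0 d + 1) * s)) (pr L l).toFinset with hgood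
  have pt : ∀ l, (c / (C * s ^ 2)) * X l + (-(c / (C * s ^ 2)) * (c / 2 * s ^ 2) * 1 + (-(c / (2 * C * s ^ 2)) ^ 2 * X l ^ 2 + (-(c ^ 2 / (8 * C * Ce * s ^ 2))) * En l)) ≤ ib (good l) := by
    intro l
    have hEn0 : 0 ≤ En l := sum_nonneg fun _ _ => sum_nonneg fun _ _ => (fp_pos _).le
    by_cases h1 : c / 2 * (s:ℝ) ^ 2 ≤ X l
    · by_cases h2 : En l ≤ 8 * C * Ce / c ^ 2 * (s:ℝ) ^ 2
      · have hg : good l := (Hv _ s _ G.hs Finset.inter_subset_right h1 h2).trans (Zb_mono Finset.inter_subset_left)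
        rw [ib_true hg]
        have e1 : 0 ≤ c ^ 2 / (8 * C * Ce * s ^ 2) * En l := by positivity
        have e2 : 0 ≤ c / (C * s ^ 2) * (c / 2 * s ^ 2) := by positivity
        have e3 := sq_nonneg (c / (2 * C * s ^ 2) * X l - 1)
        have e4 : c / (C * s ^ 2) = 2 * (c / (2 * C * s ^ 2)) := by field_simp
        rw [e4] at e2 ⊢; nlinarith
      · push Not at h2
        have e1 : 1 ≤ c ^ 2 / (8 * C * Ce * s ^ 2) * En l := by
          calc (1:ℝ) = c ^ 2 / (8 * C * Ce * s ^ 2) * (8 * C * Ce / c ^ 2 * (s:ℝ) ^ 2) := by field_simp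
            _ ≤ _ := by gcongr
        have e2 : 0 ≤ c / (C * s ^ 2) * (c / 2 * s ^ 2) := by positivity
        have e3 := sq_nonneg (c / (2 * C * s ^ 2) * X l - 1)
        have e4 : c / (C * s ^ 2) = 2 * (c / (2 * C * s ^ 2)) := by field_simp
        have := ib_nonneg (good l)
        rw [e4] at e2 ⊢; nlinarith
    · push Not at h1
      have e1 : 0 ≤ c ^ 2 / (8 * C * Ce * s ^ 2) * En l := by positivity
      have e2 : c / (C * s ^ 2) * X l ≤ c / (C * s ^ 2) * (c / 2 * s ^ 2) := by gcongr
      have e3 := sq_nonneg (c / (2 * C * s ^ 2) * X l)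
      have := ib_nonneg (good l)
      nlinarith
  have h5 := LW_mono {x | x ∉ A0} (A0 \ K) o pt
  rw [LW_add, LW_add, LW_add, LW_smul, LW_smul, LW_smul, LW_smul] at h5
  refine le_trans ?_ h5
  have g1 := mul_le_mul_of_nonneg_left h1 (show 0 ≤ c / (C * s ^ 2) by positivity)
  have g2 := mul_le_mul_of_nonneg_left h2 (show 0 ≤ (c / (2 * C * s ^ 2)) ^ 2 by positivity)
  have g3 := mul_le_mul_of_nonneg_left h3 (show 0 ≤ c ^ 2 / (8 * C * Ce * s ^ 2) by positivity)
  rw [← hW, h4]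
  have f1 : c / (C * s ^ 2) * (c * s ^ 2 * hh A0 K o) = c ^ 2 / C * hh A0 K o := by field_simp
  have f2 : (c / (2 * C * s ^ 2)) ^ 2 * (C * s ^ 4 * hh A0 K o) = c ^ 2 / (4 * C) * hh A0 K o := by field_simp; ring
  have f3 : c ^ 2 / (8 * C * Ce * s ^ 2) * (Ce * s ^ 2 * hh A0 K o) = c ^ 2 / (8 * C) * hh A0 K o := by field_simp
  have f4 : c / (C * s ^ 2) * (c / 2 * s ^ 2) = c ^ 2 / (2 * C) := by field_simp
  rw [f1] at g1; rw [f2] at g2; rw [f3] at g3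
  have f5 : c ^ 2 / (8 * C) * hh A0 K o = c ^ 2 / C * hh A0 K o - c ^ 2 / (2 * C) * hh A0 K o - c ^ 2 / (4 * C) * hh A0 K o - c ^ 2 / (8 * C) * hh A0 K o := by field_simp; ring
  have f6 : -(c / (C * (s:ℝ) ^ 2)) * (c / 2 * s ^ 2) = -(c ^ 2 / (2 * C)) := by rw [neg_mul, f4]
  rw [f6]
  linarith [g1, g2, g3, f5]
end

section
variable [hd : Fact (5 ≤ d)]
lemma er_ins (A0 K : Finset (V d)) (x : V d) : (A0 \ K).erase x = A0 \ insert x K := by ext y; simp; tauto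
lemma indK (A0 L : Finset (V d)) {m : ℕ} (hL : L ⊆ Q 0 m) {P : Finset (V d) → V d → Prop} (h0 : ∀ K x, x ∈ Q 0 (m + 1) → x ∉ A0 \ K → P K x)
    (h1 : ∀ K ⊆ Q 0 m, ∀ x ∈ A0 \ K, x ∈ L → (∀ e, P (insert x K) (nb x e)) → P K x)
    (h2 : ∀ K ⊆ Q 0 m, ∀ x ∈ Q 0 (m + 1), x ∈ A0 \ K → x ∉ L → P K x) : ∀ K ⊆ Q 0 m, ∀ x ∈ Q 0 (m + 1), P K x := by
  suffices ∀ n, ∀ K ⊆ Q 0 m, ∀ x ∈ Q 0 (m + 1), (A0 \ K).card ≤ n → P K x from fun K hK x hx => this _ K hK x hx le_rfl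
  intro n
  induction n with
  | zero =>
    intro K hK x hx hc
    refine h0 K x hx ?_
    rw [Finset.card_eq_zero.mp (Nat.le_zero.mp hc)]; simp
  | succ n ih =>
    intro K hK x hx hc
    by_cases hA : x ∈ A0 \ K
    · by_cases hxL : x ∈ L
      · refine h1 K hK x hA hxL fun e => ih _ ?_ _ (nb_mem_Q e (hL hxL)) ?_
        · exact Finset.insert_subset (hL hxL) hK
        · rw [← er_ins, Finset.card_erase_of_mem hA]; omega
      · exact h2 K hK x hx hA hxL
    · exact h0 K x hx hA
lemma offR {A0 K : Finset (V d)} {m : ℕ} (hm : Q 0 (m + 1) ⊆ A0) {x : V d} (hx : x ∈ Q 0 (m + 1)) (h : x ∉ A0 \ K) (F : List (V d) → ℝ) :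
    LW {x | x ∉ A0} (A0 \ K) x F = 0 := by
  have hn : x ∉ ({x | x ∉ A0} : Set (V d)) := fun h' => h' (hm hx)
  rw [LW_off h, ind_not hn, zero_mul]
lemma LW_split {A0 L : Finset (V d)} {m : ℕ} (hm : Q 0 (m + 1) ⊆ A0) (hL : L ⊆ Q 0 m) {H : List (V d) → ℝ} {c : ℝ} (hH : ∀ v l, H (v :: l) ≤ H l)
    (hc : ∀ K ⊆ Q 0 m, ∀ x ∈ Q 0 (m + 1), LW {x | x ∉ A0} (A0 \ K) x H ≤ c * hh A0 K x) :
    ∀ K ⊆ Q 0 m, ∀ x ∈ Q 0 (m + 1), ∀ G : List (V d) → ℝ, (∀ l, 0 ≤ G l) →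
    LW {x | x ∉ A0} (A0 \ K) x (fun l => G (pr L l) * H l) ≤ c * LW {x | x ∉ A0} (A0 \ K) x (fun l => G (pr L l)) := by
  refine indK A0 L hL (fun K x hx h G _ => ?_) (fun K hK x hA hxL ih G hG => ?_) (fun K hK x hx hA hxL G hG => ?_)
  · rw [offR hm hx h, offR hm hx h, mul_zero]
  · rw [LW_in hA, LW_in hA, er_ins, mul_left_comm]
    refine mul_le_mul_of_nonneg_left ?_ (gr_nonneg _ _ _)
    rw [mul_comm c, ← av_mul_right]
    refine av_mono fun e => ?_
    have h1 : ∀ l, pr L (x :: l) = x :: pr L l := fun l => by simp [pr, hxL]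
    simp only [h1]
    refine le_trans (LW_mono _ _ _ fun l => mul_le_mul_of_nonneg_left (hH x l) (hG _)) ?_
    rw [mul_comm _ c]; exact ih e (fun l => G (x :: l)) fun l => hG _
  · have h1 : ∀ l, pr L (x :: l) = [] := fun l => by simp [pr, hxL]
    have e1 : LW {x | x ∉ A0} (A0 \ K) x (fun l => G (pr L l) * H l) = LW {x | x ∉ A0} (A0 \ K) x (fun l => G [] * H l) := by
      rw [LW_in hA, LW_in hA]; simp only [h1]
    have e2 : LW {x | x ∉ A0} (A0 \ K) x (fun l => G (pr L l)) = LW {x | x ∉ A0} (A0 \ K) x (fun l => G [] * 1) := by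
      rw [LW_in hA, LW_in hA]; simp only [h1, mul_one]
    rw [e1, e2, LW_smul, LW_smul, LW_one {x | x ∉ A0} _ _ (fun y hy h => hy (mem_sdiff.mp h).1), mul_left_comm]
    exact mul_le_mul_of_nonneg_left (hc K hK x hx) (hG _)
noncomputable def ms (d : ℕ) [hd : Fact (5 ≤ d)] (s j : ℕ) : ℕ := j * ((MM d + 1) * s)
noncomputable def rho (d : ℕ) [hd : Fact (5 ≤ d)] (s : ℕ) : ℕ := (2 * M0 d + 1) * s
def good (a : ℝ) (s j : ℕ) (Γ : Finset (V d)) : Prop :=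
  ∃ z : V d, Q z (rho d s) ⊆ Q 0 (ms d s (j + 1)) \ Q 0 (ms d s j + 1) ∧ a * (s : ℝ) ^ 4 ≤ Zb (Q z (rho d s)) Γ
lemma good_mono {a : ℝ} {s j : ℕ} {Γ Γ' : Finset (V d)} (h : Γ ⊆ Γ') : good a s j Γ → good a s j Γ' :=
  fun ⟨z, h1, h2⟩ => ⟨z, h1, h2.trans (Zb_mono h)⟩
noncomputable def ph (a α : ℝ) (s j : ℕ) (Γ : Finset (V d)) : ℝ := 1 - α * ib (good a s j Γ)
lemma seq : ∃ a p : ℝ, 0 < a ∧ 0 < p ∧ p ≤ 1 ∧ ∃ i0 : ℕ, ∀ (α : ℝ) (A0 : Finset (V d)) (N' N i k : ℕ), 0 ≤ α → α ≤ 1 → i0 ≤ i →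
    Q 0 (4 * N) ⊆ A0 → La d * N' ≤ N → 4 * MM d * sc d i ≤ N' → ms d (sc d i) k + 1 ≤ N' →
    LW {x | x ∉ A0} A0 0 (fun l => ∏ j ∈ Finset.Ico 0 k, ph a α (sc d i) j l.toFinset) ≤ (1 - α * p) ^ k := by
  obtain ⟨a, p, ha, hp, i0, H⟩ := key (d := d)
  refine ⟨a, min p 1, ha, by positivity, min_le_right _ _, i0, ?_⟩
  intro α A0 N' N i k h0 h1 hi hA hN hsN hk
  set s := sc d i with hs
  have hs1 : 1 ≤ s := sc_one i
  set q := min p 1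
  have hq : 0 ≤ 1 - α * q := by have : q ≤ 1 := min_le_right _ _; nlinarith [show 0 < q by positivity]
  have ph0 : ∀ j (Γ : Finset (V d)), 0 ≤ ph a α s j Γ := fun j Γ => by
    have := ib_le (good a s j Γ); have := ib_nonneg (good a s j Γ); unfold ph; nlinarith
  have pha : ∀ j {Γ Γ' : Finset (V d)}, Γ ⊆ Γ' → ph a α s j Γ' ≤ ph a α s j Γ := fun j Γ Γ' h => by
    have := ib_mono (good_mono (a := a) (s := s) (j := j) h); unfold ph; nlinarith
  have prod0 : ∀ j (Γ : Finset (V d)), 0 ≤ ∏ t ∈ Finset.Ico j k, ph a α s t Γ := fun j Γ => Finset.prod_nonneg fun t _ => ph0 t Γ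
  have proda : ∀ j (v : V d) (l : List (V d)), ∏ t ∈ Finset.Ico j k, ph a α s t (v :: l).toFinset ≤ ∏ t ∈ Finset.Ico j k, ph a α s t l.toFinset :=
    fun j v l => prod_le_prod (fun t _ => ph0 t _) fun t _ => pha t (by simp)
  have hLa := La_ge (d := d)
  have hN8 : 8 * N' ≤ N := (Nat.mul_le_mul_right _ hLa).trans hN
  have msm : ∀ {j j' : ℕ}, j ≤ j' → ms d s j ≤ ms d s j' := fun h => Nat.mul_le_mul_right _ h
  have T : ∀ n j, j + n = k → ∀ K ⊆ Q 0 (ms d s j), ∀ x ∈ Q 0 (ms d s j + 1),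
      LW {x | x ∉ A0} (A0 \ K) x (fun l => ∏ t ∈ Finset.Ico j k, ph a α s t l.toFinset) ≤ (1 - α * q) ^ n * hh A0 K x := by
    intro n
    induction n with
    | zero =>
      intro j hj K hK x hx
      have : j = k := by omega
      subst this
      simp only [Finset.Ico_self, Finset.prod_empty, pow_zero, one_mul]
      exact (LW_one {x | x ∉ A0} _ _ (fun y hy h => hy (mem_sdiff.mp h).1)).le
    | succ n ih =>
      intro j hj
      have hmA : ∀ j' ≤ k, Q (0 : V d) (ms d s j' + 1) ⊆ A0 := fun j' hj' => (Q_mono _ (by have := msm hj'; omega)).trans hA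
      refine indK A0 (Q 0 (ms d s j)) (Finset.Subset.refl _) (fun K x hx h => ?_) (fun K hK x hxA hxL ih' => ?_) (fun K hK x hx hxA hxL => ?_)
      · rw [offR (hmA j (by omega)) hx h]; exact mul_nonneg (pow_nonneg hq _) (hh_nonneg _ _ _)
      · have hxK := mem_sdiff.mp hxA
        rw [LW_in hxA, er_ins, hh, hm_erase (R := {x | x ∉ A0}) hxA (fun h => h hxK.1), er_ins, mul_left_comm]
        refine mul_le_mul_of_nonneg_left ?_ (gr_nonneg _ _ _)
        rw [mul_comm (_ ^ _), ← av_mul_right]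
        refine av_mono fun e => ?_
        rw [mul_comm]
        exact (LW_mono _ _ _ fun l => proda j x l).trans (ih' e)
      · obtain ⟨i', hi'⟩ : ∃ i', ¬ |x i' - (0 : V d) i'| ≤ (ms d s j : ℕ) := by
          by_contra hcon; push Not at hcon; exact hxL (mem_Q.mpr hcon)
        have hx' := mem_Q.mp hx i'
        simp only [Pi.zero_apply, sub_zero] at hi' hx'
        obtain ⟨e, he⟩ : ∃ e : E d, ∀ y : V d, y ∈ Q 0 (ms d s j + 1) → tt x e y ≤ 0 ∧ (y ∈ Q 0 (ms d s j) → tt x e y < 0) := by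
          refine ⟨(i', decide (0 ≤ x i')), fun y hy => ?_⟩
          have a1 := mem_Q.mp hy i'
          simp only [Pi.zero_apply, sub_zero] at a1
          simp only [tt]
          have a3 : y ∈ Q 0 (ms d s j) → |y i'| ≤ (ms d s j : ℕ) := fun h => by simpa using mem_Q.mp h i'
          push_cast at hi' hx' a1
          rw [abs_le] at a1 hx'
          by_cases h : 0 ≤ x i'
          · rw [abs_of_nonneg h] at hi'
            simp only [h, decide_true, sg, if_true]
            refine ⟨by omega, fun h => ?_⟩
            have := abs_le.mp (a3 h); omega
          · rw [abs_of_neg (by omega)] at hi'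
            simp only [h, decide_false, sg]
            simp only [Bool.false_eq_true, if_false]
            refine ⟨by omega, fun h => ?_⟩
            have := abs_le.mp (a3 h); omega
        have hjk : ms d s (j + 1) ≤ ms d s k := msm (by omega)
        have hjj : ms d s (j + 1) = ms d s j + (MM d + 1) * s := by unfold ms; ring
        have G : Geo A0 K x e N' N s := ⟨hA, fun y hy => (he y (Q_mono _ (by omega) (hK hy))).2 (hK hy), hK.trans (Q_mono _ (by omega)),
          Q_mono _ (by omega) hx, sc_ge i, hsN, hN⟩
        have hL : Q x (MM d * s) ⊆ Q 0 (ms d s (j + 1)) := fun y hy => Q_mono _ (by rw [hjj]; nlinarith) (Q_tri hy hx)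
        have h2 := LW_split (hmA (j + 1) (by omega)) hL (H := fun l => ∏ t ∈ Finset.Ico (j + 1) k, ph a α s t l.toFinset)
          (proda (j + 1)) (ih (j + 1) (by omega)) K (hK.trans (Q_mono _ (by omega))) x (Q_mono _ (by omega) hx) (fun l => ph a α s j l.toFinset) (fun l => ph0 _ _)
        have h3 := H A0 K x e N' N i hi G
        rw [← hs] at h3
        have h4 : LW {x | x ∉ A0} (A0 \ K) x (fun l => ph a α s j (pr (Q x (MM d * s)) l).toFinset) ≤ (1 - α * q) * hh A0 K x := by
          have e1 : (fun l : List (V d) => ph a α s j (pr (Q x (MM d * s)) l).toFinset) = fun l => 1 * (1:ℝ) + (-α) * ib (good a s j (pr (Q x (MM d * s)) l).toFinset) := by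
            ext l; unfold ph; ring
          rw [e1, LW_lin, LW_one {x | x ∉ A0} _ _ (fun y hy h => hy (mem_sdiff.mp h).1)]
          have h5 : q * hh A0 K x ≤ LW {x | x ∉ A0} (A0 \ K) x (fun l => ib (good a s j (pr (Q x (MM d * s)) l).toFinset)) := by
            refine le_trans (mul_le_mul_of_nonneg_right (min_le_left _ _) (hh_nonneg _ _ _)) (h3.trans (LW_mono _ _ _ fun l => ib_mono fun hl => ?_))
            refine ⟨_, fun y hy => mem_sdiff.mpr ⟨hL ?_, fun h' => ?_⟩, hl⟩
            · refine Q_mono _ ?_ (Q_tri hy (cc_Q x e (Th d * s)))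
              unfold rho Th MM; nlinarith
            · have a1 := tt_Q (o := x) (e := e) hy
              rw [tt_cc, abs_le] at a1
              have a2 := (he y h').1
              have a3 : rho d s < Th d * s := by unfold rho Th; nlinarith
              omega
          have h6 := mul_le_mul_of_nonneg_left h5 h0
          unfold hh at h6 ⊢; linarith
        refine (LW_mono _ _ _ fun l => ?_).trans (h2.trans ?_)
        · rw [Finset.prod_eq_prod_Ico_succ_bot (by omega)]
          refine mul_le_mul_of_nonneg_right (pha j fun v hv => ?_) (prod0 _ _)
          rw [List.mem_toFinset] at hv ⊢; exact pr_sub hv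
        · rw [pow_succ, mul_assoc]
          exact mul_le_mul_of_nonneg_left h4 (pow_nonneg hq _)
  have := T k 0 (by omega) ∅ (by simp) 0 (Q_self _ _)
  simp only [Finset.sdiff_empty] at this
  refine this.trans ?_
  have h2 : hh A0 ∅ 0 ≤ 1 := hm_le_one _ _ _
  exact mul_le_of_le_one_right (pow_nonneg hq _) h2
end

section
variable [hd : Fact (5 ≤ d)]
inductive Hit (σ : V d → E d) (A : Finset (V d)) (R : Set (V d)) : V d → Prop
  | base (x : V d) : x ∉ A → x ∈ R → Hit σ A R x
  | step (x : V d) : x ∈ A → Hit σ A R (nb x (σ x)) → Hit σ A R x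
section hit
variable {σ τ : V d → E d} {A A' B : Finset (V d)} {R R' : Set (V d)} {x y z : V d}
lemma Hit.tr (h : Hit σ A' R' x) (hA : A' ⊆ A) (h2 : ∀ y, y ∉ A' → y ∈ R' → Hit σ A R y) : Hit σ A R x := by
  induction h with
  | base x h1 h3 => exact h2 x h1 h3
  | step x h1 _ ih => exact .step x (hA h1) ih
lemma Hit.mono (h : Hit σ A' R x) (hA : A' ⊆ A) (hR : ∀ y ∈ R, y ∉ A) : Hit σ A R x :=
  h.tr hA fun y _ h2 => .base y (hR y h2) h2
lemma Hit.monoR (h : Hit σ A R x) (hR : ∀ y, y ∉ A → y ∈ R → y ∈ R') : Hit σ A R' x :=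
  h.tr le_rfl fun y h1 h2 => .base y h1 (hR y h1 h2)
lemma Hit.cut (h : Hit σ A R x) (hA : A' ⊆ A) (h2 : ∀ y ∈ A, y ∉ A' → y ∈ R') (h3 : R ⊆ R') : Hit σ A' R' x := by
  induction h with
  | base x h1 h4 => exact .base x (fun h => h1 (hA h)) (h3 h4)
  | step x h1 _ ih =>
    by_cases hx : x ∈ A'
    · exact .step x hx ih
    · exact .base x hx (h2 x h1 hx)
lemma Hit.det (h : Hit σ A R x) (h' : Hit σ A R' x) : ∃ y, y ∈ R ∧ y ∈ R' := by
  induction h with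
  | base x h1 h2 =>
    cases h' with
    | base _ _ h3 => exact ⟨x, h2, h3⟩
    | step _ h3 _ => exact absurd h3 h1
  | step x h1 _ ih =>
    cases h' with
    | base _ h3 _ => exact absurd h1 h3
    | step _ _ h4 => exact ih h4
lemma Hit.loc (h : Hit σ A R x) (hl : ∀ y ∈ A, σ y = τ y) : Hit τ A R x := by
  induction h with
  | base x h1 h2 => exact .base x h1 h2
  | step x h1 _ ih => exact .step x h1 (hl x h1 ▸ ih)
lemma Hit.loc_iff (hl : ∀ y ∈ A, σ y = τ y) : Hit σ A R x ↔ Hit τ A R x := ⟨fun h => h.loc hl, fun h => h.loc fun y hy => (hl y hy).symm⟩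
lemma Hit.nxt (h : Hit σ A R x) (hx : x ∈ A) : Hit σ A R (nb x (σ x)) := by
  cases h with
  | base _ h3 _ => exact absurd hx h3
  | step _ _ h4 => exact h4
lemma Hit.del (h : Hit σ A R z) (x : V d) : Hit σ (A.erase x) R z ∨ Hit σ (A.erase x) R (nb x (σ x)) := by
  induction h with
  | base z h1 h2 => exact .inl (.base z (fun h => h1 (mem_of_mem_erase h)) h2)
  | step z h1 _ ih =>
    by_cases hz : z = x
    · subst hz; exact .inr (ih.elim id id)
    · exact ih.imp (fun h => .step z (mem_erase.mpr ⟨hz, h1⟩) h) id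
lemma Hit.iff_er (hx : x ∈ A) (hR : ∀ y ∈ R, y ∉ A) : Hit σ A R x ↔ Hit σ (A.erase x) R (nb x (σ x)) :=
  ⟨fun h => ((h.nxt hx).del x).elim id id, fun h => .step x hx (h.mono (erase_subset _ _) hR)⟩
def ac (A : Finset (V d)) (σ : V d → E d) : Prop := ∀ x, Hit σ A {y | y ∉ A} x
lemma ac.anti (h : ac A σ) (hA : A' ⊆ A) : ac A' σ := fun x => (h x).cut hA (fun _ _ h => h) (fun _ h h' => h (hA h'))
lemma ac_loc (hl : ∀ y ∈ A, σ y = τ y) : ac A σ ↔ ac A τ := forall_congr' fun _ => Hit.loc_iff hl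
lemma ac_iff (hx : x ∈ A) (hR : ∀ y ∈ R, y ∉ A) :
    (ac A σ ∧ Hit σ A R x) ↔ (ac (A.erase x) σ ∧ Hit σ (A.erase x) R (nb x (σ x))) := by
  refine ⟨fun h => ⟨h.1.anti (erase_subset _ _), (Hit.iff_er hx hR).mp h.2⟩, fun h => ?_⟩
  have h2 := (Hit.iff_er hx hR).mpr h.2
  refine ⟨fun z => (h.1 z).tr (erase_subset _ _) fun y hy _ => ?_, h2⟩
  by_cases hyA : y ∈ A
  · have : y = x := by by_contra hne; exact hy (mem_erase.mpr ⟨hne, hyA⟩)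
    subst this; exact h2.monoR fun y h1 _ => h1
  · exact .base y hyA hyA
noncomputable def pl (σ : V d → E d) (A : Finset (V d)) (x : V d) : List (V d) :=
  if _h : x ∈ A then x :: pl σ (A.erase x) (nb x (σ x)) else []
termination_by A.card
decreasing_by exact Finset.card_erase_lt_of_mem _h
lemma pl_in (h : x ∈ A) : pl σ A x = x :: pl σ (A.erase x) (nb x (σ x)) := by rw [pl]; simp [h]
lemma pl_off (h : x ∉ A) : pl σ A x = [] := by rw [pl]; simp [h]
lemma pl_hit : (∀ y ∈ R, y ∉ A) → Hit σ A R x → ∀ z ∈ pl σ A x, Hit σ A R z := by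
  refine ind_er (P := fun A x => (∀ y ∈ R, y ∉ A) → Hit σ A R x → ∀ z ∈ pl σ A x, Hit σ A R z) ?_ ?_ A x
  · intro A x hx _ _ z hz; simp [pl_off hx] at hz
  · intro A x hx ih hR h z hz
    rw [pl_in hx, List.mem_cons] at hz
    rcases hz with rfl | hz
    · exact h
    · exact (ih _ (fun y hy h => hR y hy (mem_of_mem_erase h)) ((Hit.iff_er hx hR).mp h) z hz).mono (erase_subset _ _) hR
lemma Hit.avoid {v : V d} (hv : v ∉ A) (hvR : v ∉ R) (hR : ∀ y ∈ R, y ∉ A) (hBA : B ⊆ A) (hy : Hit σ A {v} y) (h : Hit σ B R x) :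
    Hit σ (B \ (pl σ A y).toFinset) R x := by
  have h' := h.mono hBA hR
  induction h with
  | base x h1 h2 => exact .base x (fun h => h1 (mem_sdiff.mp h).1) h2
  | step x h1 h3 ih =>
    have hxl : x ∉ (pl σ A y).toFinset := fun hx => by
      have h4 := pl_hit (by rintro _ rfl; exact hv) hy x (List.mem_toFinset.mp hx)
      obtain ⟨w, rfl, h6⟩ := h4.det h'
      exact hvR h6
    refine .step x (mem_sdiff.mpr ⟨h1, hxl⟩) (ih (h'.nxt (hBA h1)))
end hit
noncomputable def ex {U : Finset (V d)} (σ : U → E d) (x : V d) : E d := if h : x ∈ U then σ ⟨x, h⟩ else (0, true)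
noncomputable def Su (U : Finset (V d)) (F : (V d → E d) → ℝ) : ℝ := ∑ σ : U → E d, F (ex σ)
section sums
variable {U : Finset (V d)}
lemma ex_upd (σ : U → E d) {x : V d} (hx : x ∈ U) (e : E d) : ex (Function.update σ ⟨x, hx⟩ e) = Function.update (ex σ) x e := by
  ext1 y
  by_cases h : y = x
  · subst h; simp [ex, hx]
  · rw [Function.update_of_ne h]; unfold ex
    by_cases hy : y ∈ U
    · simp only [hy, dif_pos]; rw [Function.update_of_ne (by simpa using h)]
    · simp [hy]
lemma Su_mono {F G : (V d → E d) → ℝ} (h : ∀ σ, F σ ≤ G σ) : Su U F ≤ Su U G := sum_le_sum fun σ _ => h _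
lemma Su_av {x : V d} (hx : x ∈ U) (F : V d → (V d → E d) → ℝ) (hF : ∀ y σ e, F y (Function.update σ x e) = F y σ) :
    Su U (fun σ => F (nb x (σ x)) σ) = av (fun y => Su U (F y)) x := by
  have h2 := d2pos (d := d)
  rw [av_def, eq_div_iff h2.ne', ← card_E]
  have h3 : ∑ e, Su U (F (nb x e)) = ∑ σ : U → E d, ∑ e, F (nb x e) (ex σ) := sum_comm
  have : (Su U fun σ => F (nb x (σ x)) σ) * (Fintype.card (E d) : ℝ) = ∑ q : (U → E d) × E d, F (nb x (ex q.1 x)) (ex q.1) := by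
    rw [Fintype.sum_prod_type]; simp [Su, ← mul_sum, mul_comm]
  rw [this, h3, ← Fintype.sum_prod_type' (f := fun (σ : U → E d) (e : E d) => F (nb x e) (ex σ))]
  have inv : Function.Involutive (fun q : (U → E d) × E d => (Function.update q.1 ⟨x, hx⟩ q.2, q.1 ⟨x, hx⟩)) := fun q => by simp
  refine Fintype.sum_equiv inv.toPerm _ _ fun q => ?_
  simp only [Function.Involutive.coe_toPerm, ex_upd, hF]
  simp [ex, hx]
lemma Su_ind (S : Finset (V d)) {F G : (V d → E d) → ℝ} (hF : ∀ σ τ, (∀ x ∈ S, σ x = τ x) → F σ = F τ)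
    (hG : ∀ σ τ, (∀ x, x ∉ S → σ x = τ x) → G σ = G τ) : Su U (fun σ => F σ * G σ) * Su U (fun _ => 1) = Su U F * Su U G := by
  unfold Su
  rw [sum_mul_sum, sum_mul_sum, ← Fintype.sum_prod_type' (f := fun (σ τ : U → E d) => F (ex σ) * G (ex σ) * 1),
    ← Fintype.sum_prod_type' (f := fun (σ τ : U → E d) => F (ex σ) * G (ex τ))]
  have inv : Function.Involutive (fun q : (U → E d) × (U → E d) =>
      ((fun x => if x.1 ∈ S then q.1 x else q.2 x : U → E d), (fun x => if x.1 ∈ S then q.2 x else q.1 x : U → E d))) := fun q => by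
    ext x <;> simp <;> split_ifs <;> rfl
  refine Fintype.sum_equiv inv.toPerm _ _ fun q => ?_
  simp only [Function.Involutive.coe_toPerm, mul_one]
  congr 1
  · refine hF _ _ fun x hx => ?_
    unfold ex; split_ifs <;> simp_all
  · refine hG _ _ fun x hx => ?_
    unfold ex; split_ifs <;> simp_all
noncomputable def NN (U A : Finset (V d)) : ℝ := Su U fun σ => ib (ac A σ)
noncomputable def mean (U A : Finset (V d)) (F : (V d → E d) → ℝ) : ℝ := Su U (fun σ => ib (ac A σ) * F σ) / NN U A
lemma ib_and (p q : Prop) : ib (p ∧ q) = ib p * ib q := by by_cases hp : p <;> by_cases hq : q <;> simp [ib, hp, hq]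
lemma ib_iff {p q : Prop} (h : p ↔ q) : ib p = ib q := by rw [propext h]
end sums
end

section
variable [hd : Fact (5 ≤ d)]
variable {U : Finset (V d)}
lemma upd_ag {σ : V d → E d} {x : V d} {e : E d} {A : Finset (V d)} (hx : x ∉ A) : ∀ y ∈ A, Function.update σ x e y = σ y :=
  fun y hy => Function.update_of_ne (by rintro rfl; exact hx hy) _ _
lemma pl_loc {σ τ : V d → E d} {A : Finset (V d)} {x : V d} : (∀ y ∈ A, σ y = τ y) → pl σ A x = pl τ A x := by
  refine ind_er (P := fun A x => (∀ y ∈ A, σ y = τ y) → pl σ A x = pl τ A x) (fun A x hx _ => by rw [pl_off hx, pl_off hx]) (fun A x hx ih h => ?_) A x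
  rw [pl_in hx, pl_in hx, h x hx, ih _ fun y hy => h y (mem_of_mem_erase hy)]
lemma Su_step {A : Finset (V d)} {x : V d} (hx : x ∈ A) (hxU : x ∈ U) {R : Set (V d)} (hR : ∀ y ∈ R, y ∉ A)
    (Ψ : List (V d) → (V d → E d) → ℝ) (hΨ : ∀ l σ e, Ψ (x :: l) (Function.update σ x e) = Ψ (x :: l) σ) :
    Su U (fun σ => ib (ac A σ) * (ib (Hit σ A R x) * Ψ (pl σ A x) σ)) =
    av (fun y => Su U (fun σ => ib (ac (A.erase x) σ) * (ib (Hit σ (A.erase x) R y) * Ψ (x :: pl σ (A.erase x) y) σ))) x := by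
  rw [← Su_av hxU]
  · congr 1; ext σ
    rw [← mul_assoc, ← ib_and, ib_iff (ac_iff hx hR), ib_and, pl_in hx, mul_assoc]
  · intro y σ e
    have h := upd_ag (σ := σ) (e := e) (Finset.notMem_erase x A)
    rw [ib_iff (ac_loc h), ib_iff (Hit.loc_iff h), pl_loc h, hΨ]
lemma ib_ac (A : Finset (V d)) (σ : V d → E d) (x : V d) : ib (ac A σ) * ib (Hit σ A {y | y ∉ A} x) = ib (ac A σ) := by
  by_cases h : ac A σ
  · rw [ib_true (h x), mul_one]
  · rw [ib_false h, zero_mul]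
lemma count (A : Finset (V d)) : A ⊆ U → (0 < NN U A ∧ (∀ x ∈ A, NN U (A.erase x) = NN U A * gr A x x) ∧
    ∀ (R : Set (V d)) x, (∀ y ∈ R, y ∉ A) → Su U (fun σ => ib (ac A σ) * ib (Hit σ A R x)) = NN U A * hm A R x) := by
  induction A using Finset.strongInduction with
  | H A ih =>
  intro hU
  have off : ∀ (R : Set (V d)) x, x ∉ A → Su U (fun σ => ib (ac A σ) * ib (Hit σ A R x)) = NN U A * hm A R x := fun R x hx => by
    have : ∀ σ, ib (Hit σ A R x) = ind R x := fun σ => by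
      by_cases h : x ∈ R
      · rw [ind_mem h, ib_true (.base x hx h)]
      · rw [ind_not h, ib_false]
        intro h'
        cases h' with
        | base _ _ h2 => exact h h2
        | step _ h2 _ => exact hx h2
    simp only [this, NN, Su, ← sum_mul, hm_off hx]
  have on : ∀ (R : Set (V d)), (∀ y ∈ R, y ∉ A) → ∀ x ∈ A, Su U (fun σ => ib (ac A σ) * ib (Hit σ A R x)) = NN U (A.erase x) * av (hm (A.erase x) R) x := by
    intro R hR x hx
    have h1 := Su_step (U := U) hx (hU hx) hR (fun _ _ => 1) (fun _ _ _ => rfl)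
    simp only [mul_one] at h1
    rw [h1, mul_comm, ← av_mul_right]
    refine av_congr fun e => ?_
    rw [((ih _ (erase_ssubset hx)) ((erase_subset _ _).trans hU)).2.2 R _ fun y hy h => hR y hy (mem_of_mem_erase h), mul_comm]
  have g : ∀ x ∈ A, NN U (A.erase x) = NN U A * gr A x x := by
    intro x hx
    have h1 := on {y | y ∉ A} (fun y hy => hy) x hx
    simp only [ib_ac] at h1
    have h2 : hm A {y | y ∉ A} x = 1 := mp_eq A _ (fun _ => 1) (fun x hx => by rw [hm_lap hx, lap_const]) (fun y hy => by rw [hm_off hy]; exact ind_mem hy) x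
    rw [hm_erase (R := {y | y ∉ A}) hx (fun h => h hx)] at h2
    have h3 : NN U A = NN U (A.erase x) * av (hm (A.erase x) {y | y ∉ A}) x := h1
    rw [h3]; linear_combination -(NN U (A.erase x)) * h2
  refine ⟨?_, g, fun R x hR => ?_⟩
  · rcases A.eq_empty_or_nonempty with rfl | ⟨x, hx⟩
    · have : ∀ σ : V d → E d, ac ∅ σ := fun σ x => .base x (by simp) (by simp)
      simp only [NN, ib_true (this _), Su]; have := dpos (d := d); simp; positivity
    · have h1 := ((ih _ (erase_ssubset hx)) ((erase_subset _ _).trans hU)).1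
      rw [g x hx] at h1
      exact pos_of_mul_pos_left h1 (gr_nonneg _ _ _)
  · by_cases hx : x ∈ A
    · rw [on R hR x hx, g x hx, hm_erase hx (fun h => hR x h hx)]; ring
    · exact off R x hx
section mean
variable {A : Finset (V d)}
lemma NN_pos (hU : A ⊆ U) : 0 < NN U A := (count A hU).1
lemma mean_mono' {F G : (V d → E d) → ℝ} (h : ∀ σ, ac A σ → F σ ≤ G σ) : mean U A F ≤ mean U A G := by
  unfold mean
  refine div_le_div_of_nonneg_right (Su_mono fun σ => ?_) (sum_nonneg fun _ _ => ib_nonneg _)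
  by_cases hσ : ac A σ
  · exact mul_le_mul_of_nonneg_left (h σ hσ) (ib_nonneg _)
  · rw [ib_false hσ]; simp
lemma mean_mono {F G : (V d → E d) → ℝ} (h : ∀ σ, F σ ≤ G σ) : mean U A F ≤ mean U A G := mean_mono' fun σ _ => h σ
lemma mean_congr {F G : (V d → E d) → ℝ} (h : ∀ σ, ac A σ → F σ = G σ) : mean U A F = mean U A G :=
  le_antisymm (mean_mono' fun σ hσ => (h σ hσ).le) (mean_mono' fun σ hσ => (h σ hσ).ge)
lemma mean_lin (a b : ℝ) (F G : (V d → E d) → ℝ) : mean U A (fun σ => a * F σ + b * G σ) = a * mean U A F + b * mean U A G := by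
  unfold mean Su; rw [← mul_div_assoc, ← mul_div_assoc, ← add_div, mul_sum, mul_sum, ← sum_add_distrib]
  congr 1; exact sum_congr rfl fun σ _ => by ring
lemma mean_sum {ι : Type*} (s : Finset ι) (F : ι → (V d → E d) → ℝ) : mean U A (fun σ => ∑ i ∈ s, F i σ) = ∑ i ∈ s, mean U A (F i) := by
  unfold mean Su; rw [← sum_div, sum_comm]; congr 1
  exact sum_congr rfl fun σ _ => mul_sum _ _ _
lemma mean_one (hU : A ⊆ U) : mean U A (fun _ => 1) = 1 := by
  unfold mean; simp only [mul_one]; exact div_self (NN_pos hU).ne'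
lemma mean_nonneg {F : (V d → E d) → ℝ} (h : ∀ σ, 0 ≤ F σ) : 0 ≤ mean U A F :=
  div_nonneg (sum_nonneg fun _ _ => mul_nonneg (ib_nonneg _) (h _)) (sum_nonneg fun _ _ => ib_nonneg _)
lemma mean_hit (hU : A ⊆ U) {R : Set (V d)} (hR : ∀ y ∈ R, y ∉ A) (x : V d) : mean U A (fun σ => ib (Hit σ A R x)) = hm A R x := by
  rw [mean, (count A hU).2.2 R x hR, mul_div_cancel_left₀ _ (NN_pos hU).ne']
end mean
lemma reveal (A : Finset (V d)) (x : V d) : A ⊆ U → ∀ (R : Set (V d)), (∀ y ∈ R, y ∉ A) → ∀ (Ψ : List (V d) → (V d → E d) → ℝ),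
    (∀ l σ τ, (∀ y, y ∉ l → σ y = τ y) → Ψ l σ = Ψ l τ) →
    mean U A (fun σ => ib (Hit σ A R x) * Ψ (pl σ A x) σ) = LW R A x (fun l => mean U (A \ l.toFinset) (Ψ l)) := by
  refine ind_er (P := fun A x => A ⊆ U → ∀ (R : Set (V d)), (∀ y ∈ R, y ∉ A) → ∀ (Ψ : List (V d) → (V d → E d) → ℝ),
    (∀ l σ τ, (∀ y, y ∉ l → σ y = τ y) → Ψ l σ = Ψ l τ) →
    mean U A (fun σ => ib (Hit σ A R x) * Ψ (pl σ A x) σ) = LW R A x (fun l => mean U (A \ l.toFinset) (Ψ l))) ?_ ?_ A x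
  · intro A x hx hU R hR Ψ hΨ
    rw [LW_off hx, ← add_zero (_ * _), ← zero_mul (mean U A fun _ => 0)]
    simp only [List.toFinset_nil, Finset.sdiff_empty]
    rw [← mean_lin]
    refine mean_congr fun σ _ => ?_
    rw [pl_off hx, mul_zero, add_zero]; congr 1
    by_cases h : x ∈ R
    · rw [ind_mem h, ib_true (.base x hx h)]
    · rw [ind_not h, ib_false]
      intro h'
      cases h' with
      | base _ _ h2 => exact h h2
      | step _ h2 _ => exact hx h2
  · intro A x hx ih hU R hR Ψ hΨ
    have hU' := (erase_subset x A).trans hU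
    rw [mean, Su_step hx (hU hx) hR Ψ fun l σ e => hΨ _ _ _ fun y hy => Function.update_of_ne (fun h => hy (by simp [h])) _ _, LW_in hx]
    have h1 := (count A hU).2.1 x hx
    have h2 := NN_pos hU
    rw [div_eq_iff h2.ne', mul_right_comm, mul_comm (gr _ _ _), ← h1, mul_comm, ← av_mul_right]
    refine av_congr fun e => ?_
    have h3 := ih (nb x e) hU' R (fun y hy h => hR y hy (mem_of_mem_erase h)) (fun l => Ψ (x :: l)) (fun l σ τ h => hΨ _ _ _ fun y hy => h y fun h' => hy (List.mem_cons_of_mem _ h'))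
    have h4 : ∀ l : List (V d), A \ (x :: l).toFinset = A.erase x \ l.toFinset := fun l => by ext y; simp; tauto
    simp only [h4]
    rw [← h3, mean, div_mul_cancel₀ _ (NN_pos hU').ne']
end

section
variable [hd : Fact (5 ≤ d)]
variable {U : Finset (V d)}
lemma hm_compl (A : Finset (V d)) (x : V d) : hm A {y | y ∉ A} x = 1 :=
  mp_eq A _ (fun _ => 1) (fun x hx => by rw [hm_lap hx, lap_const]) (fun y hy => by rw [hm_off hy]; exact ind_mem hy) x
lemma dom (R : Set (V d)) (g : Set (V d) → ℝ) (g0 : ∀ C, 0 ≤ g C) (ga : ∀ C C', C ⊆ C' → g C' ≤ g C) (A : Finset (V d)) : A ⊆ U →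
    (∀ y ∈ R, y ∉ A) → ∀ B ⊆ A, ∀ A' ⊆ A, mean U A (fun σ => g {x | Hit σ B R x}) ≤ mean U A' (fun σ => g {x | Hit σ (B ∩ A') R x}) := by
  induction A using Finset.strongInduction with
  | H A ih =>
  intro hU hR B hB A' hA'
  by_cases hs : A ⊆ A'
  · rw [Finset.Subset.antisymm hA' hs, Finset.inter_eq_left.mpr hB]
  obtain ⟨v, hv, hvA'⟩ := Finset.not_subset.mp hs
  have hU' := (erase_subset v A).trans hU
  have hR' : ∀ y ∈ R, y ∉ A.erase v := fun y hy h => hR y hy (mem_of_mem_erase h)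
  have hBB : B.erase v ⊆ A.erase v := Finset.erase_subset_erase v hB
  have IH := ih _ (erase_ssubset hv) hU' hR' (B.erase v) hBB
  have h1 := IH A' (fun y hy => mem_erase.mpr ⟨fun h => hvA' (h ▸ hy), hA' hy⟩)
  have h2 : B.erase v ∩ A' = B ∩ A' := by ext y; simp only [mem_inter, mem_erase]; constructor <;> rintro h <;> refine ⟨?_, h.2⟩ <;> [exact h.1.2; exact ⟨fun h' => hvA' (h' ▸ h.2), h.1⟩]
  rw [h2] at h1
  refine le_trans ?_ h1
  set m := mean U (A.erase v) (fun σ => g {x | Hit σ (B.erase v) R x}) with hm'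
  have st := Su_step (U := U) hv (hU hv) (R := {y | y ∉ A}) (fun y hy => hy) (fun _ σ => g {x | Hit σ (B.erase v) R x}) (fun _ σ e => by
    simp only [Hit.loc_iff (upd_ag (σ := σ) (e := e) (Finset.notMem_erase v B))])
  simp only [← mul_assoc, ib_ac] at st
  rw [mean, div_le_iff₀ (NN_pos hU)]
  refine le_trans (Su_mono (G := fun σ => ib (ac A σ) * g {x | Hit σ (B.erase v) R x}) fun σ => mul_le_mul_of_nonneg_left (ga _ _ fun x hx => ?_) (ib_nonneg _)) ?_
  · exact Hit.mono hx (erase_subset _ _) fun y hy h => hR y hy (hB h)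
  rw [st]
  have c1 := (count A hU).2.1 v hv
  have c2 := hm_compl A v
  rw [hm_erase (R := {y | y ∉ A}) hv (fun h => h hv)] at c2
  have c3 : m * NN U A = av (fun y => hm (A.erase v) {y | y ∉ A} y * (m * NN U (A.erase v))) v := by
    rw [av_mul_right, c1]; linear_combination -(m * NN U A) * c2
  rw [c3]
  refine av_mono fun e => ?_
  set y := nb v e
  rw [← mul_assoc]
  simp only [mul_assoc (ib (ac _ _))]
  rw [← div_le_iff₀ (NN_pos hU')]
  change mean U (A.erase v) (fun σ => ib (Hit σ (A.erase v) {y | y ∉ A} y) * g {x | Hit σ (B.erase v) R x}) ≤ _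
  have hvR : ∀ y ∈ ({v} : Set (V d)), y ∉ A.erase v := by rintro _ rfl; simp
  have k1 : hm (A.erase v) {v} y * m ≤ mean U (A.erase v) (fun σ => ib (Hit σ (A.erase v) {v} y) * g {x | Hit σ (B.erase v) R x}) := by
    have r := reveal (U := U) (A.erase v) y hU' {v} hvR (fun l σ => g {x | Hit σ (B.erase v \ l.toFinset) R x}) (fun l σ τ h => by
      simp only [Hit.loc_iff (σ := σ) (τ := τ) (A := B.erase v \ l.toFinset) (fun y hy => h y (by simp at hy; exact hy.2))])
    refine le_trans (le_trans ?_ r.ge) (mean_mono fun σ => ?_)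
    · rw [mul_comm, ← LW_one _ _ _ hvR, ← LW_smul]
      refine LW_mono _ _ _ fun l => ?_
      have := IH (A.erase v \ l.toFinset) sdiff_subset
      have e1 : B.erase v ∩ (A.erase v \ l.toFinset) = B.erase v \ l.toFinset := by
        rw [← Finset.inter_sdiff_assoc, Finset.inter_eq_left.mpr hBB]
      rw [e1] at this; rw [mul_one]; exact this
    · by_cases h : Hit σ (A.erase v) {v} y
      · refine mul_le_mul_of_nonneg_left (ga _ _ fun x hx => ?_) (ib_nonneg _)
        exact Hit.avoid (by simp) (fun h => hR v h hv) hR' hBB h hx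
      · simp [ib_false h]
  have id1 : ∀ σ, ac (A.erase v) σ → ib (Hit σ (A.erase v) {y | y ∉ A} y) = 1 - ib (Hit σ (A.erase v) {v} y) := fun σ hσ => by
    by_cases h : Hit σ (A.erase v) {v} y
    · rw [ib_true h, ib_false, sub_self]
      intro h'; obtain ⟨w, rfl, h3⟩ := h.det h'; exact h3 hv
    · rw [ib_false h, ib_true, sub_zero]
      obtain h3 := (hσ y).tr (R := {y | y ∉ A} ∪ {v}) le_rfl fun z h1 _ => .base z h1 (by
        by_cases hz : z = v
        · exact .inr hz
        · exact .inl fun h => h1 (mem_erase.mpr ⟨hz, h⟩))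
      clear k1 st
      clear_value y
      clear hσ c3
      induction h3 with
      | base x h1 h2 =>
        rcases h2 with h2 | h2
        · exact .base x h1 h2
        · exact absurd (.base x h1 h2) h
      | step x h1 _ ih => exact .step x h1 (ih fun h' => h (.step x h1 h'))
  have e1 : hm (A.erase v) {y | y ∉ A} y = 1 - hm (A.erase v) {v} y := by
    rw [← mean_hit hU' (R := {y | y ∉ A}) (fun y hy h => hy (mem_of_mem_erase h)), ← mean_hit hU' hvR, mean_congr id1]
    have := mean_lin (U := U) (A := A.erase v) 1 (-1) (fun _ => 1) (fun σ => ib (Hit σ (A.erase v) {v} y))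
    rw [mean_one hU'] at this
    simpa [sub_eq_add_neg] using this
  have e2 := mean_lin (U := U) (A := A.erase v) 1 (-1) (fun σ => g {x | Hit σ (B.erase v) R x}) (fun σ => ib (Hit σ (A.erase v) {v} y) * g {x | Hit σ (B.erase v) R x})
  rw [e1, mean_congr (G := fun σ => 1 * g {x | Hit σ (B.erase v) R x} + -1 * (ib (Hit σ (A.erase v) {v} y) * g {x | Hit σ (B.erase v) R x})) (fun σ hσ => by rw [id1 σ hσ]; ring), e2]
  linarith
end

section
variable [hd : Fact (5 ≤ d)]
variable {U : Finset (V d)}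
lemma pair2 {A : Finset (V d)} (hU : A ⊆ U) {R : Set (V d)} (hR : ∀ y ∈ R, y ∉ A) (x y : V d) :
    mean U A (fun σ => ib (Hit σ A R x) * ib (Hit σ A R y)) ≤ hm A R x * hm A R y + ∑ v ∈ A, gr A v y * (gr A v x * hm A R v) := by
  have r := reveal (U := U) A x hU R hR (fun l σ => ib (Hit σ (A \ l.toFinset) (R ∪ {v | v ∈ l}) y)) (fun l σ τ h =>
    ib_iff (Hit.loc_iff fun y hy => h y (by simp at hy; exact hy.2)))
  refine le_trans (mean_mono fun σ => mul_le_mul_of_nonneg_left (ib_mono fun h => ?_) (ib_nonneg _)) (r.le.trans ?_)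
  · exact h.cut sdiff_subset (fun y hy hy' => .inr (by simpa [hy] using hy')) Set.subset_union_left
  have h1 : ∀ l : List (V d), (∀ v ∈ l, v ∈ A) → mean U (A \ l.toFinset) (fun σ => ib (Hit σ (A \ l.toFinset) (R ∪ {v | v ∈ l}) y)) ≤
      hm A R y * 1 + ∑ v ∈ A, gr A v y * ib (v ∈ l) := by
    intro l hl
    rw [mean_hit (sdiff_subset.trans hU) (by rintro z (h | h) <;> simp; exacts [fun h' => absurd h' (hR z h), fun _ => h])]
    have e1 : hm A R y * 1 + ∑ v ∈ A, gr A v y * ib (v ∈ l) = (hm A R + ∑ v ∈ A, ib (v ∈ l) • gr A v) y := by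
      simp [Finset.sum_apply, mul_comm]
    rw [e1]
    have nn : ∀ (T : Finset (V d)) z, 0 ≤ (∑ v ∈ T, ib (v ∈ l) • gr A v) z := fun T z => by
      rw [Finset.sum_apply]; exact sum_nonneg fun v _ => mul_nonneg (ib_nonneg _) (gr_nonneg _ _ _)
    refine hm_le_of (fun z hz => ?_) (fun z hz => ?_) y
    · have hzA := (mem_sdiff.mp hz).1
      simp only [map_add, map_sum, map_smul, Pi.add_apply, Finset.sum_apply, Pi.smul_apply, hm_lap hzA, gr_lap hzA, zero_add]
      exact sum_nonneg fun v _ => mul_nonneg (ib_nonneg _) (ind_nonneg _ _)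
    · rw [Pi.add_apply]
      by_cases h : z ∈ l
      · have h2 : gr A z z ≤ (∑ v ∈ A, ib (v ∈ l) • gr A v) z := by
          rw [Finset.sum_apply]
          have := single_le_sum (f := fun v => (ib (v ∈ l) • gr A v) z) (fun v _ => mul_nonneg (ib_nonneg _) (gr_nonneg _ _ _)) (hl z h)
          simpa [ib_true h] using this
        linarith [ind_le (R ∪ {v | v ∈ l}) z, gr_self_ge (hl z h), hm_nonneg A R z]
      · have hzA : z ∉ A := fun hh => hz (by simp [hh, h])
        rw [hm_off hzA]
        have : ind (R ∪ {v | v ∈ l}) z = ind R z := by simp [ind, h]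
        linarith [nn A z]
  refine (LW_mono' _ _ _ h1).trans ?_
  rw [LW_add, LW_smul, LW_one _ _ _ hR, LW_sum, mul_comm]
  refine add_le_add_right (sum_le_sum fun v _ => ?_) _
  rw [LW_smul]
  exact mul_le_mul_of_nonneg_left (LW_pt _ _ _ _ hR) (gr_nonneg _ _ _)
noncomputable def Yn (σ : V d → E d) (A B : Finset (V d)) (R : Set (V d)) : ℝ := ∑ x ∈ B, ib (Hit σ A R x)
lemma pz {B Γ : Finset (V d)} (hU : B \ Γ ⊆ U) {ζ C c0 : ℝ} (hζ : 0 < ζ) (h1 : ζ ≤ Zb B Γ) (hc : 0 ≤ c0) (hC : C ^ 2 ≤ c0 * ζ)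
    (hg : ∀ v, ∑ x ∈ B, gr (B \ Γ) v x ≤ C) : 1 / (4 * (1 + c0)) ≤ mean U (B \ Γ) (fun σ => ib (ζ / 2 ≤ Yn σ (B \ Γ) B Γ)) := by
  set A := B \ Γ with hA
  set Z := Zb B Γ with hZ
  have hZ0 : 0 < Z := hζ.trans_le h1
  have hR : ∀ y ∈ (Γ : Set (V d)), y ∉ A := fun y hy h => (mem_sdiff.mp h).2 hy
  have m1 : mean U A (fun σ => Yn σ A B Γ) = Z := by
    unfold Yn; rw [mean_sum]; exact sum_congr rfl fun x _ => mean_hit hU hR x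
  have m2 : mean U A (fun σ => Yn σ A B Γ ^ 2) ≤ Z ^ 2 * (1 + c0) := by
    have e1 : ∀ σ, Yn σ A B Γ ^ 2 = ∑ x ∈ B, ∑ y ∈ B, ib (Hit σ A Γ x) * ib (Hit σ A Γ y) := fun σ => by
      unfold Yn; rw [sq, sum_mul_sum]
    simp only [e1]; rw [mean_sum]; simp only [mean_sum]
    refine (sum_le_sum fun x _ => sum_le_sum fun y _ => pair2 hU hR x y).trans ?_
    simp only [sum_add_distrib]
    have e2 : ∑ x ∈ B, ∑ y ∈ B, hm A Γ x * hm A Γ y = Z ^ 2 := by rw [← sum_mul_sum, sq]; rfl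
    have e3 : ∑ x ∈ B, ∑ y ∈ B, ∑ v ∈ A, gr A v y * (gr A v x * hm A Γ v) = ∑ v ∈ A, (∑ x ∈ B, gr A v x) ^ 2 * hm A Γ v := by
      rw [sum_comm]
      conv_lhs => enter [2, y]; rw [sum_comm]
      rw [sum_comm]
      refine sum_congr rfl fun v _ => ?_
      rw [sq, sum_mul_sum, sum_mul]
      refine sum_congr rfl fun y _ => ?_
      rw [sum_mul]; exact sum_congr rfl fun x _ => by ring
    rw [e2, e3]
    have e4 : ∑ v ∈ A, (∑ x ∈ B, gr A v x) ^ 2 * hm A Γ v ≤ C ^ 2 * Z := by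
      calc _ ≤ ∑ v ∈ A, C ^ 2 * hm A Γ v := sum_le_sum fun v _ => mul_le_mul_of_nonneg_right
            (pow_le_pow_left₀ (sum_nonneg fun x _ => gr_nonneg _ _ _) (hg v) 2) (hm_nonneg _ _ _)
        _ ≤ ∑ v ∈ B, C ^ 2 * hm A Γ v := sum_le_sum_of_subset_of_nonneg sdiff_subset fun v _ _ => mul_nonneg (sq_nonneg _) (hm_nonneg _ _ _)
        _ = _ := by rw [← mul_sum]; rfl
    nlinarith [mul_le_mul_of_nonneg_left h1 hc]
  set κ := 1 + c0
  have hκ : 0 < κ := by positivity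
  have h2 : ∀ σ, (1 / (κ * Z)) * Yn σ A B Γ + (-1) * ((1 / (2 * κ)) * 1 + (1 / (2 * κ * Z) ^ 2) * Yn σ A B Γ ^ 2) ≤ ib (ζ / 2 ≤ Yn σ A B Γ) := by
    intro σ
    set Y := Yn σ A B Γ
    have e1 : (1 / (κ * Z)) * Y + (-1) * ((1 / (2 * κ)) * 1 + (1 / (2 * κ * Z) ^ 2) * Y ^ 2) = 1 - (1 - Y / (2 * κ * Z)) ^ 2 - 1 / (2 * κ) := by field_simp; ring
    by_cases h : ζ / 2 ≤ Y
    · rw [ib_true h, e1]; have : 0 < 1 / (2 * κ) := by positivity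
      nlinarith [sq_nonneg (1 - Y / (2 * κ * Z))]
    · rw [ib_false h]
      have h3 : (1 / (κ * Z)) * Y ≤ 1 / (2 * κ) := by
        rw [one_div_mul_eq_div, div_le_div_iff₀ (by positivity) (by positivity)]
        push Not at h; nlinarith
      have : 0 ≤ (1 / (2 * κ * Z) ^ 2) * Y ^ 2 := by positivity
      linarith
  refine le_trans ?_ (mean_mono h2)
  rw [mean_lin, mean_lin, mean_one hU, m1]
  have h4 : 1 / (2 * κ * Z) ^ 2 * mean U A (fun σ => Yn σ A B Γ ^ 2) ≤ 1 / (2 * κ * Z) ^ 2 * (Z ^ 2 * κ) := by gcongr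
  have e5 : 1 / (κ * Z) * Z - 1 / (2 * κ) - 1 / (2 * κ * Z) ^ 2 * (Z ^ 2 * κ) = 1 / (4 * κ) := by field_simp; norm_num
  linarith
lemma block2 {A1 A2 : Finset (V d)} (hU1 : A1 ⊆ U) (hU2 : A2 ⊆ U) (hdj : ∀ x ∈ A1, x ∉ A2) (hn : ∀ x ∈ A1, ∀ e, nb x e ∉ A2) (hn' : ∀ x ∈ A2, ∀ e, nb x e ∉ A1)
    {F1 F2 : (V d → E d) → ℝ} (h1 : ∀ σ τ, (∀ x ∈ A1, σ x = τ x) → F1 σ = F1 τ) (h2 : ∀ σ τ, (∀ x ∈ A2, σ x = τ x) → F2 σ = F2 τ) :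
    mean U (A1 ∪ A2) (fun σ => F1 σ * F2 σ) = mean U A1 F1 * mean U A2 F2 := by
  have ac2 : ∀ σ, ac (A1 ∪ A2) σ ↔ ac A1 σ ∧ ac A2 σ := fun σ => by
    refine ⟨fun h => ⟨h.anti Finset.subset_union_left, h.anti Finset.subset_union_right⟩, fun h x => ?_⟩
    have aux : ∀ {A A' : Finset (V d)}, (∀ x ∈ A, ∀ e, nb x e ∉ A') → ∀ x, Hit σ A {y | y ∉ A} x → x ∉ A' → Hit σ (A ∪ A') {y | y ∉ A ∪ A'} x := fun hh x hx => by
      induction hx with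
      | base x h1 h2 => exact fun h3 => .base x (by simp [h1, h3]) (by simp [h3]; exact h2)
      | step x h1 _ ih => exact fun _ => .step x (by simp [h1]) (ih (hh x h1 _))
    by_cases hx : x ∈ A2
    · rw [Finset.union_comm]; exact aux hn' x (h.2 x) (fun h' => hdj x h' hx)
    · exact aux hn x (h.1 x) hx
  have S : ∀ F1 F2 : (V d → E d) → ℝ, (∀ σ τ, (∀ x ∈ A1, σ x = τ x) → F1 σ = F1 τ) → (∀ σ τ, (∀ x ∈ A2, σ x = τ x) → F2 σ = F2 τ) →
      Su U (fun σ => ib (ac (A1 ∪ A2) σ) * (F1 σ * F2 σ)) * Su U (fun _ => 1) = Su U (fun σ => ib (ac A1 σ) * F1 σ) * Su U (fun σ => ib (ac A2 σ) * F2 σ) := by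
    intro F1 F2 h1 h2
    have := Su_ind (U := U) A1 (F := fun σ => ib (ac A1 σ) * F1 σ) (G := fun σ => ib (ac A2 σ) * F2 σ) (fun σ τ h => by
      simp only [h1 σ τ h, ib_iff (ac_loc h)]) (fun σ τ h => by
      have : ∀ x ∈ A2, σ x = τ x := fun x hx => h x fun h' => hdj x h' hx
      simp only [h2 σ τ this, ib_iff (ac_loc this)])
    rw [← this]
    congr 2; ext σ; rw [ib_iff (ac2 σ), ib_and]; ring
  have s1 := S F1 F2 h1 h2
  have s2 := S (fun _ => 1) (fun _ => 1) (fun _ _ _ => rfl) (fun _ _ _ => rfl)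
  simp only [mul_one] at s2
  change NN U (A1 ∪ A2) * _ = NN U A1 * NN U A2 at s2
  have p1 := NN_pos hU1
  have p2 := NN_pos hU2
  have p3 := NN_pos (Finset.union_subset hU1 hU2)
  have p4 : Su U (fun _ => 1) ≠ 0 := fun h => by rw [h, mul_zero] at s2; exact (mul_pos p1 p2).ne s2
  unfold mean
  rw [div_mul_div_comm, ← s1, ← s2, mul_div_mul_right _ _ p4]
lemma blocks (k : ℕ) (S : ℕ → Finset (V d)) (hU : ∀ j < k, S j ⊆ U) (b : ℕ → ℕ) (hb : ∀ j < k, S j ⊆ Q 0 (b (j + 1)) \ Q 0 (b j + 1)) (bm : Monotone b)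
    (F : ℕ → (V d → E d) → ℝ) (hF : ∀ j < k, ∀ σ τ, (∀ x ∈ S j, σ x = τ x) → F j σ = F j τ) :
    mean U ((Finset.range k).biUnion S) (fun σ => ∏ j ∈ Finset.range k, F j σ) = ∏ j ∈ Finset.range k, mean U (S j) (F j) := by
  induction k with
  | zero => simp [mean_one]
  | succ k ih =>
    have h1 : (Finset.range k).biUnion S ⊆ Q 0 (b k) := biUnion_subset.mpr fun j hj => by
      have := mem_range.mp hj
      exact ((hb j (by omega)).trans sdiff_subset).trans (Q_mono _ (bm (by omega)))
    have h2 : ∀ x ∈ S k, x ∉ Q (0 : V d) (b k + 1) := fun x hx => (mem_sdiff.mp (hb k (by omega) hx)).2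
    rw [Finset.prod_range_succ, ← ih (fun j hj => hU j (by omega)) (fun j hj => hb j (by omega)) (fun j hj => hF j (by omega)), Finset.range_add_one, Finset.biUnion_insert, Finset.union_comm, ← block2]
    · simp only [← Finset.range_add_one, Finset.prod_range_succ]
    · exact biUnion_subset.mpr fun j hj => hU j (by have := mem_range.mp hj; omega)
    · exact hU k (by omega)
    · exact fun x hx hx' => h2 x hx' (Q_mono _ (by omega) (h1 hx))
    · exact fun x hx e hx' => h2 _ hx' (nb_mem_Q e (h1 hx))
    · intro x hx e hx'
      exact h2 x hx (nb_inv x e ▸ nb_mem_Q (e.1, !e.2) (h1 hx'))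
    · intro σ τ h
      refine prod_congr rfl fun j hj => hF j (by have := mem_range.mp hj; omega) σ τ fun x hx => h x ?_
      exact Finset.mem_biUnion.mpr ⟨j, hj, hx⟩
    · exact hF k (by omega)
end

section
variable [hd : Fact (5 ≤ d)]
variable {U : Finset (V d)}
def inSh (s j : ℕ) (z : V d) : Prop := Q z (rho d s) ⊆ Q 0 (ms d s (j + 1)) \ Q 0 (ms d s j + 1)
def Suc (a : ℝ) (s j : ℕ) (A Γ : Finset (V d)) (σ : V d → E d) : Prop :=
  ∃ z, inSh s j z ∧ a * (s : ℝ) ^ 4 / 2 ≤ Yn σ (A \ Γ) (Q z (rho d s)) Γ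
lemma ms_mono (s : ℕ) : Monotone (ms d s) := fun _ _ h => Nat.mul_le_mul_right _ h
lemma inner {a c0 : ℝ} (ha : 0 < a) (hc0 : 0 ≤ c0) {s : ℕ} (hs : 1 ≤ s) (hC : (Cg d * (64 * 8 ^ d * (rho d s : ℝ) ^ 2)) ^ 2 ≤ c0 * (a * (s : ℝ) ^ 4))
    (k : ℕ) {A0 : Finset (V d)} (hU : A0 ⊆ U) (hB : Q 0 (ms d s k) ⊆ A0) (Γ : Finset (V d)) :
    mean U (A0 \ Γ) (fun σ => ∏ j ∈ Finset.range k, (1 - 1 / 2 * ib (Suc a s j (Q 0 (ms d s k)) Γ σ))) ≤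
      ∏ j ∈ Finset.range k, ph a (1 / 2 * (1 / (4 * (1 + c0)))) s j Γ := by
  have hz : ∀ j, ∃ z : V d, good a s j Γ → (inSh s j z ∧ a * (s : ℝ) ^ 4 ≤ Zb (Q z (rho d s)) Γ) := fun j => by
    by_cases h : good a s j Γ
    · obtain ⟨z, h1, h2⟩ := h; exact ⟨z, fun _ => ⟨h1, h2⟩⟩
    · exact ⟨0, fun h' => absurd h' h⟩
  choose z hz using hz
  set S : ℕ → Finset (V d) := fun j => if good a s j Γ then Q (z j) (rho d s) \ Γ else ∅ with hS
  set B := Q (0 : V d) (ms d s k) \ Γ with hBd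
  set A' := (Finset.range k).biUnion S
  have hSb : ∀ j, S j ⊆ Q 0 (ms d s (j + 1)) \ Q 0 (ms d s j + 1) := fun j => by
    simp only [hS]; split_ifs with h
    · exact sdiff_subset.trans (hz j h).1
    · simp
  have hSB : ∀ j < k, S j ⊆ B := fun j hj x hx => by
    refine mem_sdiff.mpr ⟨Q_mono _ (ms_mono s (by omega : j + 1 ≤ k)) (mem_sdiff.mp (hSb j hx)).1, ?_⟩
    simp only [hS] at hx; split_ifs at hx with h
    · exact (mem_sdiff.mp hx).2
    · simp at hx
  have hA'B : A' ⊆ B := biUnion_subset.mpr fun j hj => hSB j (mem_range.mp hj)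
  have hBA : B ⊆ A0 \ Γ := Finset.sdiff_subset_sdiff hB le_rfl
  set gg : Set (V d) → ℕ → ℝ := fun C j => 1 - 1 / 2 * ib (∃ z, inSh s j z ∧ a * (s : ℝ) ^ 4 / 2 ≤ ∑ x ∈ Q z (rho d s), ib (x ∈ C)) with hgg
  have gg0 : ∀ C j, 0 ≤ gg C j := fun C j => by
    have := ib_le (∃ z, inSh s j z ∧ a * (s : ℝ) ^ 4 / 2 ≤ ∑ x ∈ Q z (rho d s), ib (x ∈ C)); simp only [hgg]; linarith
  have gga : ∀ C C' j, C ⊆ C' → gg C' j ≤ gg C j := fun C C' j h => by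
    simp only [hgg]
    refine sub_le_sub_left (mul_le_mul_of_nonneg_left (ib_mono ?_) (by norm_num)) _
    rintro ⟨z, h1, h2⟩
    exact ⟨z, h1, h2.trans (sum_le_sum fun x _ => ib_mono fun hx => h hx)⟩
  have D := dom (U := U) (Γ : Set (V d)) (fun C => ∏ j ∈ Finset.range k, gg C j) (fun C => Finset.prod_nonneg fun j _ => gg0 C j)
    (fun C C' h => prod_le_prod (fun j _ => gg0 C' j) fun j _ => gga C C' j h) (A0 \ Γ) (sdiff_subset.trans hU)
    (fun y hy h => (mem_sdiff.mp h).2 hy) B hBA A' (hA'B.trans hBA)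
  rw [Finset.inter_eq_right.mpr hA'B] at D
  refine le_trans (le_of_eq ?_) (D.trans ?_)
  · rfl
  set F : ℕ → (V d → E d) → ℝ := fun j σ => if good a s j Γ then 1 - 1 / 2 * ib (a * (s : ℝ) ^ 4 / 2 ≤ Yn σ (Q (z j) (rho d s) \ Γ) (Q (z j) (rho d s)) Γ) else 1 with hF
  have h1 : mean U A' (fun σ => ∏ j ∈ Finset.range k, gg {x | Hit σ A' Γ x} j) ≤ mean U A' (fun σ => ∏ j ∈ Finset.range k, F j σ) := by
    refine mean_mono fun σ => prod_le_prod (fun j _ => gg0 _ j) fun j hj => ?_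
    simp only [hF]; split_ifs with h
    · refine sub_le_sub_left (mul_le_mul_of_nonneg_left (ib_mono fun h2 => ?_) (by norm_num)) _
      refine ⟨z j, (hz j h).1, h2.trans (sum_le_sum fun x _ => ib_mono fun hx => ?_)⟩
      refine Hit.mono hx (fun y hy => Finset.mem_biUnion.mpr ⟨j, hj, by simp only [hS, if_pos h]; exact hy⟩) fun y hy h3 => ?_
      exact (mem_sdiff.mp (hA'B h3)).2 hy
    · have := ib_nonneg (∃ z, inSh s j z ∧ a * (s : ℝ) ^ 4 / 2 ≤ ∑ x ∈ Q z (rho d s), ib (x ∈ {x | Hit σ A' Γ x})); simp only [hgg]; linarith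
  refine h1.trans ?_
  rw [blocks k S (fun j hj => (hSB j hj).trans (hBA.trans (sdiff_subset.trans hU))) (ms d s) (fun j _ => hSb j) (ms_mono s) F]
  · refine prod_le_prod (fun j _ => mean_nonneg fun σ => ?_) fun j hj => ?_
    · simp only [hF]; split_ifs
      · have := ib_le (a * (s : ℝ) ^ 4 / 2 ≤ Yn σ (Q (z j) (rho d s) \ Γ) (Q (z j) (rho d s)) Γ); linarith
      · norm_num
    · have hSU := (hSB j (mem_range.mp hj)).trans (hBA.trans (sdiff_subset.trans hU))
      by_cases h : good a s j Γ
      · simp only [hS, if_pos h] at hSU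
        simp only [hF, hS, if_pos h, ph, ib_true h]
        have s0 : (0 : ℝ) < s := by exact_mod_cast hs
        have hr : 1 ≤ rho d s := by unfold rho; nlinarith
        have := pz hSU (by positivity) (hz j h).2 hc0 hC fun v => by
          calc _ ≤ ∑ x ∈ Q (z j) (rho d s), Cg d * fp (x - v) := sum_le_sum fun x _ => gr_le _ _ _
            _ = Cg d * ∑ x ∈ Q (z j) (rho d s), fp (x - v) := by rw [mul_sum]
            _ ≤ _ := mul_le_mul_of_nonneg_left (sum_fp _ hr _ _) Cg_pos.le
        have e : mean U (Q (z j) (rho d s) \ Γ) (fun σ => 1 * 1 + (-(1 / 2)) * ib (a * (s : ℝ) ^ 4 / 2 ≤ Yn σ (Q (z j) (rho d s) \ Γ) (Q (z j) (rho d s)) Γ)) = _ := mean_lin 1 (-(1 / 2)) (fun _ => 1) _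
        rw [mean_one hSU] at e
        refine le_trans (le_of_eq ?_) (e.le.trans ?_)
        · congr 1; ext σ; ring
        · linarith
      · simp only [hF, hS, if_neg h, ph, ib_false h]
        rw [mean_one (by simp)]; simp
  · intro j _ σ τ h
    simp only [hF]; split_ifs with hg
    · simp only [hS, if_pos hg] at h
      have : Yn σ (Q (z j) (rho d s) \ Γ) (Q (z j) (rho d s)) Γ = Yn τ (Q (z j) (rho d s) \ Γ) (Q (z j) (rho d s)) Γ :=
        sum_congr rfl fun x _ => ib_iff (Hit.loc_iff h)
      rw [this]
    · rfl
lemma comb : ∃ a q : ℝ, 0 < a ∧ 0 < q ∧ q < 1 ∧ ∃ i0 : ℕ, ∀ (A0 : Finset (V d)) (N' N i k : ℕ), i0 ≤ i → Q 0 (4 * N) ⊆ A0 → La d * N' ≤ N →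
    4 * MM d * sc d i ≤ N' → ms d (sc d i) k + 1 ≤ N' →
    mean A0 A0 (fun σ => ∏ j ∈ Finset.range k, (1 - 1 / 2 * ib (Suc a (sc d i) j (Q 0 (ms d (sc d i) k)) (pl σ A0 0).toFinset σ))) ≤ q ^ k := by
  obtain ⟨a, p, ha, hp, hp1, i0, H⟩ := seq (d := d)
  set K := Cg d * (64 * 8 ^ d * (2 * M0 d + 1 : ℝ) ^ 2) with hK
  set c0 := K ^ 2 / a with hc0
  have c00 : 0 ≤ c0 := by positivity
  set α := 1 / 2 * (1 / (4 * (1 + c0))) with hα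
  have α0 : 0 < α := by positivity
  have α1 : α ≤ 1 / 8 := by
    rw [hα]; have : 1 / (4 * (1 + c0)) ≤ 1 / 4 := one_div_le_one_div_of_le (by norm_num) (by linarith)
    linarith
  have hαp : α * p ≤ 1 / 8 := by nlinarith
  refine ⟨a, 1 - α * p, ha, by linarith, by have := mul_pos α0 hp; linarith, i0, ?_⟩
  intro A0 N' N i k hi hA hN h4 hk
  refine le_trans ?_ (H α A0 N' N i k α0.le (by linarith) hi hA hN h4 hk)
  set s := sc d i
  have hR : ∀ y ∈ {x | x ∉ A0}, y ∉ A0 := fun y h => h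
  set Ψ : List (V d) → (V d → E d) → ℝ := fun l σ => ∏ j ∈ Finset.range k, (1 - 1 / 2 * ib (Suc a s j (Q 0 (ms d s k)) l.toFinset σ)) with hΨ
  have r := reveal (U := A0) A0 0 le_rfl {x | x ∉ A0} hR Ψ (fun l σ τ h => by
    simp only [hΨ]; refine prod_congr rfl fun j _ => ?_
    have : Suc a s j (Q 0 (ms d s k)) l.toFinset σ ↔ Suc a s j (Q 0 (ms d s k)) l.toFinset τ := by
      unfold Suc
      refine exists_congr fun z => and_congr_right fun _ => ?_
      have : Yn σ (Q 0 (ms d s k) \ l.toFinset) (Q z (rho d s)) l.toFinset = Yn τ (Q 0 (ms d s k) \ l.toFinset) (Q z (rho d s)) l.toFinset :=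
        sum_congr rfl fun x _ => ib_iff (Hit.loc_iff fun y hy => h y (by simpa using (mem_sdiff.mp hy).2))
      rw [this]
    rw [ib_iff this])
  refine le_trans (le_of_eq ?_) (r.le.trans ?_)
  · exact mean_congr fun σ h => by rw [ib_true (h 0), one_mul]
  · refine LW_mono _ _ _ fun l => ?_
    rw [← Finset.range_eq_Ico]
    refine inner ha c00 (sc_one i) ?_ k le_rfl ?_ _
    · have : c0 * (a * (s : ℝ) ^ 4) = (K * (s : ℝ) ^ 2) ^ 2 := by rw [hc0]; field_simp
      rw [this, hK]; apply le_of_eq; unfold rho; push_cast; ring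
    · refine (Q_mono _ ?_).trans hA
      have := La_ge (d := d); nlinarith
end

section
variable [hd : Fact (5 ≤ d)]
variable {U : Finset (V d)}
def ord (v w : V d) : List (V d) → Prop
  | [] => False
  | x :: l => (x = v ∧ w ∈ l) ∨ ord v w l
lemma ord_mem {v w : V d} : ∀ {l : List (V d)}, ord v w l → w ∈ l
  | _ :: _, .inl h => List.mem_cons_of_mem _ h.2
  | _ :: _, .inr h => List.mem_cons_of_mem _ (ord_mem h)
lemma LW_ord (R : Set (V d)) {v w : V d} (hvw : v ≠ w) (A : Finset (V d)) (x : V d) : (∀ y ∈ R, y ∉ A) →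
    LW R A x (fun l => ib (ord v w l)) ≤ gr A v x * gr A w v := by
  refine ind_er (P := fun A x => (∀ y ∈ R, y ∉ A) → LW R A x (fun l => ib (ord v w l)) ≤ gr A v x * gr A w v) ?_ ?_ A x
  · intro A x hx _
    rw [LW_off hx]; simp [ib, gr_off hx, ord]
  · intro A x hx ih hR
    have hR' : ∀ y ∈ R, y ∉ A.erase x := fun z hz h => hR z hz (mem_of_mem_erase h)
    rw [LW_in hx]
    by_cases hv : x = v
    · subst hv
      refine mul_le_mul_of_nonneg_left ?_ (gr_nonneg _ _ _)
      have h1 : av (fun y => LW R (A.erase x) y (fun l => ib (ord x w (x :: l)))) x ≤ av (gr (A.erase x) w) x := by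
        refine av_mono fun e => (LW_mono _ _ _ fun l => ib_mono (q := w ∈ l) fun h => h.elim (·.2) ord_mem).trans ?_
        exact (LW_pt R w _ _ hR').trans (mul_le_of_le_one_right (gr_nonneg _ _ _) (hm_le_one _ _ _))
      have h2 := gr_erase hx hvw
      have h3 : 0 ≤ av (gr (A.erase x) w) x := by
        have := av_mono (u := fun _ => 0) (v := gr (A.erase x) w) (x := x) (fun e => gr_nonneg _ _ _)
        rwa [av_const] at this
      nlinarith [gr_self_ge hx]
    · rw [gr_erase hx hv, mul_assoc]
      refine mul_le_mul_of_nonneg_left ?_ (gr_nonneg _ _ _)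
      rw [← av_mul_right]
      refine av_mono fun e => (LW_mono _ _ _ fun l => ib_mono (q := ord v w l) fun h => h.elim (fun h => absurd h.1 hv) id).trans ?_
      exact (ih _ hR').trans (mul_le_mul_of_nonneg_left (gr_mono (erase_subset _ _) _ _) (gr_nonneg _ _ _))
def bad (N M : ℕ) (l : List (V d)) : Prop := ∃ v ∈ Q (0 : V d) (M + 1) \ Q 0 M, ∃ w ∈ Q (0 : V d) N, ord v w l
lemma ret {A : Finset (V d)} {N M : ℕ} (hM : 2 * N ≤ M) :
    mean A A (fun σ => ib (bad N M (pl σ A 0))) ≤ Cg d ^ 2 * (6 * (2 * N + 1)) ^ d / (M + 1) := by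
  have hR : ∀ y ∈ {x | x ∉ A}, y ∉ A := fun y h => h
  have r := reveal (U := A) A 0 le_rfl {x | x ∉ A} hR (fun l _ => ib (bad N M l)) (fun _ _ _ _ => rfl)
  refine le_trans (le_of_eq (mean_congr fun σ h => by rw [ib_true (h 0), one_mul])) (r.le.trans ?_)
  set S := Q (0 : V d) (M + 1) \ Q 0 M
  have e1 : ∀ l : List (V d), mean A (A \ l.toFinset) (fun _ => ib (bad N M l)) ≤ ∑ v ∈ S, ∑ w ∈ Q 0 N, ib (ord v w l) := fun l => by
    have : mean A (A \ l.toFinset) (fun _ => ib (bad N M l) * 1 + 0 * 0) = _ := mean_lin (ib (bad N M l)) 0 (fun _ => 1) (fun _ => 0)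
    rw [mean_one sdiff_subset] at this
    simp only [mul_one, mul_zero, add_zero, zero_mul] at this
    rw [this]
    have nn : ∀ v ∈ S, 0 ≤ ∑ w ∈ Q 0 N, ib (ord v w l) := fun v _ => sum_nonneg fun _ _ => ib_nonneg _
    by_cases hb : bad N M l
    · obtain ⟨v, hv, w, hw, h⟩ := id hb
      rw [ib_true hb, ← ib_true h]
      exact (single_le_sum (f := fun w => ib (ord v w l)) (fun _ _ => ib_nonneg _) hw).trans
        (single_le_sum (f := fun v => ∑ w ∈ Q 0 N, ib (ord v w l)) nn hv)
    · rw [ib_false hb]; exact sum_nonneg nn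
  refine (LW_mono _ _ _ e1).trans ?_
  rw [LW_sum]; simp only [LW_sum]
  set m : ℝ := M + 1 with hm
  have m0 : 0 < m := by positivity
  have e2 : ∀ v ∈ S, ∀ w ∈ Q (0 : V d) N, LW {x | x ∉ A} A 0 (fun l => ib (ord v w l)) ≤ (Cg d * (1 / m ^ (d - 2))) * (Cg d * (2 ^ d / m ^ (d - 2))) := by
    intro v hv w hw
    have hv2 := (mem_sdiff.mp hv).2
    have hvw : v ≠ w := by rintro rfl; exact hv2 (Q_mono _ (by omega) hw)
    refine (LW_ord _ hvw A 0 hR).trans (mul_le_mul ?_ ?_ (gr_nonneg _ _ _) (by have := Cg_pos (d := d); positivity))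
    · refine (gr_le _ _ _).trans (mul_le_mul_of_nonneg_left ?_ Cg_pos.le)
      rw [fp_symm, sub_zero]; exact fp_le hv2
    · refine (gr_le _ _ _).trans (mul_le_mul_of_nonneg_left ?_ Cg_pos.le)
      have h3 : v - w ∉ Q 0 (M - N) := fun h => hv2 (by
        have := Q_tri (Q_sub.mpr h) hw; exact Q_mono _ (by omega) this)
      refine (fp_le h3).trans ?_
      have h4 : m / 2 ≤ ((M - N : ℕ) : ℝ) + 1 := by
        rw [Nat.cast_sub (by omega)]; have : (2 * N : ℝ) ≤ M := by exact_mod_cast hM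
        linarith
      calc _ ≤ 1 / (m / 2) ^ (d - 2) := by gcongr
        _ = 2 ^ (d - 2) / m ^ (d - 2) := by rw [div_pow]; field_simp
        _ ≤ _ := by gcongr <;> first | norm_num | omega
  refine (sum_le_sum fun v hv => sum_le_sum fun w hw => e2 v hv w hw).trans ?_
  simp only [sum_const, nsmul_eq_mul, card_Q]
  have hS : (S.card : ℝ) ≤ (3 * m) ^ d := by
    have : S.card ≤ (2 * (M + 1) + 1) ^ d := (Finset.card_le_card sdiff_subset).trans (card_Q _ _).le
    calc (S.card : ℝ) ≤ ((2 * (M + 1) + 1 : ℕ) : ℝ) ^ d := by exact_mod_cast this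
      _ ≤ _ := by gcongr; push_cast; rw [hm]; linarith [Nat.cast_nonneg (α := ℝ) M]
  have h5 := hd.out
  obtain ⟨n, rfl⟩ : ∃ n, d = n + 5 := ⟨d - 5, by omega⟩
  have cg := Cg_pos (d := n + 5)
  calc _ ≤ (3 * m) ^ (n + 5) * (((2 * N + 1 : ℕ) ^ (n + 5) : ℕ) * (Cg (n + 5) * (1 / m ^ (n + 3)) * (Cg (n + 5) * (2 ^ (n + 5) / m ^ (n + 3))))) := by
        exact mul_le_mul_of_nonneg_right hS (by positivity)
    _ = Cg (n + 5) ^ 2 * (6 * (2 * N + 1)) ^ (n + 5) / m * (1 / m ^ n) := by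
      have : (6 : ℝ) = 3 * 2 := by norm_num
      push_cast; rw [this, mul_pow, mul_pow, mul_pow]; field_simp; ring
    _ ≤ _ := by
      refine mul_le_of_le_one_right (by positivity) ?_
      rw [div_le_one (by positivity)]; exact one_le_pow₀ (by rw [hm]; linarith [Nat.cast_nonneg (α := ℝ) M])
def pr' (σ : V d → E d) (S : Set (V d)) (u v : V d) : Prop := u ∈ S ∧ v ∈ S ∧ v = nb u (σ u)
lemma pl_con {σ : V d → E d} {N M : ℕ} (hM : N ≤ M) {w : V d} (hw : w ∈ Q (0 : V d) N) {A0 : Finset (V d)} (A : Finset (V d)) (x : V d) : A ⊆ A0 → x ∈ Q (0 : V d) M → w ∈ pl σ A x →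
    ¬ bad N M (pl σ A x) → Relation.ReflTransGen (pr' σ {y | y ∈ A0 ∧ y ∈ Q (0 : V d) M}) x w := by
  refine ind_er (P := fun A x => A ⊆ A0 → x ∈ Q (0 : V d) M → w ∈ pl σ A x →
    ¬ bad N M (pl σ A x) → Relation.ReflTransGen (pr' σ {y | y ∈ A0 ∧ y ∈ Q (0 : V d) M}) x w) ?_ ?_ A x
  · intro A x hx _ _ h; simp [pl_off hx] at h
  · intro A x hx ih hA hxM h hb
    rw [pl_in hx] at h hb
    rcases List.mem_cons.mp h with rfl | h
    · exact .refl
    · set y := nb x (σ x) with hy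
      have hyA : y ∈ A.erase x := by
        by_contra hyA; simp [pl_off hyA] at h
      have hyM : y ∈ Q (0 : V d) M := by
        by_contra hyM
        refine hb ⟨y, mem_sdiff.mpr ⟨nb_mem_Q _ hxM, hyM⟩, w, hw, .inr ?_⟩
        rw [pl_in hyA] at h ⊢
        rcases List.mem_cons.mp h with rfl | h
        · exact absurd (Q_mono _ hM hw) hyM
        · exact .inl ⟨rfl, h⟩
      refine .head ⟨⟨hA hx, hxM⟩, ⟨hA (mem_of_mem_erase hyA), hyM⟩, rfl⟩ (ih y ((erase_subset _ _).trans hA) hyM h ?_)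
      rintro ⟨v, hv, w, hw, h⟩; exact hb ⟨v, hv, w, hw, .inr h⟩
end

section
variable [hd : Fact (5 ≤ d)]
lemma nb_inj {x : V d} {e e' : E d} (h : nb x e = nb x e') : e = e' := by
  obtain ⟨i, b⟩ := e; obtain ⟨j, c⟩ := e'
  unfold nb at h
  have h1 := congrFun (add_left_cancel h) i
  simp only at h1
  simp only [Pi.single_eq_same] at h1
  by_cases hij : i = j
  · subst hij; simp only [Pi.single_eq_same] at h1
    cases b <;> cases c <;> simp_all [sg]
  · rw [Pi.single_eq_of_ne hij] at h1; cases b <;> simp [sg] at h1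
lemma adj_nb (x : V d) (e : E d) : adj x (nb x e) := by
  unfold adj
  have : ∀ i, |x i - nb x e i| = if i = e.1 then 1 else 0 := fun i => by
    split_ifs with h
    · subst h; simp [nb]; cases e.2 <;> simp [sg]
    · simp [nb, Pi.single_eq_of_ne h]
  simp [this]
lemma adj_ex {x y : V d} (h : adj x y) : ∃ e, y = nb x e := by
  unfold adj at h
  have h0 : ∃ i, x i - y i ≠ 0 := by
    by_contra hc; push Not at hc; simp [hc] at h
  obtain ⟨i, hi⟩ := h0
  have h1 : 1 ≤ |x i - y i| := Int.one_le_abs hi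
  have h2 := Finset.add_sum_erase Finset.univ (fun i => |x i - y i|) (mem_univ i)
  have h3 : ∑ j ∈ Finset.univ.erase i, |x j - y j| = 0 := by
    have := sum_nonneg (s := Finset.univ.erase i) (fun j _ => abs_nonneg (x j - y j))
    linarith
  have h4 := (Finset.sum_eq_zero_iff_of_nonneg fun j _ => abs_nonneg _).mp h3
  have h5 : |x i - y i| = 1 := by linarith
  have h6 : ∀ j, j ≠ i → y j = x j := fun j hj => by
    have := h4 j (by simp [hj]); rw [abs_eq_zero] at this; linarith
  rcases (abs_eq (by norm_num)).mp h5 with h | h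
  · refine ⟨(i, false), funext fun j => ?_⟩
    by_cases hj : j = i
    · subst hj; simp [nb, sg]; linarith
    · simp [nb, Pi.single_eq_of_ne hj, h6 j hj]
  · refine ⟨(i, true), funext fun j => ?_⟩
    by_cases hj : j = i
    · subst hj; simp [nb, sg]; linarith
    · simp [nb, Pi.single_eq_of_ne hj, h6 j hj]
def Tr (A : Finset (V d)) (σ : V d → E d) : Set (Sym2 (V d)) := {e | ∃ x ∈ A, e = s(x, nb x (σ x))}
section tr
variable {A : Finset (V d)} {σ τ : V d → E d}
lemma no2 {R : Set (V d)} {x : V d} (h : Hit σ A R x) : x ∈ A → nb x (σ x) ∈ A → nb (nb x (σ x)) (σ (nb x (σ x))) = x → False := by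
  induction h with
  | base x h1 h2 => exact fun h => absurd h h1
  | step x h1 _ ih => exact fun h2 h3 h4 => ih h3 (by rw [h4]; exact h2) (by rw [h4])
lemma Tr_inj1 (h : ac A σ) : Set.InjOn (fun x => s(x, nb x (σ x))) (A : Set (V d)) := fun x hx y hy hxy => by
  rcases Sym2.eq_iff.mp hxy with h1 | h1
  · exact h1.1
  · exfalso; refine no2 (h x) hx (by rw [h1.2]; exact hy) (by rw [h1.2, ← h1.1])
lemma Tr_eq : Tr A σ = (fun x => s(x, nb x (σ x))) '' (A : Set (V d)) := by
  ext e; simp only [Tr, Set.mem_setOf_eq, Set.mem_image, Finset.mem_coe]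
  exact exists_congr fun x => and_congr_right fun _ => eq_comm
lemma Tr_card (h : ac A σ) : (Tr A σ).ncard = A.card := by
  rw [Tr_eq, Set.ncard_image_of_injOn (Tr_inj1 h), Set.ncard_coe_finset]
lemma Tr_mem (h : ac A σ) : Tr A σ ∈ wiredSpanningTrees (A : Set (V d)) := by
  refine ⟨?_, by rw [Tr_card h, Set.ncard_coe_finset], ?_⟩
  · rintro e ⟨x, hx, rfl⟩
    exact ⟨⟨x, _, rfl, adj_nb _ _⟩, x, by simp, hx⟩
  · suffices hs : ∀ x, ∃ l : List (V d), l.IsChain (fun u w => adj u w ∧ s(u, w) ∈ Tr A σ) ∧ l.head? = some x ∧ ∃ y, l.getLast? = some y ∧ y ∉ (A : Set (V d)) from fun x _ => hs x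
    intro x
    have hh := h x
    induction hh with
    | base x h1 h2 => exact ⟨[x], List.isChain_singleton _, rfl, x, rfl, h1⟩
    | step x h1 _ ih =>
      obtain ⟨l, h2, h3, y, h4, h5⟩ := ih
      refine ⟨x :: l, ?_, rfl, y, ?_, h5⟩
      · cases l with
        | nil => simp at h3
        | cons z l =>
          simp only [List.head?_cons, Option.some.injEq] at h3
          exact List.isChain_cons_cons.mpr ⟨h3 ▸ ⟨adj_nb _ _, x, h1, rfl⟩, h2⟩
      · cases l with
        | nil => simp at h3
        | cons z l => rw [List.getLast?_cons_cons]; exact h4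
lemma Tr_inj (h : ac A σ) (hT : Tr A σ = Tr A τ) : ∀ x ∈ A, σ x = τ x := by
  intro x hx
  have hh := h x
  induction hh with
  | base x h1 _ => exact absurd hx h1
  | step x h1 h2 ih =>
    have : s(x, nb x (σ x)) ∈ Tr A τ := hT ▸ ⟨x, h1, rfl⟩
    obtain ⟨y, hy, hxy⟩ := this
    rcases Sym2.eq_iff.mp hxy with h3 | h3
    · obtain ⟨rfl, h4⟩ := h3; exact nb_inj h4
    · exfalso
      have h5 := ih (h3.2 ▸ hy)
      refine no2 (h x) h1 (h3.2 ▸ hy) ?_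
      rw [h5, h3.2, ← h3.1]
def Rn (T : Set (Sym2 (V d))) (A : Finset (V d)) : ℕ → V d → Prop
  | 0, x => x ∉ A
  | n + 1, x => ∃ e, s(x, nb x e) ∈ T ∧ Rn T A n (nb x e)
lemma Rn_list {T : Set (Sym2 (V d))} : ∀ (l : List (V d)) (x : V d), l.IsChain (fun u w => adj u w ∧ s(u, w) ∈ T) → l.head? = some x →
    (∃ y, l.getLast? = some y ∧ y ∉ (A : Set (V d))) → ∃ n, Rn T A n x
  | [], _, _, h, _ => by simp at h
  | [z], x, _, h, ⟨y, h1, h2⟩ => by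
    simp at h h1; subst h; subst h1; exact ⟨0, h2⟩
  | z :: w :: l, x, hc, h, ⟨y, h1, h2⟩ => by
    simp only [List.head?_cons, Option.some.injEq] at h; subst h
    rw [List.isChain_cons_cons] at hc
    rw [List.getLast?_cons_cons] at h1
    obtain ⟨n, hn⟩ := Rn_list (w :: l) w hc.2 rfl ⟨y, h1, h2⟩
    obtain ⟨e, rfl⟩ := adj_ex hc.1.1
    exact ⟨n + 1, e, hc.1.2, hn⟩
lemma Tr_surj (hA : A.Nonempty) {T : Set (Sym2 (V d))} (hT : T ∈ wiredSpanningTrees (A : Set (V d))) : ∃ σ : V d → E d, ac A σ ∧ Tr A σ = T := by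
  obtain ⟨h1, h2, h3⟩ := hT
  have h4 : ∀ x ∈ A, ∃ n, Rn T A n x := fun x hx => by
    obtain ⟨l, a, b, c⟩ := h3 x hx; exact Rn_list l x a b c
  have h5 : ∀ x, ∃ e : E d, x ∈ A → s(x, nb x e) ∈ T ∧ ∀ n, Rn T A n x → ∃ m < n, Rn T A m (nb x e) := fun x => by
    by_cases hx : x ∈ A
    · have hf := Nat.find_spec (h4 x hx)
      generalize hn : Nat.find (h4 x hx) = n at hf
      cases n with
      | zero => exact absurd hx hf
      | succ n =>
        obtain ⟨e, he, he'⟩ := hf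
        exact ⟨e, fun _ => ⟨he, fun m hm => ⟨n, by have := Nat.find_min' (h4 x hx) hm; omega, he'⟩⟩⟩
    · exact ⟨(0, true), fun h => absurd h hx⟩
  choose σ hσ using h5
  have hac : ac A σ := by
    have key : ∀ n x, Rn T A n x → Hit σ A {y | y ∉ A} x := fun n => by
      induction n using Nat.strong_induction_on with
      | _ n ih =>
        intro x hx
        by_cases hxA : x ∈ A
        · obtain ⟨m, hm, h⟩ := (hσ x hxA).2 n hx
          exact .step x hxA (ih m hm _ h)
        · exact .base x hxA hxA
    intro x
    by_cases hxA : x ∈ A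
    · obtain ⟨n, hn⟩ := h4 x hxA; exact key n x hn
    · exact .base x hxA hxA
  refine ⟨σ, hac, ?_⟩
  have hc : T.ncard = A.card := by rw [h2, Set.ncard_coe_finset]
  refine Set.eq_of_subset_of_ncard_le ?_ (by rw [Tr_card hac, hc]) (Set.finite_of_ncard_ne_zero ?_)
  · rintro e ⟨x, hx, rfl⟩; exact (hσ x hx).1
  · rw [hc]; exact hA.card_pos.ne'
lemma Tr_loc (h : ∀ x ∈ A, σ x = τ x) : Tr A σ = Tr A τ := by
  ext e; exact exists_congr fun x => and_congr_right fun hx => by rw [h x hx]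
lemma ncard_P (hA : A.Nonempty) (P : Set (Sym2 (V d)) → Prop) :
    ({T ∈ wiredSpanningTrees (A : Set (V d)) | P T}.ncard : ℝ) = Su A (fun σ => ib (ac A σ) * ib (P (Tr A σ))) := by
  have e1 : {T ∈ wiredSpanningTrees (A : Set (V d)) | P T} =
      (fun σ : A → E d => Tr A (ex σ)) '' ({σ : A → E d | ac A (ex σ) ∧ P (Tr A (ex σ))}) := by
    ext T; constructor
    · rintro ⟨h1, h2⟩
      obtain ⟨σ, h3, rfl⟩ := Tr_surj hA h1
      have hl : ∀ x ∈ A, σ x = ex (fun y : A => σ y) x := fun x hx => by simp [ex, hx]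
      refine ⟨fun y => σ y, ⟨(ac_loc hl).mp h3, Tr_loc hl ▸ h2⟩, (Tr_loc hl).symm⟩
    · rintro ⟨σ, ⟨h1, h2⟩, rfl⟩
      exact ⟨Tr_mem h1, h2⟩
  rw [e1, Set.ncard_image_of_injOn]
  · rw [show {σ : A → E d | ac A (ex σ) ∧ P (Tr A (ex σ))} = ((Finset.univ.filter fun σ : A → E d => ac A (ex σ) ∧ P (Tr A (ex σ)) : Finset _) : Set (A → E d)) by ext; simp,
      Set.ncard_coe_finset, Finset.card_eq_sum_ones, Nat.cast_sum, Finset.sum_filter]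
    unfold Su
    refine sum_congr rfl fun σ _ => ?_
    show _ = ib (ac A (ex σ)) * ib (P (Tr A (ex σ)))
    rw [← ib_and]; simp [ib]
  · rintro σ ⟨h1, _⟩ τ ⟨_, _⟩ h
    ext1 ⟨x, hx⟩
    have := Tr_inj h1 h x hx
    simpa [ex, hx] using this
lemma ratio (hA : A.Nonempty) (P : Set (Sym2 (V d)) → Prop) :
    ({T ∈ wiredSpanningTrees (A : Set (V d)) | P T}.ncard : ℝ) / ((wiredSpanningTrees (A : Set (V d))).ncard : ℝ) = mean A A (fun σ => ib (P (Tr A σ))) := by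
  have := ncard_P hA (fun _ => True)
  simp only [and_true, Set.setOf_mem_eq, ib_true, mul_one] at this
  rw [ncard_P hA, this]; rfl
end tr
lemma lim_bound {Ds : ℕ → Set (V d)} {μ : Measure (Config d)} [IsProbabilityMeasure μ] (hμ : IsWiredLimit Ds μ) {Ev : Set (Config d)} (K : Finset (Sym2 (V d)))
    (hE : ∀ ω ω' : Config d, (∀ e ∈ K, ω e = ω' e) → ω ∈ Ev → ω' ∈ Ev) {ε : ℝ}
    (hb : ∀ᶠ r in Filter.atTop, ∃ A : Finset (V d), Ds r = A ∧ A.Nonempty ∧ mean A A (fun σ => ib ((fun e => decide (e ∈ Tr A σ)) ∈ Ev)) ≤ ε) :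
    (μ Ev).toReal ≤ ε := by
  set xt : (K → Bool) → Config d := fun f e => if h : e ∈ K then f ⟨e, h⟩ else false with hxt
  set F := Finset.univ.filter fun f : K → Bool => xt f ∈ Ev
  have h1 : Ev ⊆ ⋃ f ∈ F, cylEvent K (xt f) := fun ω hω => by
    simp only [Set.mem_iUnion]
    refine ⟨fun e => ω e, ?_, fun e he => by simp [hxt, he]⟩
    simp only [F, mem_filter, mem_univ, true_and]
    exact hE ω _ (fun e he => by simp [hxt, he]) hω
  have h2 : (μ Ev).toReal ≤ ∑ f ∈ F, (μ (cylEvent K (xt f))).toReal := by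
    rw [← ENNReal.toReal_sum fun f _ => measure_ne_top _ _]
    exact ENNReal.toReal_mono (ENNReal.sum_ne_top.mpr fun f _ => measure_ne_top _ _) ((measure_mono h1).trans (measure_biUnion_finset_le _ _))
  refine h2.trans (le_of_tendsto (tendsto_finsetSum F fun f _ => hμ K (xt f)) ?_)
  filter_upwards [hb] with r ⟨A, hA, hA0, hm⟩
  refine le_trans (le_of_eq ?_) (le_trans (mean_mono (U := A) (A := A) (F := fun σ => ∑ f ∈ F, ib (∀ e ∈ K, (e ∈ Tr A σ ↔ xt f e = true))) fun σ => ?_) hm)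
  · rw [mean_sum]; simp only [hA]
    exact sum_congr rfl fun f _ => ratio hA0 fun T => ∀ e ∈ K, (e ∈ T ↔ xt f e = true)
  · set ω : Config d := fun e => decide (e ∈ Tr A σ) with hω
    have h3 : ∀ f, (∀ e ∈ K, (e ∈ Tr A σ ↔ xt f e = true)) → ∀ e ∈ K, xt f e = ω e := fun f h e he => by
      rw [Bool.eq_iff_iff, ← h e he]; simp [hω]
    by_cases h : ω ∈ Ev
    · rw [ib_true h]
      calc _ ≤ ∑ f ∈ F, ib (f = (fun e : K => ω e)) := sum_le_sum fun f _ => by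
            refine ib_mono (q := f = (fun e : K => ω e)) fun hf => ?_
            ext1 ⟨e, he⟩
            rw [← h3 f hf e he]; simp [hxt, he]
        _ ≤ 1 := by
            refine (Finset.sum_le_univ_sum_of_nonneg fun f => ib_nonneg _).trans ?_
            rw [Fintype.sum_eq_single (fun e : K => ω e) fun f hf => ib_false hf]; exact ib_le _
    · rw [ib_false h]
      refine (sum_eq_zero fun f hf => ib_false fun h4 => h ?_).le
      exact hE _ _ (h3 f h4) (mem_filter.mp hf).2
end

section
variable [hd : Fact (5 ≤ d)]
lemma cube_eq (z : V d) (r : ℕ) : cube z r = (Q z r : Set (V d)) := by ext x; simp [cube, mem_Q]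
def rl (ω : Config d) (S : Set (V d)) (u v : V d) : Prop := u ∈ S ∧ v ∈ S ∧ adj u v ∧ ω s(u, v) = true
lemma rl_symm {ω : Config d} {S : Set (V d)} {u v : V d} (h : rl ω S u v) : rl ω S v u := by
  obtain ⟨h1, h2, h3, h4⟩ := h
  refine ⟨h2, h1, ?_, by rw [Sym2.eq_swap]; exact h4⟩
  unfold adj at *; rw [← h3]; exact sum_congr rfl fun i _ => abs_sub_comm _ _
lemma rl_comp {ω : Config d} {S : Set (V d)} (h0 : (0 : V d) ∈ S) {x : V d} (h : Relation.ReflTransGen (rl ω S) 0 x) : x ∈ comp0In S ω := by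
  induction h with
  | refl => exact ⟨[0], List.isChain_singleton _, rfl, rfl, by simpa using h0⟩
  | tail _ hr ih =>
    rename_i b c _
    obtain ⟨l, h1, h2, h3, h4⟩ := ih
    refine ⟨l ++ [c], ?_, ?_, by simp, ?_⟩
    · refine List.isChain_append.mpr ⟨h1, List.isChain_singleton _, fun u hu v hv => ?_⟩
      rw [h3] at hu; simp at hu hv; subst hu; subst hv; exact hr.2.2
    · cases l with
      | nil => simp at h2
      | cons a l => simpa using h2
    · intro v hv
      rcases List.mem_append.mp hv with hv | hv
      · exact h4 v hv
      · simp at hv; subst hv; exact hr.2.1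
lemma comp_mono {S S' : Set (V d)} (h : S ⊆ S') (ω : Config d) : comp0In S ω ⊆ comp0In S' ω := by
  rintro x ⟨l, h1, h2, h3, h4⟩; exact ⟨l, h1, h2, h3, fun v hv => h (h4 v hv)⟩
def EvM (N : ℕ) (D : Set (V d)) (t : ℝ) : Set (Config d) := {ω | ((cube 0 N ∩ comp0In D ω).ncard : ℝ) ≤ t}
noncomputable def wt (A : Finset (V d)) (σ : V d → E d) : Config d := fun e => decide (e ∈ Tr A σ)
lemma nc_mono (N : ℕ) {S S' : Set (V d)} (h : S ⊆ S') : (cube 0 N ∩ S).ncard ≤ (cube 0 N ∩ S').ncard :=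
  Set.ncard_le_ncard (Set.inter_subset_inter_right _ h) (Set.Finite.subset (by rw [cube_eq]; exact Finset.finite_toSet _) Set.inter_subset_left)
lemma EvM_anti (N : ℕ) {S S' : Set (V d)} (h : S ⊆ S') (t : ℝ) : EvM N S' t ⊆ EvM N S t := fun ω hω =>
  le_trans (Nat.cast_le.mpr (nc_mono N (comp_mono h ω))) (show _ ≤ t from hω)
lemma wt_rl {A : Finset (V d)} {σ : V d → E d} {S : Set (V d)} {x : V d} (hA : x ∈ A) (hx : x ∈ S) (hy : nb x (σ x) ∈ S) : rl (wt A σ) S x (nb x (σ x)) :=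
  ⟨hx, hy, adj_nb _ _, by simp only [wt, decide_eq_true_eq]; exact ⟨x, hA, rfl⟩⟩
lemma EvM_cyl (N M : ℕ) (D : Set (V d)) (t : ℝ) : ∀ ω ω' : Config d, (∀ e ∈ ((Q (0 : V d) M) ×ˢ (Q (0 : V d) M)).image (fun p => s(p.1, p.2)), ω e = ω' e) →
    ω ∈ EvM N (D ∩ cube 0 M) t → ω' ∈ EvM N (D ∩ cube 0 M) t := by
  intro ω ω' h hω
  have : comp0In (D ∩ cube 0 M) ω' ⊆ comp0In (D ∩ cube 0 M) ω := by
    rintro x ⟨l, h1, h2, h3, h4⟩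
    refine ⟨l, ?_, h2, h3, h4⟩
    refine List.IsChain.imp_of_mem_imp (fun u v hu hv huv => ⟨huv.1, ?_⟩) h1
    rw [h]
    · exact huv.2
    · have hu := (h4 u hu).2
      have hv := (h4 v hv).2
      rw [cube_eq] at hu hv
      exact Finset.mem_image.mpr ⟨(u, v), Finset.mem_product.mpr ⟨hu, hv⟩, rfl⟩
  exact le_trans (Nat.cast_le.mpr (nc_mono N this)) (show _ ≤ t from hω)
lemma main_lim {D : Set (V d)} {N : ℕ} (hD : cube 0 (4 * N) ⊆ D) {μ : Measure (Config d)} [IsProbabilityMeasure μ]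
    (hμ : IsWiredLimit (fun r => { x ∈ D | eudist x 0 ≤ (r : ℝ) }) μ) {t β K : ℝ}
    (H : ∀ (A : Finset (V d)) (M : ℕ), (A : Set (V d)) ⊆ D → Q 0 (4 * N) ⊆ A → 2 * N ≤ M → mean A A (fun σ => ib (wt A σ ∈ EvM N (D ∩ cube 0 M) t)) ≤ β + K / (M + 1)) :
    (μ (EvM N D t)).toReal ≤ β := by
  have h1 : ∀ M ≥ 2 * N, (μ (EvM N D t)).toReal ≤ β + K / ((M : ℝ) + 1) := fun M hM => by
    refine le_trans (ENNReal.toReal_mono (measure_ne_top _ _) (measure_mono (EvM_anti N (Set.inter_subset_left (t := cube 0 M)) t))) ?_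
    refine lim_bound hμ _ (EvM_cyl N M D t) ?_
    filter_upwards [Filter.eventually_ge_atTop (d * (4 * N))] with r hr
    have hsub : {x ∈ D | eudist x 0 ≤ (r : ℝ)} ⊆ (Q (0 : V d) r : Set (V d)) := by
      rintro x ⟨_, hx⟩
      rw [Finset.mem_coe, mem_Q]
      intro i
      have h2 : |(x i : ℝ)| ≤ r := by
        refine le_trans ?_ hx
        unfold eudist
        refine Real.abs_le_sqrt ?_
        have := single_le_sum (f := fun i => ((x i : ℝ) - (((0 : V d) i : ℤ) : ℝ)) ^ 2) (fun i _ => sq_nonneg _) (mem_univ i)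
        simpa using this
      simp; exact_mod_cast h2
    have hfin := (Finset.finite_toSet _).subset hsub
    have hQ : Q (0 : V d) (4 * N) ⊆ hfin.toFinset := fun x hx => by
      rw [Set.Finite.mem_toFinset]
      refine ⟨hD (by rw [cube_eq]; exact hx), ?_⟩
      unfold eudist
      rw [Real.sqrt_le_left (by positivity)]
      rw [mem_Q] at hx
      calc ∑ i, ((x i : ℝ) - (((0 : V d) i : ℤ) : ℝ)) ^ 2 ≤ ∑ _i : Fin d, (4 * N : ℝ) ^ 2 := sum_le_sum fun i _ => by
            refine sq_le_sq' ?_ ?_ <;> have := abs_le.mp (hx i) <;> simp at this ⊢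
            · exact_mod_cast this.1
            · exact_mod_cast this.2
        _ = d * (4 * N : ℝ) ^ 2 := by simp
        _ ≤ (d * (4 * N)) ^ 2 := by
            have : (1 : ℝ) ≤ d := by exact_mod_cast (by have := hd.out; omega : 1 ≤ d)
            nlinarith [mul_nonneg (mul_nonneg (zero_le_one.trans this) (sub_nonneg.2 this)) (sq_nonneg (4 * N : ℝ))]
        _ ≤ _ := by have : ((d * (4 * N) : ℕ) : ℝ) ≤ r := by exact_mod_cast hr
                    push_cast at this; exact pow_le_pow_left₀ (by positivity) this 2
    refine ⟨hfin.toFinset, by simp, ⟨0, hQ (Q_self _ _)⟩, ?_⟩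
    exact H _ M (by simp) hQ hM
  have h2 : Filter.Tendsto (fun M : ℕ => β + K / ((M : ℝ) + 1)) Filter.atTop (nhds (β + 0)) :=
    tendsto_const_nhds.add (tendsto_const_div_atTop_nhds_zero_nat K |>.comp (Filter.tendsto_add_atTop_nat 1) |>.congr fun M => by simp)
  rw [add_zero] at h2
  exact ge_of_tendsto h2 (Filter.eventually_atTop.mpr ⟨2 * N, h1⟩)
lemma path_pts {A : Finset (V d)} {σ : V d → E d} (hac : ac A σ) {N : ℕ} {S : Set (V d)} (hA : Q 0 N ⊆ A) (hS : (Q (0 : V d) N : Set (V d)) ⊆ S) (j : ℕ) (hj : j ≤ N) :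
    ∃ y ∈ Q (0 : V d) j, (∀ i < j, y ∉ Q (0 : V d) i) ∧ Relation.ReflTransGen (rl (wt A σ) S) 0 y := by
  cases j with
  | zero => exact ⟨0, Q_self _ _, by simp, .refl⟩
  | succ j =>
    have key : ∀ x, Hit σ A {y | y ∉ A} x → x ∈ Q (0 : V d) (j + 1) → Relation.ReflTransGen (rl (wt A σ) S) 0 x →
        ∃ y ∈ Q (0 : V d) (j + 1), (∀ i < j + 1, y ∉ Q (0 : V d) i) ∧ Relation.ReflTransGen (rl (wt A σ) S) 0 y := by
      intro x hx
      induction hx with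
      | base x h1 _ => exact fun h => absurd (hA (Q_mono _ hj h)) h1
      | step x h1 _ ih =>
        intro h2 h3
        by_cases h4 : x ∈ Q (0 : V d) j
        · have h5 := nb_mem_Q (σ x) h4
          exact ih h5 (h3.tail (wt_rl h1 (hS (Q_mono _ hj h2)) (hS (Q_mono _ hj h5))))
        · exact ⟨x, h2, fun i hi h5 => h4 (Q_mono _ (by omega) h5), h3⟩
    exact key 0 (hac 0) (Q_self _ _) .refl
lemma small {D : Set (V d)} {A : Finset (V d)} {N M : ℕ} (hAD : (A : Set (V d)) ⊆ D) (hA : Q 0 (4 * N) ⊆ A) (hM : 2 * N ≤ M) {t : ℝ} (ht : t < N + 1) :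
    mean A A (fun σ => ib (wt A σ ∈ EvM N (D ∩ cube 0 M) t)) ≤ 0 + 0 / (M + 1) := by
  rw [zero_div, add_zero]
  have h0 : mean A A (fun _ : V d → E d => (0 : ℝ)) = 0 := by simp [mean, Su]
  rw [← h0]
  refine mean_mono' fun σ hac => (ib_false fun h => ?_).le
  have hA' : Q (0 : V d) N ⊆ A := (Q_mono _ (by omega)).trans hA
  have hS : (Q (0 : V d) N : Set (V d)) ⊆ D ∩ cube 0 M := fun x hx => ⟨hAD (hA' hx), by rw [cube_eq]; exact Q_mono _ (by omega) hx⟩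
  have hp : ∀ j : ℕ, ∃ y : V d, j ≤ N → (y ∈ Q (0 : V d) j ∧ (∀ i < j, y ∉ Q (0 : V d) i) ∧ Relation.ReflTransGen (rl (wt A σ) (D ∩ cube 0 M)) 0 y) := fun j => by
    by_cases hj : j ≤ N
    · obtain ⟨y, h⟩ := path_pts hac hA' hS j hj; exact ⟨y, fun _ => h⟩
    · exact ⟨0, fun h => absurd h hj⟩
  choose y hy using hp
  have inj : Set.InjOn y (Finset.range (N + 1)) := fun i hi j hj hij => by
    have hi' := mem_range.mp hi
    have hj' := mem_range.mp hj
    rcases lt_trichotomy i j with h | h | h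
    · exact absurd (hij ▸ (hy i (by omega)).1) ((hy j (by omega)).2.1 i h)
    · exact h
    · exact absurd (hij ▸ (hy j (by omega)).1) ((hy i (by omega)).2.1 j h)
  have h1 : N + 1 ≤ (cube 0 N ∩ comp0In (D ∩ cube 0 M) (wt A σ)).ncard := by
    have := Set.ncard_image_of_injOn inj
    rw [Set.ncard_coe_finset, Finset.card_range] at this
    rw [← this]
    refine Set.ncard_le_ncard ?_ (Set.Finite.subset (by rw [cube_eq]; exact Finset.finite_toSet _) Set.inter_subset_left)
    rintro _ ⟨j, hj, rfl⟩
    have hj' := mem_range.mp hj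
    refine ⟨by rw [cube_eq]; exact Q_mono _ (by omega) (hy j (by omega)).1, rl_comp (hS (Q_self _ _)) (hy j (by omega)).2.2⟩
  have h2 : ((N : ℝ) + 1) ≤ t := le_trans (by exact_mod_cast h1) h
  linarith
lemma suc_count {a : ℝ} (ha : 0 < a) {s : ℕ} {D : Set (V d)} {A : Finset (V d)} {N M k : ℕ} (hAD : (A : Set (V d)) ⊆ D) (hA : Q 0 (4 * N) ⊆ A) (hM : 2 * N ≤ M)
    (hk : ms d s k + 1 ≤ N) {σ : V d → E d} (hb : ¬ bad N M (pl σ A 0)) :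
    ((Finset.range k).filter fun j => Suc a s j (Q 0 (ms d s k)) (pl σ A 0).toFinset σ).card * (a * (s : ℝ) ^ 4 / 2) ≤
      ((cube 0 N ∩ comp0In (D ∩ cube 0 M) (wt A σ)).ncard : ℝ) := by
  set γ := (pl σ A 0).toFinset with hγ
  set S := D ∩ cube (0 : V d) M with hSd
  set X := (Q (0 : V d) N).filter fun x => x ∈ comp0In S (wt A σ) with hX
  have hNA : Q (0 : V d) N ⊆ A := (Q_mono _ (by omega)).trans hA
  have hNS : ∀ x ∈ Q (0 : V d) N, x ∈ S := fun x hx => ⟨hAD (hNA hx), by rw [cube_eq]; exact Q_mono _ (by omega) hx⟩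
  have eX : (cube 0 N ∩ comp0In S (wt A σ)) = (X : Set (V d)) := by rw [cube_eq, hX]; ext x; simp
  rw [eX, Set.ncard_coe_finset]
  have key : ∀ x, Hit σ (Q 0 (ms d s k) \ γ) γ x → x ∈ Q (0 : V d) N → Relation.ReflTransGen (rl (wt A σ) S) 0 x := fun x hx => by
    induction hx with
    | base x h1 h2 =>
      intro hx
      have := pl_con (by omega : N ≤ M) hx (A0 := A) A 0 le_rfl (Q_self _ _) (by simpa [hγ] using h2) hb
      refine Relation.ReflTransGen.mono (fun u v h => ?_) _ _ this
      obtain ⟨⟨h3, h3'⟩, ⟨h4, h4'⟩, rfl⟩ := h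
      exact wt_rl h3 ⟨hAD h3, by rw [cube_eq]; exact h3'⟩ ⟨hAD h4, by rw [cube_eq]; exact h4'⟩
    | step x h1 _ ih =>
      intro hx
      have h2 := Q_mono _ hk (nb_mem_Q (σ x) (mem_sdiff.mp h1).1)
      exact (ih h2).tail (rl_symm (wt_rl (hNA hx) (hNS _ hx) (hNS _ h2)))
  set J := (Finset.range k).filter fun j => Suc a s j (Q 0 (ms d s k)) γ σ with hJ
  set sh : ℕ → Finset (V d) := fun j => X ∩ (Q 0 (ms d s (j + 1)) \ Q 0 (ms d s j + 1)) with hsh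
  have h1 : ∀ j ∈ J, a * (s : ℝ) ^ 4 / 2 ≤ ((sh j).card : ℝ) := fun j hj => by
    rw [hJ, mem_filter, mem_range] at hj
    obtain ⟨hjk, z, hz, h⟩ := hj
    refine h.trans ?_
    unfold Yn
    rw [Finset.card_eq_sum_ones, Nat.cast_sum]
    refine le_trans (sum_le_sum (g := fun x => ib (x ∈ sh j)) fun x hx => ib_mono fun hh => ?_) ?_
    · have hx' := hz hx
      have hxN : x ∈ Q (0 : V d) N := Q_mono _ ((ms_mono s (by omega : j + 1 ≤ k)).trans (by omega)) (mem_sdiff.mp hx').1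
      refine mem_inter.mpr ⟨mem_filter.mpr ⟨hxN, rl_comp (hNS 0 (Q_self _ _)) (key x hh hxN)⟩, hx'⟩
    · calc ∑ x ∈ Q z (rho d s), ib (x ∈ sh j) = ∑ x ∈ (Q z (rho d s)).filter (· ∈ sh j), (1 : ℝ) := by
            rw [Finset.sum_filter]; exact sum_congr rfl fun x _ => by unfold ib; split_ifs <;> rfl
        _ ≤ ∑ x ∈ sh j, ((1 : ℕ) : ℝ) := by
          push_cast
          exact sum_le_sum_of_subset_of_nonneg (fun x hx => (mem_filter.mp hx).2) fun _ _ _ => by norm_num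
  have dj : ∀ i j x, i < j → x ∈ sh i → x ∉ sh j := fun i j x hij hi hj => by
    refine (mem_sdiff.mp (mem_inter.mp hj).2).2 (Q_mono _ ?_ (mem_sdiff.mp (mem_inter.mp hi).2).1)
    exact (ms_mono s (by omega : i + 1 ≤ j)).trans (by omega)
  have h2 : ∑ j ∈ J, (sh j).card ≤ X.card := by
    rw [← Finset.card_biUnion]
    · exact Finset.card_le_card (biUnion_subset.mpr fun j _ => Finset.inter_subset_left)
    · intro i _ j _ hij
      rw [Function.onFun, Finset.disjoint_left]
      intro x hi hj
      rcases lt_or_gt_of_ne hij with h | h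
      · exact dj i j x h hi hj
      · exact dj j i x h hj hi
  calc (J.card : ℝ) * (a * (s : ℝ) ^ 4 / 2) = ∑ j ∈ J, a * (s : ℝ) ^ 4 / 2 := by simp
    _ ≤ ∑ j ∈ J, ((sh j).card : ℝ) := sum_le_sum h1
    _ ≤ _ := by exact_mod_cast h2
lemma fin_bound : ∃ a q : ℝ, 0 < a ∧ 0 < q ∧ q < 1 ∧ ∃ i0 : ℕ, ∀ (D : Set (V d)) (A : Finset (V d)) (N' N M i k n0 : ℕ) (t : ℝ), i0 ≤ i → (A : Set (V d)) ⊆ D → Q 0 (4 * N) ⊆ A → La d * N' ≤ N →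
    4 * MM d * sc d i ≤ N' → ms d (sc d i) k + 1 ≤ N' → 2 * N ≤ M → t < a * (sc d i : ℝ) ^ 4 * (n0 + 1) →
    mean A A (fun σ => ib (wt A σ ∈ EvM N (D ∩ cube 0 M) t)) ≤ 2 ^ n0 * q ^ k + Cg d ^ 2 * (6 * (2 * N + 1)) ^ d / (M + 1) := by
  obtain ⟨a, q, ha, hq, hq1, i0, H⟩ := comb (d := d)
  refine ⟨a / 2, q, by positivity, hq, hq1, i0, ?_⟩
  intro D A N' N M i k n0 t hi hAD hA hN h4 hk hM ht
  set s := sc d i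
  set γ : (V d → E d) → Finset (V d) := fun σ => (pl σ A 0).toFinset
  set P : (V d → E d) → ℝ := fun σ => ∏ j ∈ Finset.range k, (1 - 1 / 2 * ib (Suc a s j (Q 0 (ms d s k)) (γ σ) σ)) with hP
  have P0 : ∀ σ, 0 ≤ P σ := fun σ => Finset.prod_nonneg fun j _ => by
    have := ib_le (Suc a s j (Q 0 (ms d s k)) (γ σ) σ); linarith
  have h1 : ∀ σ, ib (wt A σ ∈ EvM N (D ∩ cube 0 M) t) ≤ 2 ^ n0 * P σ + 1 * ib (bad N M (pl σ A 0)) := fun σ => by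
    by_cases hb : bad N M (pl σ A 0)
    · rw [ib_true hb]; have := ib_le (wt A σ ∈ EvM N (D ∩ cube 0 M) t)
      have := mul_nonneg (pow_nonneg (by norm_num : (0 : ℝ) ≤ 2) n0) (P0 σ); linarith
    rw [ib_false hb, mul_zero, add_zero]
    by_cases he : wt A σ ∈ EvM N (D ∩ cube 0 M) t
    · rw [ib_true he]
      have hkN : ms d s k + 1 ≤ N := by have := La_ge (d := d); nlinarith
      have h2 := (suc_count ha hAD hA hM hkN hb).trans he
      set J := (Finset.range k).filter fun j => Suc a s j (Q 0 (ms d s k)) (pl σ A 0).toFinset σ with hJ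
      have s0 : (0 : ℝ) < s := by exact_mod_cast sc_one i
      have h3 : J.card ≤ n0 := by
        have : (J.card : ℝ) < n0 + 1 := by
          by_contra hc; push Not at hc
          have := mul_le_mul_of_nonneg_right hc (by positivity : 0 ≤ a * (s : ℝ) ^ 4 / 2)
          linarith
        have : J.card < n0 + 1 := by exact_mod_cast this
        omega
      have h4 : P σ = (1 / 2) ^ J.card := by
        rw [hJ, ← Finset.prod_const, Finset.prod_filter]
        refine prod_congr rfl fun j _ => ?_
        split_ifs with h
        · rw [ib_true h]; norm_num
        · rw [ib_false h]; norm_num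
      rw [h4]
      have : ((1 : ℝ) / 2) ^ n0 ≤ (1 / 2) ^ J.card := pow_le_pow_of_le_one (by norm_num) (by norm_num) h3
      calc (1 : ℝ) = 2 ^ n0 * (1 / 2) ^ n0 := by rw [← mul_pow]; norm_num
        _ ≤ _ := mul_le_mul_of_nonneg_left this (by positivity)
    · rw [ib_false he]; exact mul_nonneg (by positivity) (P0 σ)
  refine (mean_mono h1).trans ?_
  rw [mean_lin, one_mul]
  exact add_le_add (mul_le_mul_of_nonneg_left (H A N' N i k hi hA hN h4 hk) (by positivity)) (ret hM)
end

section
variable [hd : Fact (5 ≤ d)]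
lemma sc_find (i0 : ℕ) {v : ℝ} (hv : (sc d i0 : ℝ) ≤ v) : ∃ i, i0 ≤ i ∧ v ≤ sc d i ∧ (sc d i : ℝ) ≤ 2 * v := by
  have h : ∃ i, i0 ≤ i ∧ v ≤ sc d i := by
    refine ⟨i0 + ⌈v⌉₊, by omega, (Nat.le_ceil v).trans ?_⟩
    have : ∀ n, n ≤ sc d (i0 + n) := fun n => by
      induction n with
      | zero => omega
      | succ n ih => have h1 := sc_succ (d := d) (i0 + n); have h2 := sc_one (d := d) (i0 + n); rw [← add_assoc, h1]; omega
    exact_mod_cast this _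
  have v0 : 0 ≤ v := le_trans (by positivity) hv
  refine ⟨Nat.find h, (Nat.find_spec h).1, (Nat.find_spec h).2, ?_⟩
  have hm := fun j => Nat.find_min h (m := j)
  have h1 := (Nat.find_spec h).1
  rcases h1.eq_or_lt with h2 | h2
  · rw [← h2]; linarith
  · obtain ⟨j, hj⟩ : ∃ j, Nat.find h = j + 1 := ⟨Nat.find h - 1, by omega⟩
    have h3 : ¬ (v ≤ sc d j) := fun h4 => hm j (by omega) ⟨by omega, h4⟩
    rw [hj, sc_succ]; push_cast; push Not at h3; linarith
set_option maxHeartbeats 2000000 in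
lemma fin_thm : ∃ C c : ℝ, 0 < C ∧ 0 < c ∧
      ∀ (N : ℕ) (D : Set (V d)), 1 ≤ N → cube 0 (4 * N) ⊆ D →
      ∀ μ : Measure (Config d), IsProbabilityMeasure μ →
        IsWiredLimit (fun r => { x ∈ D | eudist x 0 ≤ (r : ℝ) }) μ →
      ∀ lam : ℝ, 0 < lam → (μ (EvM N D (lam * (N : ℝ) ^ 4))).toReal ≤ C * Real.exp (-c * lam ^ (-(1 / 3 : ℝ))) := by
  obtain ⟨a, q, ha, hq, hq1, i0, H⟩ := fin_bound (d := d)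
  obtain ⟨K0, hK0⟩ := exists_pow_lt_of_lt_one (by positivity : 0 < Real.exp (-1) / 2) hq1
  set B : ℝ := 2 * La d * (K0 + 4) * (MM d + 1) with hB
  have B0 : 0 ≤ B := by positivity
  set x : ℝ := sc d i0 + B / a with hx
  have hs1 : (1 : ℝ) ≤ sc d i0 := by exact_mod_cast sc_one (d := d) i0
  have hBa : 0 ≤ B / a := by positivity
  have hx1 : 1 ≤ x := by linarith
  have x0 : 0 < x := by linarith
  set y : ℝ := 1 / (a * x ^ 4) with hy
  have y0 : 0 < y := by positivity
  have hxy : a * x ^ 4 * y = 1 := by rw [hy]; field_simp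
  have hBy : B * x * y ≤ 1 := by
    have h1 : B ≤ a * x := by
      rw [hx]; have : a * (B / a) = B := by field_simp
      nlinarith
    have h2 : a * x ≤ a * x ^ 3 := by
      have : x ≤ x ^ 3 := le_self_pow₀ hx1 (by norm_num)
      exact mul_le_mul_of_nonneg_left this ha.le
    calc B * x * y ≤ (a * x ^ 3) * x * y := by gcongr; linarith
      _ = 1 := by rw [← hxy]; ring
  refine ⟨Real.exp 1, y, by positivity, y0, ?_⟩
  intro N D hN hD μ hp hμ lam hl
  set p : ℝ := lam ^ (1 / 3 : ℝ) with hpd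
  have p0 : 0 < p := Real.rpow_pos_of_pos hl _
  have hp3 : p ^ 3 = lam := by
    rw [hpd, ← Real.rpow_natCast, ← Real.rpow_mul hl.le]; norm_num
  have hpi : lam ^ (-(1 / 3 : ℝ)) = p⁻¹ := by rw [Real.rpow_neg hl.le]
  rw [hpi]
  have N0 : (0 : ℝ) < N := by exact_mod_cast hN
  set n0 := ⌊y * p⁻¹⌋₊ with hn0
  have hn1 : y * p⁻¹ < n0 + 1 := Nat.lt_floor_add_one _
  have hn2 : (n0 : ℝ) ≤ y * p⁻¹ := Nat.floor_le (by positivity)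
  have hfin : Real.exp (-(n0 : ℝ)) ≤ Real.exp 1 * Real.exp (-y * p⁻¹) := by
    rw [← Real.exp_add]; apply Real.exp_le_exp.mpr; linarith
  rcases Nat.eq_zero_or_pos n0 with h0 | h0
  · refine le_trans ?_ hfin
    rw [h0]; simp only [Nat.cast_zero, neg_zero, Real.exp_zero]
    exact measureReal_le_one (μ := μ)
  by_cases hs : lam * (N : ℝ) ^ 4 < N + 1
  · exact (main_lim hD hμ fun A M hAD hA hM => small hAD hA hM hs).trans (by positivity)
  refine le_trans ?_ hfin
  have hu : 1 ≤ p * N := by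
    by_contra hc; push Not at hc
    have : (p * N) ^ 3 < 1 := pow_lt_one₀ (by positivity) hc (by norm_num)
    rw [mul_pow, hp3] at this
    apply hs
    nlinarith
  obtain ⟨i, hi, hi1, hi2⟩ := sc_find (d := d) i0 (v := x * (p * N)) (by nlinarith)
  set s := sc d i with hsd
  have hsp : 1 ≤ s := sc_one i
  set N' := (K0 * n0 + 4) * ((MM d + 1) * s) with hN'
  have h0R : (1 : ℝ) ≤ n0 := by exact_mod_cast h0
  have hNN : La d * N' ≤ N := by
    have : (La d : ℝ) * N' ≤ N := by
      calc (La d : ℝ) * N' = La d * ((K0 * n0 + 4) * ((MM d + 1) * s)) := by rw [hN']; push_cast; ring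
        _ ≤ La d * (((K0 + 4) * (y * p⁻¹)) * ((MM d + 1) * (2 * (x * (p * N))))) := by
          gcongr
          nlinarith [(Nat.cast_nonneg K0 : (0 : ℝ) ≤ K0)]
        _ = (B * x * y) * N * (p⁻¹ * p) := by rw [hB]; ring
        _ ≤ 1 * N * 1 := by rw [inv_mul_cancel₀ p0.ne']; gcongr
        _ = N := by ring
    exact_mod_cast this
  have ht : lam * (N : ℝ) ^ 4 < a * (s : ℝ) ^ 4 * (n0 + 1) := by
    calc lam * (N : ℝ) ^ 4 = (a * x ^ 4 * y) * (p ^ 3 * N ^ 4) * (p * p⁻¹) := by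
            rw [hxy, hp3, mul_inv_cancel₀ p0.ne']; ring
      _ = a * (x * (p * N)) ^ 4 * (y * p⁻¹) := by ring
      _ < a * (x * (p * N)) ^ 4 * (n0 + 1) := mul_lt_mul_of_pos_left hn1 (by positivity)
      _ ≤ _ := by gcongr
  have hq2 : (2 : ℝ) ^ n0 * q ^ (K0 * n0) ≤ Real.exp (-(n0 : ℝ)) := by
    have e1 : Real.exp (-(n0 : ℝ)) = Real.exp (-1) ^ n0 := by rw [← Real.exp_nat_mul]; congr 1; ring
    rw [pow_mul, ← mul_pow, e1]
    exact pow_le_pow_left₀ (by positivity) (by linarith) _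
  refine (main_lim hD hμ fun A M hAD hA hM => H D A N' N M i (K0 * n0) n0 _ hi hAD hA hNN ?_ ?_ hM ht).trans hq2
  · rw [hN', ← hsd]; nlinarith [Nat.zero_le (K0 * n0 * ((MM d + 1) * s))]
  · rw [hN', ← hsd, ms]; nlinarith [Nat.zero_le (K0 * n0 * ((MM d + 1) * s)), Nat.zero_le (MM d * s)]
end

end

/-- Theorem 5.3.  Let `d ≥ 5`, `N ≥ 1`, `Q_{4N} ⊆ D ⊆ ℤ^d`, and let `𝒰 = 𝒰_D` be the
uniform spanning tree of the wired graph of `D` (the weak limit of the wired USTs of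
`D_r = { x ∈ D : |x| ≤ r }`), with `𝒰₀` the component of the origin.  There are
constants `C, c > 0`, depending only on `d`, such that for all `λ > 0`,
`P( |Q_N ∩ 𝒰₀| ≤ λ N⁴ ) ≤ C exp( -c λ^{-1/3} )`. -/
theorem wired_ust_component_volume_lower_tail :
    ∀ d : ℕ, 5 ≤ d → ∃ C c : ℝ, 0 < C ∧ 0 < c ∧
      ∀ (N : ℕ) (D : Set (V d)), 1 ≤ N → cube 0 (4 * N) ⊆ D →
      ∀ μ : Measure (Config d), IsProbabilityMeasure μ →
        IsWiredLimit (fun r => { x ∈ D | eudist x 0 ≤ (r : ℝ) }) μ →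
      ∀ lam : ℝ, 0 < lam →
        (μ { ω | ((cube 0 N ∩ comp0In D ω).ncard : ℝ) ≤ lam * (N : ℝ) ^ 4 }).toReal
          ≤ C * Real.exp (-c * lam ^ (-(1 / 3 : ℝ))) := by
  intro d h
  haveI : Fact (5 ≤ d) := ⟨h⟩
  exact fin_thm

end USFPaper
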